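/- Suppose f is smooth with support in the closed unit ball and g = 𝒯f is the corresponding thermoacoustic data. Then for every x ∈ B, ∫_S W(g)(y,|x−y|) dσ(y) = 0. -/

import Mathlib

open MeasureTheory Function

noncomputable section

/-- The constant `c_n`. -/
def cnConst (n : ℕ) : ℝ :=
  if Even n then (-1 : ℝ) ^ ((n - 2) / 2) / (2 * Real.pi) ^ (n / 2)
  else (-1 : ℝ) ^ ((n - 3) / 2) / (2 * (2 * Real.pi) ^ ((n - 1) / 2))

/-- The operator `v ↦ (1/s) v'(s)` on complex-valued functions. -/
def invDerivC (v : ℝ → ℂ) : ℝ → ℂ := fun s => deriv v s / (s : ℂ)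

/-- The operator `v ↦ (1/s) v'(s)` on real-valued functions. -/
def invDerivR (v : ℝ → ℝ) : ℝ → ℝ := fun s => deriv v s / s

/-- The free-space outgoing Green's function `G(s,λ)` of the Helmholtz equation. -/
def GreenG (n : ℕ) (s lam : ℝ) : ℂ :=
  if Even n then
    (cnConst n : ℂ) *
      (invDerivC^[(n - 2) / 2]
        (fun s' => ∫ t in Set.Ioi s',
          Complex.exp (Complex.I * lam * t) / (Real.sqrt (t ^ 2 - s' ^ 2) : ℂ)) s)
  else
    (cnConst n : ℂ) *
      (invDerivC^[(n - 3) / 2] (fun s' => Complex.exp (Complex.I * lam * s') / (s' : ℂ)) s)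

/-- The transform `W` on real-valued functions. -/
def Wtr (n : ℕ) (v : ℝ → ℝ) (s : ℝ) : ℝ :=
  if Even n then
    cnConst n * (invDerivR^[(n - 2) / 2]
      (fun s' => ∫ t in Set.Ioi s', v t / Real.sqrt (t ^ 2 - s' ^ 2)) s)
  else
    cnConst n * (invDerivR^[(n - 3) / 2] (fun s' => v s' / s') s)

/-- The transform `W` on complex-valued functions. -/
def WtrC (n : ℕ) (v : ℝ → ℂ) (s : ℝ) : ℂ :=
  if Even n then
    (cnConst n : ℂ) * (invDerivC^[(n - 2) / 2]
      (fun s' => ∫ t in Set.Ioi s', v t / (Real.sqrt (t ^ 2 - s' ^ 2) : ℂ)) s)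
  else
    (cnConst n : ℂ) * (invDerivC^[(n - 3) / 2] (fun s' => v s' / (s' : ℂ)) s)

abbrev Esp (n : ℕ) := EuclideanSpace ℝ (Fin n)

/-- The unit sphere centered at the origin. -/
def unitSphere (n : ℕ) : Set (Esp n) := Metric.sphere 0 1

/-- The surface measure: `(n-1)`-dimensional Hausdorff measure. -/
def sphMeasure (n : ℕ) : Measure (Esp n) := μH[(n : ℝ) - 1]

/-- The Laplacian, as the sum of second directional derivatives along coordinate axes. -/
def lapl {n : ℕ} (f : Esp n → ℝ) (x : Esp n) : ℝ :=
  ∑ i : Fin n, iteratedDeriv 2 (fun t : ℝ => f (x + t • EuclideanSpace.single i (1 : ℝ))) 0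

/-- The spherical Radon transform with centers on the unit sphere. -/
def RadonS (n : ℕ) (f : Esp n → ℝ) (y : Esp n) (r : ℝ) : ℝ :=
  ∫ ω in unitSphere n, f (y + r • ω) * r ^ (n - 1) ∂(sphMeasure n)

/-- The spherical means operator with centers on the unit sphere. -/
def Msph (n : ℕ) (f : Esp n → ℝ) (y : Esp n) (r : ℝ) : ℝ :=
  (1 / (sphMeasure n (unitSphere n)).toReal) * ∫ ω in unitSphere n, f (y + r • ω) ∂(sphMeasure n)

/-- The kernel `K_n(y,s)` built from the real and imaginary parts of `G`. -/
def Kker (n : ℕ) (f : Esp n → ℝ) (y : Esp n) (s : ℝ) : ℝ :=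
  ∫ lam in Set.Ioi (0 : ℝ),
    lam * (GreenG n s lam).re * ∫ r in Set.Ioi (0 : ℝ), RadonS n f y r * (GreenG n r lam).im

/-- The time Fourier transform `(1/2π) ∫ v(t) e^{iλt} dt` of a real-valued function. -/
def timeFT (v : ℝ → ℝ) (lam : ℝ) : ℂ :=
  (1 / (2 * Real.pi)) * ∫ t : ℝ, (v t : ℂ) * Complex.exp (Complex.I * lam * t)

/-- The operator `w ↦ d/dr (w(r)/r)`. -/
def DWop (w : ℝ → ℝ) : ℝ → ℝ := fun r => deriv (fun r' => w r' / r') r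

section Helpers

open Filter Topology
open scoped FourierTransform SchwartzMap

variable {n : ℕ}

lemma integral_fderiv_eq_zero_of_hasCompactSupport {n : ℕ} {g : Esp n → ℝ} (hg : ContDiff ℝ 1 g)
    (hs : HasCompactSupport g) (v : Esp n) : ∫ x, fderiv ℝ g x v = 0 := by
  have hc : Continuous fun x => fderiv ℝ g x v :=
    (hg.continuous_fderiv one_ne_zero).clm_apply continuous_const
  have hs' : HasCompactSupport fun x => fderiv ℝ g x v := hs.fderiv_apply ℝ v
  have := integral_mul_fderiv_eq_neg_fderiv_mul_of_integrable (μ := volume) (𝕜 := ℝ)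
    (f := fun _ : Esp n => (1:ℝ)) (g := g) (v := v) (by simp)
    (by simpa using hc.integrable_of_hasCompactSupport hs')
    (by simpa using hg.continuous.integrable_of_hasCompactSupport hs) (by fun_prop)
    (fun x _ => hg.differentiable one_ne_zero x)
  simpa using this

/-- The cut-off used in the local energy estimate. -/
def coneWeight (n : ℕ) (R : ℝ) (p : Esp n × ℝ) : ℝ :=
  expNegInvGlue (R - p.2 - √(1 + ‖p.1‖ ^ 2))

lemma sqrt_one_add_normSq_contDiff (n : ℕ) :
    ContDiff ℝ 2 fun p : Esp n × ℝ => √(1 + ‖p.1‖ ^ 2) := by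
  apply ContDiff.sqrt
  · exact contDiff_const.add (contDiff_fst.norm_sq ℝ)
  · intro p; positivity

lemma coneWeight_contDiff (n : ℕ) (R : ℝ) : ContDiff ℝ 2 (coneWeight n R) := by
  have h : ContDiff ℝ 2 expNegInvGlue := expNegInvGlue.contDiff (n := 2)
  refine h.comp ?_
  exact (contDiff_const.sub contDiff_snd).sub (sqrt_one_add_normSq_contDiff n)

lemma coneWeight_nonneg {n : ℕ} (R : ℝ) (p : Esp n × ℝ) : 0 ≤ coneWeight n R p :=
  expNegInvGlue.nonneg _

lemma coneWeight_eq_zero {n : ℕ} {R : ℝ} {p : Esp n × ℝ} (ht : 0 ≤ p.2) (hR : R ≤ ‖p.1‖) :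
    coneWeight n R p = 0 := by
  apply expNegInvGlue.zero_of_nonpos
  have : ‖p.1‖ ≤ √(1 + ‖p.1‖ ^ 2) := Real.le_sqrt_of_sq_le (by linarith)
  linarith

lemma coneWeight_hasFDerivAt {n : ℕ} (R : ℝ) (p q : Esp n × ℝ) :
    fderiv ℝ (coneWeight n R) p q =
      - deriv expNegInvGlue (R - p.2 - √(1 + ‖p.1‖ ^ 2)) *
        (q.2 + inner ℝ p.1 q.1 / √(1 + ‖p.1‖ ^ 2)) := by
  have h : HasDerivAt expNegInvGlue (deriv expNegInvGlue (R - p.2 - √(1 + ‖p.1‖ ^ 2)))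
      (R - p.2 - √(1 + ‖p.1‖ ^ 2)) :=
    ((expNegInvGlue.contDiff (n := 1)).differentiable one_ne_zero _).hasDerivAt
  have h1 : HasFDerivAt (fun p : Esp n × ℝ => 1 + ‖p.1‖ ^ 2) _ p :=
    ((hasFDerivAt_fst (𝕜 := ℝ) (p := p)).norm_sq).const_add 1
  have h2 := h1.sqrt (by positivity)
  have h3 := ((hasFDerivAt_snd (𝕜 := ℝ) (p := p)).const_sub R).sub h2
  have h4 := h.comp_hasFDerivAt p h3
  have h5 : HasFDerivAt (coneWeight n R) _ p := h4
  rw [h5.fderiv]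
  have : √(1 + ‖p.1‖ ^ 2) ≠ 0 := by positivity
  simp
  field_simp
  ring

lemma deriv_expNegInvGlue_nonneg (s : ℝ) : 0 ≤ deriv expNegInvGlue s :=
  expNegInvGlue.monotone.deriv_nonneg

/-- The partial derivative of `W` along `v`. -/
def dirD {n : ℕ} (W : Esp n × ℝ → ℝ) (v p : Esp n × ℝ) : ℝ := fderiv ℝ W p v

/-- The space direction number `i`. -/
def spaceDir {n : ℕ} (i : Fin n) : Esp n × ℝ := (EuclideanSpace.single i 1, 0)

/-- The time direction. -/
def timeDir (n : ℕ) : Esp n × ℝ := (0, 1)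

/-- The energy density of `W`. -/
def energyDensity {n : ℕ} (W : Esp n × ℝ → ℝ) (p : Esp n × ℝ) : ℝ :=
  dirD W (timeDir n) p ^ 2 + ∑ i, dirD W (spaceDir i) p ^ 2


lemma dirD_contDiff {W : Esp n × ℝ → ℝ} (hW : ContDiff ℝ 2 W) (v : Esp n × ℝ) :
    ContDiff ℝ 1 (dirD W v) :=
  (hW.fderiv_right (m := 1) (by norm_num)).clm_apply contDiff_const

lemma dirD_comm {W : Esp n × ℝ → ℝ} (hW : ContDiff ℝ 2 W) (v w p : Esp n × ℝ) :
    dirD (dirD W v) w p = dirD (dirD W w) v p := by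
  have hs : IsSymmSndFDerivAt ℝ W p := (hW.contDiffAt).isSymmSndFDerivAt (by simp)
  have hd : DifferentiableAt ℝ (fderiv ℝ W) p :=
    (hW.fderiv_right (m := 1) (by norm_num)).differentiable one_ne_zero p
  have key (v w : Esp n × ℝ) : dirD (dirD W v) w p = fderiv ℝ (fderiv ℝ W) p w v := by
    unfold dirD
    rw [fderiv_clm_apply hd (by fun_prop)]
    simp
  rw [key, key]
  exact hs w v

lemma dirD_mul {f g : Esp n × ℝ → ℝ} (hf : ContDiff ℝ 1 f) (hg : ContDiff ℝ 1 g)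
    (v p : Esp n × ℝ) : dirD (fun p => f p * g p) v p = dirD f v p * g p + f p * dirD g v p := by
  unfold dirD
  rw [fderiv_fun_mul (hf.differentiable one_ne_zero p) (hg.differentiable one_ne_zero p)]
  simp
  ring

lemma energyDensity_contDiff {W : Esp n × ℝ → ℝ} (hW : ContDiff ℝ 2 W) :
    ContDiff ℝ 1 (energyDensity W) := by
  unfold energyDensity
  exact ((dirD_contDiff hW _).pow 2).add (ContDiff.sum fun i _ => (dirD_contDiff hW _).pow 2)

lemma dirD_energyDensity {W : Esp n × ℝ → ℝ} (hW : ContDiff ℝ 2 W) (v p : Esp n × ℝ) :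
    dirD (energyDensity W) v p =
      2 * dirD W (timeDir n) p * dirD (dirD W (timeDir n)) v p +
        ∑ i, 2 * dirD W (spaceDir i) p * dirD (dirD W (spaceDir i)) v p := by
  have h (w : Esp n × ℝ) : HasFDerivAt (fun p => dirD W w p ^ 2)
      ((2 * dirD W w p) • fderiv ℝ (dirD W w) p) p := by
    simpa using ((dirD_contDiff hW w).differentiable one_ne_zero p).hasFDerivAt.pow 2
  have h2 := (h (timeDir n)).add (HasFDerivAt.fun_sum (u := Finset.univ) fun i _ => h (spaceDir i))
  unfold dirD
  rw [HasFDerivAt.fderiv (f := energyDensity W) h2]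
  simp
  rfl

lemma dirD_coneWeight_le (R : ℝ) (p : Esp n × ℝ) (a : ℝ) (b : Fin n → ℝ) :
    dirD (coneWeight n R) (timeDir n) p * (a ^ 2 + ∑ i, b i ^ 2) ≤
      ∑ i, 2 * dirD (coneWeight n R) (spaceDir i) p * a * b i := by
  set c := deriv expNegInvGlue (R - p.2 - √(1 + ‖p.1‖ ^ 2)) with hc
  have hc0 : 0 ≤ c := deriv_expNegInvGlue_nonneg _
  set N := √(1 + ‖p.1‖ ^ 2) with hN
  have hNpos : 0 < N := by positivity
  have h1 : dirD (coneWeight n R) (timeDir n) p = - c := by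
    simp [dirD, coneWeight_hasFDerivAt, timeDir, hc, hN]
  have h2 (i : Fin n) : dirD (coneWeight n R) (spaceDir i) p = - c * (p.1 i / N) := by
    simp [dirD, coneWeight_hasFDerivAt, spaceDir, hc, hN, EuclideanSpace.inner_single_right]
  have h3 : ∑ i, (p.1 i / N) ^ 2 ≤ 1 := by
    simp_rw [div_pow, ← Finset.sum_div]
    rw [div_le_one (by positivity), ← EuclideanSpace.real_norm_sq_eq, hN,
      Real.sq_sqrt (by positivity)]
    linarith
  rw [h1]
  have h4 : ∑ i, 2 * dirD (coneWeight n R) (spaceDir i) p * a * b i =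
      - c * ∑ i, 2 * (a * (p.1 i / N)) * b i := by
    rw [Finset.mul_sum]
    exact Finset.sum_congr rfl fun i _ => by rw [h2]; ring
  rw [h4]
  have h5 : ∑ i, 2 * (a * (p.1 i / N)) * b i ≤ a ^ 2 + ∑ i, b i ^ 2 := by
    calc ∑ i, 2 * (a * (p.1 i / N)) * b i ≤ ∑ i, (a ^ 2 * (p.1 i / N) ^ 2 + b i ^ 2) :=
          Finset.sum_le_sum fun i _ => by nlinarith [sq_nonneg (a * (p.1 i / N) - b i)]
      _ = a ^ 2 * ∑ i, (p.1 i / N) ^ 2 + ∑ i, b i ^ 2 := by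
          rw [Finset.sum_add_distrib, Finset.mul_sum]
      _ ≤ _ := by nlinarith [sq_nonneg a]
  nlinarith

lemma dirD_weighted_energy_le {W : Esp n × ℝ → ℝ} (hW : ContDiff ℝ 2 W) (R : ℝ) (p : Esp n × ℝ)
    (hwave : dirD (dirD W (timeDir n)) (timeDir n) p =
      ∑ i, dirD (dirD W (spaceDir i)) (spaceDir i) p) :
    dirD (fun p => coneWeight n R p * energyDensity W p) (timeDir n) p ≤
      ∑ i, dirD (fun p => coneWeight n R p * (2 * dirD W (timeDir n) p * dirD W (spaceDir i) p))
        (spaceDir i) p := by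
  have hP : ContDiff ℝ 1 (coneWeight n R) := (coneWeight_contDiff n R).of_le (by norm_num)
  have hT := dirD_contDiff hW (timeDir n)
  have hX (i : Fin n) := dirD_contDiff hW (spaceDir i)
  rw [dirD_mul hP (energyDensity_contDiff hW), dirD_energyDensity hW, hwave]
  have h1 (i : Fin n) : dirD (fun p => coneWeight n R p *
      (2 * dirD W (timeDir n) p * dirD W (spaceDir i) p)) (spaceDir i) p =
      2 * dirD (coneWeight n R) (spaceDir i) p * dirD W (timeDir n) p * dirD W (spaceDir i) p +
      coneWeight n R p * (2 * dirD W (timeDir n) p * dirD (dirD W (spaceDir i)) (spaceDir i) p +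
        2 * dirD W (spaceDir i) p * dirD (dirD W (spaceDir i)) (timeDir n) p) := by
    rw [dirD_mul hP ((contDiff_const.mul hT).mul (hX i)), dirD_mul (contDiff_const.mul hT) (hX i),
      dirD_mul contDiff_const hT, dirD_comm hW (timeDir n)]
    have : dirD (fun _ : Esp n × ℝ => (2:ℝ)) (spaceDir i) p = 0 := by simp [dirD]
    rw [this]; ring
  simp_rw [h1, Finset.sum_add_distrib, ← Finset.mul_sum, Finset.sum_add_distrib, ← Finset.mul_sum]
  have := dirD_coneWeight_le R p (dirD W (timeDir n) p) (fun i => dirD W (spaceDir i) p)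
  rw [energyDensity]
  linarith

lemma dirD_coneWeight_eq_zero {R : ℝ} {p : Esp n × ℝ} (ht : 0 ≤ p.2) (hR : R ≤ ‖p.1‖)
    (v : Esp n × ℝ) : dirD (coneWeight n R) v p = 0 := by
  have h1 : R - p.2 - √(1 + ‖p.1‖ ^ 2) < 0 := by
    have : ‖p.1‖ < √(1 + ‖p.1‖ ^ 2) := Real.lt_sqrt_of_sq_lt (by linarith)
    linarith
  have h2 : expNegInvGlue =ᶠ[nhds (R - p.2 - √(1 + ‖p.1‖ ^ 2))] fun _ => 0 := by
    filter_upwards [Iio_mem_nhds h1] with s hs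
    exact expNegInvGlue.zero_of_nonpos (le_of_lt hs)
  rw [dirD, coneWeight_hasFDerivAt, h2.deriv_eq]
  simp

lemma dirD_eq_slice {g : Esp n × ℝ → ℝ} (hg : ContDiff ℝ 1 g) (v x : Esp n) (t : ℝ) :
    dirD g (v, 0) (x, t) = fderiv ℝ (fun z => g (z, t)) x v := by
  have h1 : HasFDerivAt g (fderiv ℝ g (x, t)) (x, t) :=
    (hg.differentiable one_ne_zero _).hasFDerivAt
  have h2 := h1.comp x (hasFDerivAt_prodMk_left (𝕜 := ℝ) x t)
  have h3 : HasFDerivAt (fun z => g (z, t)) _ x := h2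
  rw [h3.fderiv]
  simp [dirD]

lemma dirD_time_hasDerivAt {g : Esp n × ℝ → ℝ} (hg : ContDiff ℝ 1 g) (x : Esp n) (t : ℝ) :
    HasDerivAt (fun t => g (x, t)) (dirD g (timeDir n) (x, t)) t := by
  have h1 : HasFDerivAt g (fderiv ℝ g (x, t)) (x, t) :=
    (hg.differentiable one_ne_zero _).hasFDerivAt
  have h2 := h1.comp_hasDerivAt t ((hasDerivAt_const t x).prodMk (hasDerivAt_id t))
  exact h2

lemma dirD_continuous {g : Esp n × ℝ → ℝ} (hg : ContDiff ℝ 1 g) (v : Esp n × ℝ) :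
    Continuous (dirD g v) :=
  (hg.continuous_fderiv one_ne_zero).clm_apply continuous_const

lemma weighted_energy_integral_nonpos {W : Esp n × ℝ → ℝ} (hW : ContDiff ℝ 2 W)
    (hwave : ∀ p : Esp n × ℝ, 0 ≤ p.2 → dirD (dirD W (timeDir n)) (timeDir n) p =
      ∑ i, dirD (dirD W (spaceDir i)) (spaceDir i) p)
    (h0 : ∀ x, energyDensity W (x, 0) = 0) (R : ℝ) {T : ℝ} (hT : 0 ≤ T) :
    ∫ x, coneWeight n R (x, T) * energyDensity W (x, T) ≤ 0 := by
  have hP : ContDiff ℝ 1 (coneWeight n R) := (coneWeight_contDiff n R).of_le (by norm_num)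
  have hE := energyDensity_contDiff hW
  set F : Esp n × ℝ → ℝ := fun p => coneWeight n R p * energyDensity W p with hF
  have hFc : ContDiff ℝ 1 F := hP.mul hE
  have hsupp {t : ℝ} (ht : 0 ≤ t) (g : Esp n → ℝ) :
      HasCompactSupport fun x => coneWeight n R (x, t) * g x := by
    refine HasCompactSupport.intro (isCompact_closedBall (0 : Esp n) R) fun x hx => ?_
    rw [coneWeight_eq_zero ht (by simpa using (not_le.1 (by simpa using hx)).le), zero_mul]
  have hDsupp (v p : Esp n × ℝ) (ht : 0 ≤ p.2) (hR : R ≤ ‖p.1‖) : dirD F v p = 0 := by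
    rw [hF, dirD_mul hP hE, dirD_coneWeight_eq_zero ht hR, coneWeight_eq_zero ht hR]; simp
  have hDc := dirD_continuous hFc (timeDir n)
  have h1 (x : Esp n) : F (x, T) = ∫ t in (0)..T, dirD F (timeDir n) (x, t) := by
    rw [intervalIntegral.integral_eq_sub_of_hasDerivAt (f := fun t => F (x, t))
      (fun t _ => dirD_time_hasDerivAt hFc x t)
      ((by fun_prop : Continuous fun t => dirD F (timeDir n) (x, t)).intervalIntegrable _ _)]
    simp [hF, h0]
  have hint : Integrable (uncurry fun (x : Esp n) (t : ℝ) => dirD F (timeDir n) (x, t))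
      (volume.prod (volume.restrict (Set.Ioc 0 T))) := by
    rw [← Measure.restrict_univ (μ := (volume : Measure (Esp n))), Measure.prod_restrict]
    have hK : IntegrableOn (dirD F (timeDir n))
        (Metric.closedBall (0 : Esp n) R ×ˢ Set.Icc 0 T) (volume.prod volume) :=
      hDc.continuousOn.integrableOn_compact ((isCompact_closedBall _ _).prod isCompact_Icc)
    refine IntegrableOn.of_forall_sdiff_eq_zero hK (MeasurableSet.univ.prod measurableSet_Ioc) ?_
    rintro ⟨x, t⟩ ⟨hp, hq⟩
    simp only [Set.mem_prod, Set.mem_univ, true_and, Set.mem_Ioc] at hp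
    refine hDsupp _ _ hp.1.le ?_
    by_contra! h
    exact hq ⟨by simpa using h.le, hp.1.le, hp.2⟩
  have h2 : ∫ x, F (x, T) = ∫ t in Set.Ioc 0 T, ∫ x, dirD F (timeDir n) (x, t) := by
    rw [← integral_integral_swap hint]
    refine integral_congr_ae (.of_forall fun x => ?_)
    simp only [h1 x, intervalIntegral.integral_of_le hT]
  change ∫ x, F (x, T) ≤ 0
  rw [h2]
  refine setIntegral_nonpos measurableSet_Ioc fun t ht => ?_
  have ht0 : 0 ≤ t := ht.1.le
  have hTc := dirD_contDiff hW (timeDir n)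
  have hXc (i : Fin n) := dirD_contDiff hW (spaceDir i)
  set G : Fin n → Esp n × ℝ → ℝ := fun i p =>
    coneWeight n R p * (2 * dirD W (timeDir n) p * dirD W (spaceDir i) p) with hG
  have hGc (i : Fin n) : ContDiff ℝ 1 (G i) := hP.mul ((contDiff_const.mul hTc).mul (hXc i))
  have hGs (i : Fin n) : ContDiff ℝ 1 fun z => G i (z, t) :=
    (hGc i).comp (contDiff_id.prodMk contDiff_const)
  have hGsupp (i : Fin n) : HasCompactSupport fun z => G i (z, t) := hsupp ht0 _
  have hGi (i : Fin n) : Integrable fun x => dirD (G i) (spaceDir i) (x, t) := by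
    have hc : Continuous fun x => dirD (G i) (spaceDir i) (x, t) :=
      (dirD_continuous (hGc i) _).comp (by fun_prop)
    refine hc.integrable_of_hasCompactSupport ?_
    have := (hGsupp i).fderiv_apply ℝ (EuclideanSpace.single i 1)
    simpa only [spaceDir, dirD_eq_slice (hGc i)] using this
  have hGz (i : Fin n) : ∫ x, dirD (G i) (spaceDir i) (x, t) = 0 := by
    simp only [spaceDir, dirD_eq_slice (hGc i)]
    exact integral_fderiv_eq_zero_of_hasCompactSupport (hGs i) (hGsupp i) _
  calc ∫ x, dirD F (timeDir n) (x, t)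
      ≤ ∫ x, ∑ i, dirD (G i) (spaceDir i) (x, t) := by
        refine integral_mono ?_ (integrable_finsetSum _ fun i _ => hGi i) fun x => ?_
        · have hc : Continuous fun x : Esp n => dirD F (timeDir n) (x, t) := hDc.comp (by fun_prop)
          refine hc.integrable_of_hasCompactSupport
            (HasCompactSupport.intro (isCompact_closedBall (0 : Esp n) R) fun x hx => ?_)
          exact hDsupp _ _ ht0 (by simpa using (not_le.1 (by simpa using hx)).le)
        · exact dirD_weighted_energy_le hW R (x, t) (hwave (x, t) ht0)
    _ = 0 := by
        rw [integral_finsetSum _ fun i _ => hGi i]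
        exact Finset.sum_eq_zero fun i _ => hGz i

theorem wave_eq_zero {W : Esp n × ℝ → ℝ} (hW : ContDiff ℝ 2 W)
    (hwave : ∀ p : Esp n × ℝ, 0 ≤ p.2 → dirD (dirD W (timeDir n)) (timeDir n) p =
      ∑ i, dirD (dirD W (spaceDir i)) (spaceDir i) p)
    (h0 : ∀ x, W (x, 0) = 0) (h1 : ∀ x, dirD W (timeDir n) (x, 0) = 0)
    (x : Esp n) {T : ℝ} (hT : 0 ≤ T) : W (x, T) = 0 := by
  have hW1 : ContDiff ℝ 1 W := hW.of_le (by norm_num)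
  have hE := energyDensity_contDiff hW
  have hE0 (x : Esp n) : energyDensity W (x, 0) = 0 := by
    have h2 (i : Fin n) : dirD W (spaceDir i) (x, 0) = 0 := by
      rw [spaceDir, dirD_eq_slice hW1]
      simp [h0]
    simp [energyDensity, h1, h2]
  have hEnn (p : Esp n × ℝ) : 0 ≤ energyDensity W p := by
    unfold energyDensity; positivity
  have hz {t : ℝ} (ht : 0 ≤ t) : dirD W (timeDir n) (x, t) = 0 := by
    set R := t + √(1 + ‖x‖ ^ 2) + 1 with hR
    have hpos : 0 < coneWeight n R (x, t) := expNegInvGlue.pos_of_pos (by simp only [hR]; linarith)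
    have hle := weighted_energy_integral_nonpos hW hwave hE0 R ht
    have hc : Continuous fun z : Esp n => coneWeight n R (z, t) * energyDensity W (z, t) :=
      ((coneWeight_contDiff n R).continuous.mul hE.continuous).comp (by fun_prop)
    have hs : HasCompactSupport fun z : Esp n => coneWeight n R (z, t) * energyDensity W (z, t) := by
      refine HasCompactSupport.intro (isCompact_closedBall (0 : Esp n) R) fun x hx => ?_
      rw [coneWeight_eq_zero ht (by simpa using (not_le.1 (by simpa using hx)).le), zero_mul]
    have hEx : energyDensity W (x, t) = 0 := by
      by_contra hne
      exact absurd (hc.integral_pos_of_hasCompactSupport_nonneg_nonzero (μ := volume) hs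
        (fun z => mul_nonneg (coneWeight_nonneg _ _) (hEnn _)) (mul_ne_zero hpos.ne' hne))
        (not_lt.2 hle)
    have : 0 ≤ ∑ i, dirD W (spaceDir i) (x, t) ^ 2 := by positivity
    unfold energyDensity at hEx
    nlinarith [sq_nonneg (dirD W (timeDir n) (x, t))]
  have : W (x, T) - W (x, 0) = ∫ t in (0)..T, dirD W (timeDir n) (x, t) := by
    rw [intervalIntegral.integral_eq_sub_of_hasDerivAt (f := fun t => W (x, t))
      (fun t _ => dirD_time_hasDerivAt hW1 x t)
      (((dirD_continuous hW1 (timeDir n)).comp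
        (by fun_prop : Continuous fun t : ℝ => (x, t))).intervalIntegrable _ _)]
  rw [h0, sub_zero] at this
  rw [this, intervalIntegral.integral_of_le hT]
  rw [setIntegral_congr_fun measurableSet_Ioc (g := fun _ => (0:ℝ)) fun t ht => hz ht.1.le]
  simp

lemma hasDerivAt_dirD {W : Esp n × ℝ → ℝ} (hW : ContDiff ℝ 1 W) (v p : Esp n × ℝ) (s : ℝ) :
    HasDerivAt (fun s : ℝ => W (p + s • v)) (dirD W v (p + s • v)) s := by
  have h1 : HasFDerivAt W (fderiv ℝ W (p + s • v)) (p + s • v) :=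
    (hW.differentiable one_ne_zero _).hasFDerivAt
  have h2 : HasDerivAt (fun s : ℝ => p + s • v) v s := by
    simpa using ((hasDerivAt_id s).smul_const v).const_add p
  exact h1.comp_hasDerivAt s h2

lemma iteratedDeriv_two_line {W : Esp n × ℝ → ℝ} (hW : ContDiff ℝ 2 W) (v p : Esp n × ℝ) (s : ℝ) :
    iteratedDeriv 2 (fun s : ℝ => W (p + s • v)) s = dirD (dirD W v) v (p + s • v) := by
  rw [iteratedDeriv_succ, iteratedDeriv_one]
  have h1 : deriv (fun s : ℝ => W (p + s • v)) = fun s => dirD W v (p + s • v) :=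
    funext fun s => (hasDerivAt_dirD (hW.of_le (by norm_num)) v p s).deriv
  rw [h1]
  exact (hasDerivAt_dirD (dirD_contDiff hW v) v p s).deriv

/-- The phase of a plane wave. -/
def wavePhase (σ : ℝ) (ξ : Esp n) (p : Esp n × ℝ) : ℝ := inner ℝ ξ p.1 + σ * ‖ξ‖ * p.2

/-- A superposition of plane waves. -/
def waveU (g : Esp n → ℂ) (σ : ℝ) (p : Esp n × ℝ) : ℂ :=
  ∫ ξ, Complex.exp ((2 * Real.pi * wavePhase σ ξ p : ℝ) * Complex.I) * g ξ

lemma waveU_contDiff (g : 𝓢(Esp n, ℂ)) (σ : ℝ) : ContDiff ℝ 2 (waveU g σ) := by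
  let J : Esp n →L[ℝ] Esp n →L[ℝ] ℝ := innerSL ℝ
  let L : (Esp n × ℝ) →L[ℝ] (Esp n × ℝ) →L[ℝ] ℝ :=
    -(J.bilinearComp (ContinuousLinearMap.fst ℝ (Esp n) ℝ)
      (ContinuousLinearMap.fst ℝ (Esp n) ℝ) + (ContinuousLinearMap.mul ℝ ℝ).bilinearComp
      (ContinuousLinearMap.snd ℝ (Esp n) ℝ) (ContinuousLinearMap.snd ℝ (Esp n) ℝ))
  have hL (v w : Esp n × ℝ) : L v w = -(inner ℝ v.1 w.1 + v.2 * w.2) := by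
    simp [L, J]
    rfl
  let m : Esp n → Esp n × ℝ := fun ξ => (ξ, σ * ‖ξ‖)
  have hm : Continuous m := by fun_prop
  have hme : MeasurableEmbedding m := by
    refine hm.measurableEmbedding fun a b h => ?_
    exact (Prod.ext_iff.1 h).1
  have h := VectorFourier.contDiff_fourierIntegral (μ := Measure.map m volume) (N := 2)
    (f := fun v : Esp n × ℝ => g v.1) L (by
      intro k _
      rw [hme.integrable_map_iff]
      have hi := (g.integrable_pow_mul volume k).const_mul ((1 + |σ|) ^ k)
      refine hi.mono' (Continuous.aestronglyMeasurable (by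
        have := g.continuous
        simp only [comp_def, m]
        fun_prop)) (.of_forall fun ξ => ?_)
      simp only [comp_apply, norm_mul, norm_pow, norm_norm, m]
      rw [← mul_assoc, ← mul_pow]
      gcongr
      rw [Prod.norm_mk, norm_mul, norm_norm, Real.norm_eq_abs]
      apply max_le <;> nlinarith [norm_nonneg ξ, abs_nonneg σ])
  suffices hh : waveU g σ = VectorFourier.fourierIntegral Real.fourierChar
      (Measure.map m volume) L.toLinearMap₁₂ (fun v : Esp n × ℝ => g v.1) by
    rw [hh]
    exact h
  refine funext fun p => ?_
  change waveU g σ p = ∫ v, Real.fourierChar (-(L.toLinearMap₁₂ v) p) • g v.1 ∂_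
  rw [hme.integral_map, waveU]
  congr 1
  ext ξ
  have : -(L.toLinearMap₁₂ (m ξ)) p = wavePhase σ ξ p := by
    change -(L (m ξ) p) = _
    rw [hL]
    simp [m, wavePhase]
  rw [Circle.smul_def, Real.fourierChar_apply, this, smul_eq_mul]

lemma hasDerivAt_integral_cexp {g : Esp n → ℂ} {b : Esp n → ℝ} (hb : Continuous b)
    (hg : Integrable g) (hbg : Integrable fun ξ => (b ξ : ℂ) * g ξ) (s : ℝ) :
    HasDerivAt (fun s : ℝ => ∫ ξ, Complex.exp ((2 * Real.pi * (s * b ξ) : ℝ) * Complex.I) * g ξ)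
      (∫ ξ, Complex.exp ((2 * Real.pi * (s * b ξ) : ℝ) * Complex.I) *
        (2 * Real.pi * Complex.I * ((b ξ : ℂ) * g ξ))) s := by
  refine (hasDerivAt_integral_of_dominated_loc_of_deriv_le (μ := volume)
    (F := fun (s : ℝ) ξ => Complex.exp ((2 * Real.pi * (s * b ξ) : ℝ) * Complex.I) * g ξ)
    (F' := fun (s : ℝ) ξ => Complex.exp ((2 * Real.pi * (s * b ξ) : ℝ) * Complex.I) *
        (2 * Real.pi * Complex.I * ((b ξ : ℂ) * g ξ)))
    (bound := fun ξ => ‖2 * Real.pi * Complex.I * ((b ξ : ℂ) * g ξ)‖)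
    (s := Set.univ) Filter.univ_mem (.of_forall fun s => ?_) ?_ ?_ (.of_forall fun ξ s _ => ?_) ?_
    (.of_forall fun ξ s _ => ?_)).2
  · exact AEStronglyMeasurable.mul (by fun_prop) hg.1
  · refine hg.norm.mono' (AEStronglyMeasurable.mul (by fun_prop) hg.1) (.of_forall fun ξ => ?_)
    rw [norm_mul, Complex.norm_exp_ofReal_mul_I, one_mul]
  · exact AEStronglyMeasurable.mul (by fun_prop) (hbg.const_mul _).1
  · rw [norm_mul, Complex.norm_exp_ofReal_mul_I, one_mul]
  · exact (hbg.const_mul _).norm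
  · have h1 : HasDerivAt (fun s : ℝ => ((2 * Real.pi * (s * b ξ) : ℝ) : ℂ) * Complex.I)
        (2 * Real.pi * b ξ * Complex.I) s := by
      have h2 : HasDerivAt (fun s : ℝ => 2 * Real.pi * (s * b ξ)) (2 * Real.pi * b ξ) s := by
        simpa using ((hasDerivAt_id s).mul_const (b ξ)).const_mul (2 * Real.pi)
      simpa using h2.ofReal_comp.mul_const Complex.I
    exact (h1.cexp.mul_const (g ξ)).congr_deriv (by ring)

lemma wavePhase_line (σ : ℝ) (ξ : Esp n) (p v : Esp n × ℝ) (s : ℝ) :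
    wavePhase σ ξ (p + s • v) = wavePhase σ ξ p + s * wavePhase σ ξ v := by
  simp [wavePhase, inner_add_right, inner_smul_right]; ring

lemma wavePhase_continuous (σ : ℝ) (p : Esp n × ℝ) : Continuous fun ξ => wavePhase σ ξ p := by
  unfold wavePhase; fun_prop

lemma abs_wavePhase_le (σ : ℝ) (ξ : Esp n) (p : Esp n × ℝ) :
    |wavePhase σ ξ p| ≤ (‖p.1‖ + |σ| * |p.2|) * ‖ξ‖ := by
  unfold wavePhase
  calc _ ≤ |inner ℝ ξ p.1| + |σ * ‖ξ‖ * p.2| := abs_add_le _ _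
    _ ≤ ‖ξ‖ * ‖p.1‖ + |σ| * ‖ξ‖ * |p.2| := by
        rw [abs_mul, abs_mul, abs_norm]
        gcongr
        exact abs_real_inner_le_norm _ _
    _ = _ := by ring

lemma integrable_wavePhase_pow_mul (g : 𝓢(Esp n, ℂ)) (σ : ℝ) (v : Esp n × ℝ) (k : ℕ) :
    Integrable fun ξ => (wavePhase σ ξ v : ℂ) ^ k * g ξ := by
  refine ((g.integrable_pow_mul volume k).const_mul ((‖v.1‖ + |σ| * |v.2|) ^ k)).mono' ?_
    (.of_forall fun ξ => ?_)
  · have := wavePhase_continuous σ v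
    fun_prop
  · rw [norm_mul, norm_pow, Complex.norm_real, Real.norm_eq_abs, ← mul_assoc, ← mul_pow]
    gcongr
    exact abs_wavePhase_le _ _ _

lemma dirD_dirD_waveU (g : 𝓢(Esp n, ℂ)) (σ : ℝ) (v p : Esp n × ℝ) :
    dirD (dirD (fun p => (waveU g σ p).re) v) v p =
      (∫ ξ, Complex.exp ((2 * Real.pi * wavePhase σ ξ p : ℝ) * Complex.I) *
        ((2 * Real.pi * Complex.I) ^ 2 * ((wavePhase σ ξ v : ℂ) ^ 2 * g ξ))).re := by
  have hW : ContDiff ℝ 2 fun p => (waveU g σ p).re :=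
    Complex.reCLM.contDiff.comp (waveU_contDiff g σ)
  have h := iteratedDeriv_two_line hW v p 0
  rw [zero_smul, add_zero] at h
  rw [← h]
  set g1 : Esp n → ℂ := fun ξ =>
    Complex.exp ((2 * Real.pi * wavePhase σ ξ p : ℝ) * Complex.I) * g ξ with hg1
  set b : Esp n → ℝ := fun ξ => wavePhase σ ξ v
  have hb : Continuous b := wavePhase_continuous σ v
  have hp := wavePhase_continuous σ p
  have hint (k : ℕ) : Integrable fun ξ => (b ξ : ℂ) ^ k * g1 ξ := by
    refine (integrable_wavePhase_pow_mul g σ v k).norm.mono' (by fun_prop) (.of_forall fun ξ => ?_)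
    simp only [hg1, norm_mul, Complex.norm_exp_ofReal_mul_I, one_mul]
    exact le_rfl
  have e1 : (fun s : ℝ => (waveU g σ (p + s • v)).re) = fun s : ℝ =>
      (∫ ξ, Complex.exp ((2 * Real.pi * (s * b ξ) : ℝ) * Complex.I) * g1 ξ).re := by
    ext s
    congr 1
    refine integral_congr_ae (.of_forall fun ξ => ?_)
    simp only [hg1, wavePhase_line, ← mul_assoc]
    rw [← Complex.exp_add]
    congr 2
    push_cast
    simp only [b]
    ring
  have hre {φ : ℝ → ℂ} {φ' : ℂ} {s : ℝ} (h : HasDerivAt φ φ' s) :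
      HasDerivAt (fun s => (φ s).re) φ'.re s :=
    Complex.reCLM.hasFDerivAt.comp_hasDerivAt s h
  have d1 (s : ℝ) := hre (hasDerivAt_integral_cexp hb (by simpa using hint 0)
    (by simpa using hint 1) s)
  have hi1 : Integrable fun ξ => (b ξ : ℂ) * g1 ξ := by simpa using hint 1
  have d2 := hre (hasDerivAt_integral_cexp hb (g := fun ξ => 2 * Real.pi * Complex.I *
    ((b ξ : ℂ) * g1 ξ)) (hi1.const_mul _)
    (by
      have := (hint 2).const_mul (2 * Real.pi * Complex.I)
      refine this.congr (.of_forall fun ξ => ?_)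
      simp only
      ring) 0)
  rw [e1, iteratedDeriv_succ, iteratedDeriv_one, funext fun s => (d1 s).deriv, d2.deriv]
  congr 2
  ext ξ
  simp only [hg1, zero_mul, mul_zero, Complex.ofReal_zero, Complex.exp_zero, one_mul]
  ring

lemma waveU_wave (g : 𝓢(Esp n, ℂ)) {σ : ℝ} (hσ : σ ^ 2 = 1) (p : Esp n × ℝ) :
    dirD (dirD (fun p => (waveU g σ p).re) (timeDir n)) (timeDir n) p =
      ∑ i, dirD (dirD (fun p => (waveU g σ p).re) (spaceDir i)) (spaceDir i) p := by
  simp only [dirD_dirD_waveU]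
  rw [← Complex.re_sum, ← integral_finsetSum]
  · congr 2
    ext ξ
    rw [← Finset.mul_sum, ← Finset.mul_sum, ← Finset.sum_mul]
    congr 3
    have h1 (i : Fin n) : wavePhase σ ξ (spaceDir i) = ξ i := by
      simp [wavePhase, spaceDir, EuclideanSpace.inner_single_right]
    have h2 : wavePhase σ ξ (timeDir n) = σ * ‖ξ‖ := by simp [wavePhase, timeDir]
    simp only [h1, h2]
    norm_cast
    rw [mul_pow, hσ, one_mul, EuclideanSpace.real_norm_sq_eq]
  · intro i _
    have h := (integrable_wavePhase_pow_mul g σ (spaceDir i) 2).const_mul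
      ((2 * Real.pi * Complex.I) ^ 2)
    have hp := wavePhase_continuous σ p
    refine h.norm.mono' (AEStronglyMeasurable.mul (by fun_prop) h.1) (.of_forall fun ξ => ?_)
    rw [norm_mul, Complex.norm_exp_ofReal_mul_I, one_mul]

lemma dirD_sub {f g : Esp n × ℝ → ℝ} (hf : ContDiff ℝ 1 f) (hg : ContDiff ℝ 1 g)
    (v p : Esp n × ℝ) : dirD (fun p => f p - g p) v p = dirD f v p - dirD g v p := by
  unfold dirD
  rw [fderiv_fun_sub (hf.differentiable one_ne_zero p) (hg.differentiable one_ne_zero p)]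
  simp

lemma dirD_add {f g : Esp n × ℝ → ℝ} (hf : ContDiff ℝ 1 f) (hg : ContDiff ℝ 1 g)
    (v p : Esp n × ℝ) : dirD (fun p => f p + g p) v p = dirD f v p + dirD g v p := by
  unfold dirD
  rw [fderiv_fun_add (hf.differentiable one_ne_zero p) (hg.differentiable one_ne_zero p)]
  simp

lemma dirD_const_mul {f : Esp n × ℝ → ℝ} (hf : ContDiff ℝ 1 f) (c : ℝ)
    (v p : Esp n × ℝ) : dirD (fun p => c * f p) v p = c * dirD f v p := by
  unfold dirD
  rw [fderiv_const_mul (hf.differentiable one_ne_zero p)]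
  simp

/-- A smooth solution of the wave equation with Cauchy data `(f, 0)` is the superposition of plane
waves given by the Fourier transform of `f`. -/
theorem wave_eq_fourier (f : 𝓢(Esp n, ℂ)) (u : Esp n → ℝ → ℝ)
    (hu : ContDiff ℝ 2 (fun p : Esp n × ℝ => u p.1 p.2))
    (hwave : ∀ x : Esp n, ∀ t : ℝ, 0 ≤ t → iteratedDeriv 2 (u x) t = lapl (fun z => u z t) x)
    (hinit : ∀ x, u x 0 = (f x).re) (hinit' : ∀ x, deriv (u x) 0 = 0) (x : Esp n) {t : ℝ}
    (ht : 0 ≤ t) :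
    u x t = 2⁻¹ * ((waveU (𝓕 f : 𝓢(Esp n, ℂ)) 1 (x, t)).re +
      (waveU (𝓕 f : 𝓢(Esp n, ℂ)) (-1) (x, t)).re) := by
  set g : 𝓢(Esp n, ℂ) := 𝓕 f with hg
  have hU (σ : ℝ) : ContDiff ℝ 2 fun p => (waveU g σ p).re :=
    Complex.reCLM.contDiff.comp (waveU_contDiff g σ)
  set V : Esp n × ℝ → ℝ := fun p => 2⁻¹ * ((waveU g 1 p).re + (waveU g (-1) p).re) with hV
  have hS : ContDiff ℝ 2 fun p => (waveU g 1 p).re + (waveU g (-1) p).re := (hU 1).add (hU (-1))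
  have hVc : ContDiff ℝ 2 V := contDiff_const.mul hS
  set w : Esp n × ℝ → ℝ := fun p => u p.1 p.2 with hw
  have l12 : (1 : WithTop ℕ∞) ≤ 2 := by norm_num
  have hV2 (v p : Esp n × ℝ) : dirD (dirD V v) v p =
      2⁻¹ * (dirD (dirD (fun p => (waveU g 1 p).re) v) v p +
        dirD (dirD (fun p => (waveU g (-1) p).re) v) v p) := by
    have e1 : dirD V v = fun p => 2⁻¹ * (dirD (fun p => (waveU g 1 p).re) v p +
        dirD (fun p => (waveU g (-1) p).re) v p) := by
      ext p
      rw [dirD_const_mul (hS.of_le l12), dirD_add ((hU 1).of_le l12) ((hU (-1)).of_le l12)]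
    rw [e1, dirD_const_mul ((dirD_contDiff (hU 1) v).add (dirD_contDiff (hU (-1)) v)),
      dirD_add (dirD_contDiff (hU 1) v) (dirD_contDiff (hU (-1)) v)]
  have hVw (p : Esp n × ℝ) : dirD (dirD V (timeDir n)) (timeDir n) p =
      ∑ i, dirD (dirD V (spaceDir i)) (spaceDir i) p := by
    simp only [hV2]
    rw [← Finset.mul_sum, Finset.sum_add_distrib, waveU_wave g (by norm_num),
      waveU_wave g (by norm_num)]
  have hww (p : Esp n × ℝ) (hp : 0 ≤ p.2) : dirD (dirD w (timeDir n)) (timeDir n) p =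
      ∑ i, dirD (dirD w (spaceDir i)) (spaceDir i) p := by
    have e1 : iteratedDeriv 2 (u p.1) p.2 = dirD (dirD w (timeDir n)) (timeDir n) p := by
      have h := iteratedDeriv_two_line hu (timeDir n) (p.1, 0) p.2
      simpa [timeDir, hw] using h
    have e2 (i : Fin n) : iteratedDeriv 2
        (fun s : ℝ => u (p.1 + s • EuclideanSpace.single i (1 : ℝ)) p.2) 0 =
        dirD (dirD w (spaceDir i)) (spaceDir i) p := by
      have h := iteratedDeriv_two_line hu (spaceDir i) p 0
      simpa only [hw, spaceDir, zero_smul, add_zero, Prod.fst_add, Prod.snd_add, Prod.smul_fst,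
        Prod.smul_snd, smul_zero] using h
    rw [← e1, hwave p.1 p.2 hp, lapl]
    exact Finset.sum_congr rfl fun i _ => e2 i
  have hsub (v p : Esp n × ℝ) : dirD (dirD (fun p => w p - V p) v) v p =
      dirD (dirD w v) v p - dirD (dirD V v) v p := by
    have e1 : dirD (fun p => w p - V p) v = fun p => dirD w v p - dirD V v p := by
      ext p
      rw [dirD_sub (hu.of_le l12) (hVc.of_le l12)]
    rw [e1, dirD_sub (dirD_contDiff hu v) (dirD_contDiff hVc v)]
  have hUneg (x : Esp n) (t : ℝ) : waveU g (-1) (x, t) = waveU g 1 (x, -t) := by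
    simp [waveU, wavePhase]
  have hU0 (σ : ℝ) (x : Esp n) : waveU g σ (x, 0) = f x := by
    have h0 : 𝓕⁻ (𝓕 f : 𝓢(Esp n, ℂ)) = f := FourierTransform.fourierInv_fourier_eq f
    have h1 := congrFun (congrArg DFunLike.coe h0) x
    rw [SchwartzMap.fourierInv_coe, Real.fourierInv_eq'] at h1
    rw [← h1]
    simp [waveU, wavePhase, hg]
  have := wave_eq_zero (W := fun p => w p - V p) (hu.sub hVc)
    (fun p hp => by simp only [hsub, hww p hp, hVw p, Finset.sum_sub_distrib])
    (fun x => by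
      simp only [hw, hV, hU0, hinit]
      ring)
    (fun x => by
      rw [dirD_sub (hu.of_le l12) (hVc.of_le l12)]
      have e1 := (dirD_time_hasDerivAt (hu.of_le l12) x 0).deriv
      have e2 := (dirD_time_hasDerivAt (hVc.of_le l12) x 0).deriv
      have e3 : deriv (fun t => V (x, t)) 0 = 0 := by
        have : (fun t => V (x, t)) = fun t => V (x, -t) := by
          ext t
          simp only [hV, hUneg, neg_neg]
          ring
        have h2 := congrArg (fun g => deriv g 0) this
        simp only [deriv_comp_neg (fun t => V (x, t)), neg_zero] at h2
        linarith
      rw [← e2, e3, ← e1]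
      simpa [hw] using hinit' x)
    x ht
  exact sub_eq_zero.1 this

lemma waveU_const_mul (g : Esp n → ℂ) (c : ℂ) (σ : ℝ) (p : Esp n × ℝ) :
    waveU (fun ξ => c * g ξ) σ p = c * waveU g σ p := by
  simp only [waveU, ← integral_const_mul]
  congr 1
  ext ξ
  ring

lemma waveU_neg_one (g : Esp n → ℂ) (x : Esp n) (t : ℝ) :
    waveU g (-1) (x, t) = waveU g 1 (x, -t) := by
  simp [waveU, wavePhase]

theorem wave_eq_fourier_complex (f : 𝓢(Esp n, ℂ)) (hf : ∀ x, (f x).im = 0) (u : Esp n → ℝ → ℝ)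
    (hu : ContDiff ℝ 2 (fun p : Esp n × ℝ => u p.1 p.2))
    (hwave : ∀ x : Esp n, ∀ t : ℝ, 0 ≤ t → iteratedDeriv 2 (u x) t = lapl (fun z => u z t) x)
    (hinit : ∀ x, u x 0 = (f x).re) (hinit' : ∀ x, deriv (u x) 0 = 0) (x : Esp n) {t : ℝ}
    (ht : 0 ≤ t) :
    (u x t : ℂ) = 2⁻¹ * (waveU (𝓕 f : 𝓢(Esp n, ℂ)) 1 (x, t) +
      waveU (𝓕 f : 𝓢(Esp n, ℂ)) 1 (x, -t)) := by
  have h1 := wave_eq_fourier f u hu hwave hinit hinit' x ht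
  have h2 := wave_eq_fourier (Complex.I • f) (fun _ _ => 0) contDiff_const (by simp [lapl])
    (by simp [hf]) (by simp) x ht
  have h3 : ((𝓕 (Complex.I • f) : 𝓢(Esp n, ℂ)) : Esp n → ℂ) =
      fun ξ => Complex.I * (𝓕 f : 𝓢(Esp n, ℂ)) ξ := by
    rw [FourierTransform.fourier_smul]
    rfl
  rw [h3, waveU_const_mul, waveU_const_mul, waveU_neg_one] at h2
  rw [waveU_neg_one] at h1
  apply Complex.ext
  · simp [h1]
  · simp at h2 ⊢
    linarith

lemma norm_waveU_le (g : Esp n → ℂ) (σ : ℝ) (p : Esp n × ℝ) : ‖waveU g σ p‖ ≤ ∫ ξ, ‖g ξ‖ := by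
  refine (norm_integral_le_integral_norm _).trans_eq (integral_congr_ae (.of_forall fun ξ => ?_))
  simp only [norm_mul, Complex.norm_exp_ofReal_mul_I, one_mul]

lemma integral_gaussian_mul_waveU (f : 𝓢(Esp n, ℂ)) {σ : ℂ} (hσ : 0 < σ.re) (y : Esp n) :
    ∫ t : ℝ, Complex.exp (-σ * t ^ 2) * waveU (𝓕 f : 𝓢(Esp n, ℂ)) 1 (y, t) =
      (Real.pi / σ) ^ (1 / 2 : ℂ) * (σ / Real.pi) ^ (n / 2 : ℂ) *
        ∫ z, f z * Complex.exp (-σ * ‖y - z‖ ^ 2) := by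
  set g : 𝓢(Esp n, ℂ) := 𝓕 f with hg
  have hσ0 : σ ≠ 0 := by rintro rfl; simp at hσ
  have hpi : (Real.pi : ℂ) ≠ 0 := by exact_mod_cast Real.pi_ne_zero
  have hgi : Integrable g := g.integrable
  have hgc : Continuous g := g.continuous
  have step1 : ∫ t : ℝ, Complex.exp (-σ * t ^ 2) * waveU g 1 (y, t) =
      ∫ ξ, ((Real.pi / σ) ^ (1 / 2 : ℂ) * Complex.exp (-(Real.pi ^ 2 / σ) * ‖ξ‖ ^ 2 +
        (2 * Real.pi * Complex.I) * (inner ℝ y ξ : ℝ))) * g ξ := by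
    simp only [waveU, ← integral_const_mul]
    rw [integral_integral_swap]
    · refine integral_congr_ae (.of_forall fun ξ => ?_)
      have h := fourierIntegral_gaussian hσ (2 * Real.pi * ‖ξ‖ : ℝ)
      have e1 : -((2 * Real.pi * ‖ξ‖ : ℝ) : ℂ) ^ 2 / (4 * σ) = -(Real.pi ^ 2 / σ) * ‖ξ‖ ^ 2 := by
        push_cast; field_simp; ring
      rw [e1] at h
      simp only
      rw [Complex.exp_add, ← mul_assoc, ← h, ← integral_mul_const, ← integral_mul_const]
      refine integral_congr_ae (.of_forall fun t => ?_)
      simp only [wavePhase]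
      have e2 : Complex.exp ((2 * Real.pi * (inner ℝ ξ y + 1 * ‖ξ‖ * t) : ℝ) * Complex.I) =
          Complex.exp (Complex.I * (2 * Real.pi * ‖ξ‖ : ℝ) * t) *
            Complex.exp (2 * Real.pi * Complex.I * (inner ℝ y ξ : ℝ)) := by
        rw [← Complex.exp_add, real_inner_comm]
        congr 1
        push_cast; ring
      rw [e2]; ring
    · have hi := (integrable_cexp_neg_mul_sq hσ).mul_prod hgi
      refine hi.norm.mono' ?_ (.of_forall fun ⟨t, ξ⟩ => ?_)
      · refine Continuous.aestronglyMeasurable ?_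
        simp only [wavePhase, uncurry_def]
        fun_prop
      · simp only [uncurry, norm_mul, Complex.norm_exp_ofReal_mul_I, one_mul]
        exact le_rfl
  rw [step1]
  set G : Esp n → ℂ := fun ξ => Complex.exp (-(Real.pi ^ 2 / σ) * ‖ξ‖ ^ 2 +
        (2 * Real.pi * Complex.I) * (inner ℝ y ξ : ℝ)) with hG
  have hre : 0 < ((Real.pi : ℂ) ^ 2 / σ).re := by
    have : ((Real.pi : ℂ) ^ 2 / σ) = (Real.pi ^ 2 : ℝ) * σ⁻¹ := by push_cast; ring
    rw [this, Complex.re_ofReal_mul, Complex.inv_re]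
    have := Complex.normSq_pos.2 hσ0
    positivity
  have hGi : Integrable G := GaussianFourier.integrable_cexp_neg_mul_sq_norm_add hre _ y
  have hGF (z : Esp n) : 𝓕 G z = (σ / Real.pi) ^ (n / 2 : ℂ) * Complex.exp (-σ * ‖y - z‖ ^ 2) := by
    rw [Real.fourier_eq']
    have h := GaussianFourier.integral_cexp_neg_mul_sq_norm_add hre (2 * Real.pi * Complex.I)
      (y - z)
    have e1 : (Real.pi : ℂ) / (Real.pi ^ 2 / σ) = σ / Real.pi := by field_simp
    have e2 : (2 * Real.pi * Complex.I) ^ 2 * ((‖y - z‖ : ℝ) : ℂ) ^ 2 / (4 * (Real.pi ^ 2 / σ)) =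
        -σ * ‖y - z‖ ^ 2 := by
      rw [mul_pow, Complex.I_sq]; field_simp; ring
    rw [e1, e2, finrank_euclideanSpace_fin] at h
    rw [← h]
    refine integral_congr_ae (.of_forall fun ξ => ?_)
    simp only [hG, smul_eq_mul]
    rw [← Complex.exp_add]
    congr 1
    rw [inner_sub_left, real_inner_comm ξ z]
    push_cast; ring
  have hflip := VectorFourier.integral_fourierIntegral_smul_eq_flip (μ := volume) (ν := volume)
    (L := innerₗ (Esp n)) (e := Real.fourierChar) (f := f) (g := G) Real.continuous_fourierChar
    continuous_inner f.integrable hGi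
  have e3 : ∀ ξ, VectorFourier.fourierIntegral Real.fourierChar volume (innerₗ (Esp n)) f ξ =
      g ξ := fun ξ => by
    rw [hg, SchwartzMap.fourier_coe]; rfl
  have e4 : ∀ z, VectorFourier.fourierIntegral Real.fourierChar volume (innerₗ (Esp n)).flip G z =
      𝓕 G z := fun z => by
    rw [flip_innerₗ]; rfl
  simp only [e3, e4, hGF, smul_eq_mul] at hflip
  calc _ = (Real.pi / σ) ^ (1 / 2 : ℂ) * ∫ ξ, g ξ * G ξ := by
        rw [← integral_const_mul]
        refine integral_congr_ae (.of_forall fun ξ => ?_)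
        simp only
        ring
    _ = _ := by
        rw [hflip, mul_assoc, ← integral_const_mul ((σ / Real.pi) ^ (n / 2 : ℂ))]
        congr 2
        ext z
        ring

lemma cpow_const_aux {w : ℂ} (hw : w ∈ Complex.slitPlane) (n : ℕ) :
    (w⁻¹) ^ (1 / 2 : ℂ) * w ^ (n / 2 : ℂ) = w ^ (((n : ℂ) - 1) / 2) := by
  have h0 : w ≠ 0 := Complex.slitPlane_ne_zero hw
  rw [Complex.inv_cpow _ _ (Complex.slitPlane_arg_ne_pi hw), ← Complex.cpow_neg,
    ← Complex.cpow_add _ _ h0]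
  congr 1
  ring

theorem integral_gaussian_mul_wave (f : 𝓢(Esp n, ℂ)) (u : Esp n → ℝ → ℝ)
    (hrep : ∀ x t, 0 ≤ t → (u x t : ℂ) = 2⁻¹ * (waveU (𝓕 f : 𝓢(Esp n, ℂ)) 1 (x, t) +
      waveU (𝓕 f : 𝓢(Esp n, ℂ)) 1 (x, -t)))
    (y : Esp n) {σ : ℂ} (hσ : 0 < σ.re) :
    ∫ t in Set.Ioi (0 : ℝ), Complex.exp (-σ * t ^ 2) * u y t =
      2⁻¹ * (σ / Real.pi) ^ (((n : ℂ) - 1) / 2) *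
        ∫ z, f z * Complex.exp (-σ * ‖y - z‖ ^ 2) := by
  set U : ℝ → ℂ := fun t => waveU (𝓕 f : 𝓢(Esp n, ℂ)) 1 (y, t) with hU
  have hUc : Continuous U :=
    (waveU_contDiff (𝓕 f : 𝓢(Esp n, ℂ)) 1).continuous.comp (by fun_prop)
  set k : ℝ → ℂ := fun t => Complex.exp (-σ * t ^ 2) * U t with hk
  have hkc : Continuous k := by fun_prop
  have hki : Integrable k := by
    refine ((integrable_cexp_neg_mul_sq hσ).norm.mul_const
      (∫ ξ, ‖(𝓕 f : 𝓢(Esp n, ℂ)) ξ‖)).mono' hkc.aestronglyMeasurable (.of_forall fun t => ?_)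
    rw [norm_mul]
    gcongr
    exact norm_waveU_le _ _ _
  have h1 : ∫ t in Set.Ioi (0 : ℝ), Complex.exp (-σ * t ^ 2) * u y t =
      ∫ t in Set.Ioi (0 : ℝ), 2⁻¹ * (k t + k (-t)) := by
    refine setIntegral_congr_fun measurableSet_Ioi fun t ht => ?_
    simp only [hrep y t (le_of_lt ht), hk, hU]
    push_cast
    rw [neg_sq]; ring
  have h2 := intervalIntegral.integral_Iic_add_Ioi (b := 0) hki.integrableOn hki.integrableOn
  have h3 := integral_comp_neg_Ioi 0 k
  rw [neg_zero] at h3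
  rw [h1, integral_const_mul, integral_add hki.integrableOn (hki.comp_neg).integrableOn, h3,
    add_comm, h2, hk, integral_gaussian_mul_waveU f hσ y, mul_assoc 2⁻¹]
  congr 2
  have hw : σ / Real.pi ∈ Complex.slitPlane := by
    left
    rw [Complex.div_ofReal_re]
    positivity
  rw [← cpow_const_aux hw, inv_div]

theorem integral_oscillatory_mul_wave (f : 𝓢(Esp n, ℂ)) (u : Esp n → ℝ → ℝ)
    (hu : Continuous (fun p : Esp n × ℝ => u p.1 p.2))
    (hrep : ∀ x t, 0 ≤ t → (u x t : ℂ) = 2⁻¹ * (waveU (𝓕 f : 𝓢(Esp n, ℂ)) 1 (x, t) +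
      waveU (𝓕 f : 𝓢(Esp n, ℂ)) 1 (x, -t)))
    (y : Esp n) (hy : IntegrableOn (u y) (Set.Ioi 0)) {k : ℝ} (hk : 0 < k) :
    ∫ t in Set.Ioi (0 : ℝ), Complex.exp (-(k * Complex.I) * t ^ 2) * u y t =
      2⁻¹ * (k * Complex.I / Real.pi) ^ (((n : ℂ) - 1) / 2) *
        ∫ z, f z * Complex.exp (-(k * Complex.I) * ‖y - z‖ ^ 2) := by
  set s : ℕ → ℂ := fun m => (1 / ((m : ℝ) + 1) : ℝ) + k * Complex.I with hs
  have hsre (m : ℕ) : 0 < (s m).re := by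
    simp only [hs, Complex.add_re, Complex.ofReal_re, Complex.re_ofReal_mul, Complex.I_re,
      mul_zero, add_zero]
    positivity
  have hst : Tendsto s atTop (𝓝 (k * Complex.I)) := by
    have := (Complex.continuous_ofReal.tendsto 0).comp
      (tendsto_one_div_add_atTop_nhds_zero_nat (𝕜 := ℝ))
    simpa [hs, comp_def] using this.add_const (k * Complex.I : ℂ)
  have hbd (m : ℕ) (r : ℝ) : ‖Complex.exp (-s m * (r : ℂ) ^ 2)‖ ≤ 1 := by
    rw [Complex.norm_exp]
    have : (-s m * (r : ℂ) ^ 2).re = -((s m).re * r ^ 2) := by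
      rw [← Complex.ofReal_pow, Complex.re_mul_ofReal, Complex.neg_re]; ring
    rw [this]
    exact Real.exp_le_one_iff.2 (by have := (hsre m).le; nlinarith [mul_nonneg this (sq_nonneg r)])
  have hexp (r : ℝ) : Tendsto (fun m => Complex.exp (-s m * (r : ℂ) ^ 2)) atTop
      (𝓝 (Complex.exp (-(k * Complex.I) * (r : ℂ) ^ 2))) :=
    (Complex.continuous_exp.tendsto _).comp ((hst.neg).mul_const _)
  have hyc : Continuous (u y) := hu.comp (by fun_prop : Continuous fun t : ℝ => (y, t))
  have L : Tendsto (fun m => ∫ t in Set.Ioi (0 : ℝ), Complex.exp (-s m * t ^ 2) * u y t) atTop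
      (𝓝 (∫ t in Set.Ioi (0 : ℝ), Complex.exp (-(k * Complex.I) * t ^ 2) * u y t)) := by
    refine tendsto_integral_of_dominated_convergence (fun t => ‖u y t‖)
      (fun m => (Continuous.aestronglyMeasurable (by fun_prop))) hy.norm
      (fun m => .of_forall fun t => ?_) (.of_forall fun t => (hexp t).mul_const _)
    rw [norm_mul, Complex.norm_real]
    exact mul_le_of_le_one_left (norm_nonneg _) (hbd m t)
  have Rr : Tendsto (fun m => ∫ z, f z * Complex.exp (-s m * ‖y - z‖ ^ 2)) atTop
      (𝓝 (∫ z, f z * Complex.exp (-(k * Complex.I) * ‖y - z‖ ^ 2))) := by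
    have hfc := f.continuous
    refine tendsto_integral_of_dominated_convergence (fun z => ‖f z‖)
      (fun m => (Continuous.aestronglyMeasurable (by fun_prop))) f.integrable.norm
      (fun m => .of_forall fun t => ?_) (.of_forall fun t => (hexp _).const_mul _)
    rw [norm_mul]
    exact mul_le_of_le_one_right (norm_nonneg _) (hbd m _)
  have hc : Tendsto (fun m => (s m / Real.pi) ^ (((n : ℂ) - 1) / 2)) atTop
      (𝓝 ((k * Complex.I / Real.pi) ^ (((n : ℂ) - 1) / 2))) := by
    have hsl : (k * Complex.I / Real.pi : ℂ) ∈ Complex.slitPlane := by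
      right
      rw [Complex.div_ofReal_im, Complex.im_ofReal_mul, Complex.I_im]
      positivity
    exact ((continuousAt_cpow_const hsl).tendsto).comp (hst.div_const _)
  refine tendsto_nhds_unique L ?_
  have := (hc.const_mul 2⁻¹).mul Rr
  refine this.congr fun m => ?_
  rw [integral_gaussian_mul_wave f u hrep y (hsre m)]

lemma norm_rpow_mul_cexp (a : ℝ) {k : ℝ} (hk : 0 < k) (w : ℂ) :
    ‖((k ^ a : ℝ) : ℂ) * Complex.exp (-(w * k))‖ = k ^ a * Real.exp (-w.re * k) := by
  rw [norm_mul, Complex.norm_real, Complex.norm_exp, Complex.neg_re, Complex.re_mul_ofReal,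
    Real.norm_of_nonneg (by positivity)]
  ring_nf

lemma integrableOn_rpow_mul_exp {a r : ℝ} (ha : -1 < a) (hr : 0 < r) :
    IntegrableOn (fun k : ℝ => k ^ a * Real.exp (-r * k)) (Set.Ioi 0) := by
  simpa using integrableOn_rpow_mul_exp_neg_mul_rpow ha one_pos hr

lemma aestronglyMeasurable_rpow_mul_cexp (a : ℝ) (w : ℂ) :
    AEStronglyMeasurable (fun k : ℝ => ((k ^ a : ℝ) : ℂ) * Complex.exp (-(w * k)))
      (volume.restrict (Set.Ioi 0)) := by
  refine Measurable.aestronglyMeasurable ?_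
  fun_prop

/-- The Gamma integral with a complex rate. -/
theorem integral_rpow_mul_cexp_neg_mul_Ioi {a : ℝ} (ha : 0 < a) {w : ℂ} (hw : 0 < w.re) :
    ∫ k in Set.Ioi (0 : ℝ), ((k ^ (a - 1) : ℝ) : ℂ) * Complex.exp (-(w * k)) =
      (w⁻¹) ^ (a : ℂ) * Complex.Gamma a := by
  set U : Set ℂ := {w | 0 < w.re} with hU
  have hUo : IsOpen U := isOpen_lt continuous_const Complex.continuous_re
  have hUc : IsPreconnected U := (convex_halfSpace_re_gt 0).isPreconnected
  set F : ℂ → ℂ := fun w => ∫ k in Set.Ioi (0 : ℝ),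
    ((k ^ (a - 1) : ℝ) : ℂ) * Complex.exp (-(w * k)) with hF
  have hFd : DifferentiableOn ℂ F U := by
    intro w hw
    have hw : 0 < w.re := hw
    have hn : {z : ℂ | w.re / 2 < z.re} ∈ 𝓝 w :=
      (isOpen_lt continuous_const Complex.continuous_re).mem_nhds
        (by simpa using half_lt_self hw)
    refine DifferentiableAt.differentiableWithinAt ?_
    refine (hasDerivAt_integral_of_dominated_loc_of_deriv_le
      (F := fun w (k : ℝ) => ((k ^ (a - 1) : ℝ) : ℂ) * Complex.exp (-(w * k)))
      (F' := fun w (k : ℝ) => ((k ^ (a - 1) : ℝ) : ℂ) * (Complex.exp (-(w * k)) * -k))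
      (bound := fun k => k ^ a * Real.exp (-(w.re / 2) * k)) hn
      (.of_forall fun z => aestronglyMeasurable_rpow_mul_cexp _ _)
      ?_ (Measurable.aestronglyMeasurable (by fun_prop)) ?_
      (integrableOn_rpow_mul_exp (by linarith) (half_pos hw)) ?_).2.differentiableAt
    · refine (integrableOn_rpow_mul_exp (by linarith : -1 < a - 1) hw).mono'
        (aestronglyMeasurable_rpow_mul_cexp _ _) ?_
      refine (ae_restrict_iff' measurableSet_Ioi).2 (.of_forall fun k hk => ?_)
      exact (norm_rpow_mul_cexp _ hk _).le
    · refine (ae_restrict_iff' measurableSet_Ioi).2 (.of_forall fun k hk z hz => ?_)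
      have hk : 0 < k := hk
      have hz : w.re / 2 < z.re := hz
      rw [← mul_assoc, norm_mul, norm_rpow_mul_cexp _ hk, norm_neg, Complex.norm_real,
        Real.norm_of_nonneg hk.le]
      calc k ^ (a - 1) * Real.exp (-z.re * k) * k = k ^ a * Real.exp (-z.re * k) := by
            rw [Real.rpow_sub_one hk.ne']; field_simp
        _ ≤ _ := by gcongr
    · refine .of_forall fun k z hz => ?_
      have h1 : HasDerivAt (fun z : ℂ => -(z * k)) (-k : ℂ) z :=
        (((hasDerivAt_id z).mul_const (k : ℂ)).neg).congr_deriv (by ring)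
      exact (h1.cexp).const_mul _
  have hGd : DifferentiableOn ℂ (fun w : ℂ => (w⁻¹) ^ (a : ℂ) * Complex.Gamma a) U := by
    intro w hw
    have hw : 0 < w.re := hw
    have h0 : w ≠ 0 := by rintro rfl; simp at hw
    refine DifferentiableAt.differentiableWithinAt ?_
    refine ((differentiableAt_inv h0).cpow_const ?_).mul_const _
    left
    rw [Complex.inv_re]
    have := Complex.normSq_pos.2 h0
    positivity
  have heq : Set.EqOn F (fun w : ℂ => (w⁻¹) ^ (a : ℂ) * Complex.Gamma a) U := by
    refine (hFd.analyticOnNhd hUo).eqOn_of_preconnected_of_frequently_eq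
      (hGd.analyticOnNhd hUo) hUc (z₀ := 1) (by simp [hU]) ?_
    have hs : Tendsto (fun m : ℕ => ((1 + 1 / ((m : ℝ) + 1) : ℝ) : ℂ)) atTop (𝓝[≠] 1) := by
      refine tendsto_nhdsWithin_iff.2 ⟨?_, .of_forall fun m => ?_⟩
      · have := (tendsto_one_div_add_atTop_nhds_zero_nat (𝕜 := ℝ)).const_add 1
        rw [add_zero] at this
        exact_mod_cast (Complex.continuous_ofReal.tendsto 1).comp this
      · have : (0 : ℝ) < 1 / ((m : ℝ) + 1) := by positivity
        rw [Set.mem_compl_iff, Set.mem_singleton_iff, Complex.ofReal_eq_one]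
        linarith
    refine hs.frequently (Frequently.of_forall fun m => ?_)
    have hr : (0 : ℝ) < 1 + 1 / ((m : ℝ) + 1) := by positivity
    have := Complex.integral_cpow_mul_exp_neg_mul_Ioi (a := a) (by simpa using ha) hr
    simp only [one_div (Complex.ofReal _)] at this
    simp only [hF]
    rw [← this]
    refine setIntegral_congr_fun measurableSet_Ioi fun k hk => ?_
    simp only [Complex.ofReal_cpow (le_of_lt hk)]
    push_cast
    rfl
  exact heq hw

lemma integral_rpow_mul_integral_cexp {α : Type*} [MeasurableSpace α] {μ : Measure α} [SFinite μ]
    {g : α → ℂ} (hg : Integrable g μ) {φ : α → ℝ} (hφ : Measurable φ) {a ε : ℝ} (ha : 0 < a)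
    (hε : 0 < ε) :
    ∫ k in Set.Ioi (0 : ℝ), (((k ^ (a - 1) : ℝ) : ℂ) * Complex.exp (-(ε * k))) *
        ∫ x, g x * Complex.exp (-(k * Complex.I) * φ x) ∂μ =
      Complex.Gamma a * ∫ x, g x * ((ε + Complex.I * φ x)⁻¹) ^ (a : ℂ) ∂μ := by
  simp_rw [← integral_const_mul]
  have hk : IntegrableOn (fun k : ℝ => ((k ^ (a - 1) : ℝ) : ℂ) * Complex.exp (-(ε * k)))
      (Set.Ioi 0) := by
    refine (integrableOn_rpow_mul_exp (by linarith : -1 < a - 1) hε).mono'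
      (aestronglyMeasurable_rpow_mul_cexp _ _) ?_
    refine (ae_restrict_iff' measurableSet_Ioi).2 (.of_forall fun k hk => ?_)
    exact (norm_rpow_mul_cexp _ hk _).le
  rw [integral_integral_swap]
  · refine integral_congr_ae (.of_forall fun x => ?_)
    simp only
    have := integral_rpow_mul_cexp_neg_mul_Ioi ha (w := ε + Complex.I * φ x) (by simpa using hε)
    rw [mul_left_comm, mul_comm (Complex.Gamma a), ← this, ← integral_const_mul]
    refine integral_congr_ae (.of_forall fun k => ?_)
    simp only
    have hadd : Complex.exp (-((ε + Complex.I * φ x) * k)) =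
        Complex.exp (-(ε * k)) * Complex.exp (-(k * Complex.I) * φ x) := by
      rw [← Complex.exp_add]; congr 1; ring
    rw [hadd]
    ring
  · refine (hk.mul_prod hg).mono (?_) (.of_forall fun p => ?_)
    · refine (hk.aestronglyMeasurable.comp_fst).mul ((hg.aestronglyMeasurable.comp_snd).mul ?_)
      exact (by fun_prop : Measurable fun p : ℝ × α =>
        Complex.exp (-(p.1 * Complex.I) * φ p.2)).aestronglyMeasurable
    · simp only [uncurry, norm_mul]
      have : ‖Complex.exp (-(p.1 * Complex.I) * φ p.2)‖ = 1 := by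
        have := Complex.norm_exp_ofReal_mul_I (-(p.1 * φ p.2))
        rw [← this]; congr 2; push_cast; ring
      rw [this, mul_one]

/-- The kernel `(-q + iε)^(-b)`, a regularization of `(-q + i0)^(-b)`. -/
def oscKernel (b ε q : ℝ) : ℂ := (-q + ε * Complex.I : ℂ) ^ (-b : ℂ)

lemma inv_cpow_eq_oscKernel {ε : ℝ} (hε : 0 < ε) (b q : ℝ) :
    ((ε + Complex.I * q : ℂ)⁻¹) ^ (b : ℂ) = Complex.I ^ (b : ℂ) * oscKernel b ε q := by
  have hre : 0 < (ε + Complex.I * q : ℂ).re := by simpa using hε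
  have hw : (ε + Complex.I * q : ℂ) ≠ 0 := fun h => by simp [h] at hre
  have h1 : (-q + ε * Complex.I : ℂ) = Complex.I * (ε + Complex.I * q) := by
    linear_combination (-q : ℂ) * Complex.I_mul_I
  have harg := abs_lt.1 (Complex.abs_arg_lt_pi_div_two_iff.2 (Or.inl hre))
  have hlog : Complex.log (Complex.I * (ε + Complex.I * q)) =
      Complex.log Complex.I + Complex.log (ε + Complex.I * q) := by
    refine Complex.log_mul Complex.I_ne_zero hw ?_
    rw [Complex.arg_I]
    constructor <;> linarith [harg.1, harg.2, Real.pi_pos]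
  rw [oscKernel, h1, Complex.inv_cpow _ _ (Complex.slitPlane_arg_ne_pi (Or.inl hre)),
    ← Complex.cpow_neg, Complex.cpow_def_of_ne_zero hw, Complex.cpow_def_of_ne_zero Complex.I_ne_zero,
    Complex.cpow_def_of_ne_zero (mul_ne_zero Complex.I_ne_zero hw), ← Complex.exp_add, hlog]
  congr 1
  ring

/-- The positive constant relating the two sides of `integral_wave_mul_oscKernel`. -/
def oscConst (n : ℕ) : ℝ :=
  2⁻¹ * (Real.pi⁻¹) ^ (((n : ℝ) - 1) / 2) * Real.Gamma ((n : ℝ) - 1) / Real.Gamma (((n : ℝ) - 1) / 2)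

theorem integral_wave_mul_oscKernel (hn : 2 ≤ n) (f : 𝓢(Esp n, ℂ)) (u : Esp n → ℝ → ℝ)
    (hu : Continuous (fun p : Esp n × ℝ => u p.1 p.2))
    (hrep : ∀ x t, 0 ≤ t → (u x t : ℂ) = 2⁻¹ * (waveU (𝓕 f : 𝓢(Esp n, ℂ)) 1 (x, t) +
      waveU (𝓕 f : 𝓢(Esp n, ℂ)) 1 (x, -t)))
    (y : Esp n) (hy : IntegrableOn (u y) (Set.Ioi 0)) {ε : ℝ} (hε : 0 < ε) (A : ℝ) :
    ∫ t in Set.Ioi (0 : ℝ), (u y t : ℂ) * oscKernel (((n : ℝ) - 1) / 2) ε (t ^ 2 - A) =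
      oscConst n * ∫ z, f z * ((ε + Complex.I * (‖y - z‖ ^ 2 - A : ℝ) : ℂ)⁻¹) ^ (n - 1) := by
  have hn' : (2 : ℝ) ≤ n := by exact_mod_cast hn
  set a : ℝ := ((n : ℝ) - 1) / 2 with ha
  have ha0 : 0 < a := by linarith
  have hp0 : 0 < (n : ℝ) - 1 := by linarith
  have h1 := integral_rpow_mul_integral_cexp (μ := volume.restrict (Set.Ioi (0 : ℝ)))
    (g := fun t => (u y t : ℂ)) hy.ofReal (φ := fun t => t ^ 2 - A) (by fun_prop) ha0 hε
  have h2 := integral_rpow_mul_integral_cexp (g := f) (f.integrable (μ := volume))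
    (φ := fun z => ‖y - z‖ ^ 2 - A) (by fun_prop) hp0 hε
  have hexp (k r : ℝ) : Complex.exp (-(k * Complex.I) * (r ^ 2 - A : ℝ)) =
      Complex.exp (k * Complex.I * A) * Complex.exp (-(k * Complex.I) * r ^ 2) := by
    rw [← Complex.exp_add]; congr 1; push_cast; ring
  have key : ∀ k ∈ Set.Ioi (0 : ℝ),
      (((k ^ (a - 1) : ℝ) : ℂ) * Complex.exp (-(ε * k))) *
        ∫ t in Set.Ioi (0 : ℝ), (u y t : ℂ) * Complex.exp (-(k * Complex.I) * (t ^ 2 - A : ℝ)) =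
      (2⁻¹ * ((Real.pi⁻¹ ^ a : ℝ) : ℂ) * Complex.I ^ (a : ℂ)) *
        ((((k ^ ((n : ℝ) - 1 - 1) : ℝ) : ℂ) * Complex.exp (-(ε * k))) *
        ∫ z, f z * Complex.exp (-(k * Complex.I) * (‖y - z‖ ^ 2 - A : ℝ))) := by
    intro k hk
    have hk : 0 < k := hk
    have h3 := integral_oscillatory_mul_wave f u hu hrep y hy hk
    have e1 : ∫ t in Set.Ioi (0 : ℝ), (u y t : ℂ) *
        Complex.exp (-(k * Complex.I) * (t ^ 2 - A : ℝ)) = Complex.exp (k * Complex.I * A) *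
        ∫ t in Set.Ioi (0 : ℝ), Complex.exp (-(k * Complex.I) * t ^ 2) * u y t := by
      rw [← integral_const_mul]
      congr 1; ext t; rw [hexp]; ring
    have e2 : ∫ z, f z * Complex.exp (-(k * Complex.I) * (‖y - z‖ ^ 2 - A : ℝ)) =
        Complex.exp (k * Complex.I * A) *
        ∫ z, f z * Complex.exp (-(k * Complex.I) * ‖y - z‖ ^ 2) := by
      rw [← integral_const_mul]
      congr 1; ext t; rw [hexp]; ring
    have e3 : (k * Complex.I / Real.pi : ℂ) ^ (((n : ℂ) - 1) / 2) =
        ((k ^ a : ℝ) : ℂ) * ((Real.pi⁻¹ ^ a : ℝ) : ℂ) * Complex.I ^ (a : ℂ) := by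
      have hexpo : ((n : ℂ) - 1) / 2 = (a : ℂ) := by rw [ha]; push_cast; ring
      have hq : (k * Complex.I / Real.pi : ℂ) = ((k * Real.pi⁻¹ : ℝ) : ℂ) * Complex.I := by
        push_cast; ring
      rw [hexpo, hq, Complex.cpow_def_of_ne_zero (mul_ne_zero (by
        exact_mod_cast (by positivity : k * Real.pi⁻¹ ≠ 0)) Complex.I_ne_zero),
        Complex.log_ofReal_mul (by positivity) Complex.I_ne_zero, add_mul, Complex.exp_add,
        ← Complex.cpow_def_of_ne_zero Complex.I_ne_zero, Complex.ofReal_log (by positivity),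
        ← Complex.cpow_def_of_ne_zero (by
        exact_mod_cast (by positivity : k * Real.pi⁻¹ ≠ 0)), ← Complex.ofReal_cpow (by positivity),
        Real.mul_rpow hk.le (by positivity)]
      push_cast
      ring
    have e4 : k ^ ((n : ℝ) - 1 - 1) = k ^ (a - 1) * k ^ a := by
      rw [← Real.rpow_add hk]; congr 1; rw [ha]; ring
    rw [e1, e2, h3, e3, e4]
    push_cast
    ring
  rw [setIntegral_congr_fun measurableSet_Ioi key, integral_const_mul, h2] at h1
  have hI : Complex.I ^ (a : ℂ) ≠ 0 := by simp [Complex.cpow_eq_zero_iff]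
  have hG : Complex.Gamma a ≠ 0 := by
    rw [Complex.Gamma_ofReal]; exact_mod_cast (Real.Gamma_pos_of_pos ha0).ne'
  simp_rw [inv_cpow_eq_oscKernel hε a] at h1
  have e5 : ∫ t in Set.Ioi (0 : ℝ), (u y t : ℂ) * (Complex.I ^ (a : ℂ) * oscKernel a ε (t ^ 2 - A)) =
      Complex.I ^ (a : ℂ) * ∫ t in Set.Ioi (0 : ℝ), (u y t : ℂ) * oscKernel a ε (t ^ 2 - A) := by
    rw [← integral_const_mul]
    congr 1; ext t; ring
  have e6 : ∀ w : ℂ, w ^ (((n : ℝ) - 1 : ℝ) : ℂ) = w ^ (n - 1) := fun w => by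
    rw [← Complex.cpow_natCast, Nat.cast_sub (by omega)]; push_cast; rfl
  rw [e5] at h1
  simp_rw [e6] at h1
  refine mul_left_cancel₀ (mul_ne_zero hG hI) ?_
  rw [mul_assoc, ← h1, oscConst, Complex.Gamma_ofReal, Complex.Gamma_ofReal]
  rw [Complex.Gamma_ofReal] at hG
  push_cast [← ha]
  field_simp

/-- The central projection to the unit sphere of a facet of the cube. -/
def facetProj {m : ℕ} (j : Fin (m + 1)) (s : ℝ) (w : Fin m → ℝ) : Esp (m + 1) :=
  ‖WithLp.toLp 2 (Fin.insertNth (α := fun _ => ℝ) j s w)‖⁻¹ •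
    WithLp.toLp 2 (Fin.insertNth (α := fun _ => ℝ) j s w)

lemma contDiff_facetProj {m : ℕ} (j : Fin (m + 1)) {s : ℝ} (hs : s ≠ 0) :
    ContDiff ℝ 1 (facetProj j s) := by
  have h1 : ContDiff ℝ 1 (fun w : Fin m → ℝ =>
      (WithLp.toLp 2 (Fin.insertNth (α := fun _ => ℝ) j s w) : Esp (m + 1))) := by
    refine (PiLp.contDiff_toLp (𝕜 := ℝ) (p := 2)).comp (contDiff_pi.2 fun i => ?_)
    refine Fin.succAboveCases j ?_ (fun i => ?_) i
    · simpa using contDiff_const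
    · simpa using contDiff_apply ℝ ℝ i
  have h0 (w : Fin m → ℝ) :
      (WithLp.toLp 2 (Fin.insertNth (α := fun _ => ℝ) j s w) : Esp (m + 1)) ≠ 0 := by
    intro h
    have := congrArg (fun v : Esp (m + 1) => v j) h
    simp at this
    exact hs this
  refine ContDiff.smul (ContDiff.inv (h1.norm ℝ h0) fun w => ?_) h1
  exact norm_ne_zero_iff.2 (h0 w)

lemma unitSphere_subset_iUnion_facetProj (m : ℕ) :
    unitSphere (m + 1) ⊆ ⋃ j : Fin (m + 1),
      facetProj j 1 '' Set.Icc (-1) 1 ∪ facetProj j (-1) '' Set.Icc (-1) 1 := by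
  intro y hy
  have hy : ‖y‖ = 1 := by simpa [unitSphere] using hy
  obtain ⟨j, hj⟩ := Finite.exists_max fun i => |y i|
  have hpos : 0 < |y j| := by
    by_contra h
    have : y = 0 := by
      ext i
      have := hj i
      have h2 : |y i| = 0 := le_antisymm (this.trans (not_lt.1 h)) (abs_nonneg _)
      simpa using h2
    simp [this] at hy
  refine Set.mem_iUnion.2 ⟨j, ?_⟩
  set w : Fin m → ℝ := fun i => y (j.succAbove i) / |y j| with hw
  have hwm : w ∈ Set.Icc (-1 : Fin m → ℝ) 1 := by
    have h (i : Fin m) : |w i| ≤ 1 := by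
      rw [hw]; simp only [abs_div, abs_abs]
      exact (div_le_one hpos).2 (hj _)
    exact ⟨fun i => (abs_le.1 (h i)).1, fun i => (abs_le.1 (h i)).2⟩
  have hins : ∀ s : ℝ, y j = s * |y j| → facetProj j s w = y := by
    intro s hs
    have : (WithLp.toLp 2 (Fin.insertNth (α := fun _ => ℝ) j s w) : Esp (m + 1)) =
        |y j|⁻¹ • y := by
      ext i
      refine Fin.succAboveCases j ?_ (fun i => ?_) i
      · simp only [Fin.insertNth_apply_same, PiLp.smul_apply, smul_eq_mul]
        rw [eq_inv_mul_iff_mul_eq₀ hpos.ne', mul_comm, ← hs]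
      · simp [hw]; field_simp
    rw [facetProj, this, norm_smul, hy, Real.norm_of_nonneg (by positivity), smul_smul]
    field_simp
    simp
  rcases le_total 0 (y j) with h | h
  · exact Or.inl ⟨w, hwm, hins 1 (by rw [abs_of_nonneg h, one_mul])⟩
  · exact Or.inr ⟨w, hwm, hins (-1) (by rw [abs_of_nonpos h]; ring)⟩

lemma sphMeasure_unitSphere_lt_top (hn : 1 ≤ n) : sphMeasure n (unitSphere n) < ⊤ := by
  obtain ⟨m, rfl⟩ : ∃ m, n = m + 1 := ⟨n - 1, by omega⟩
  have hd : ((m + 1 : ℕ) : ℝ) - 1 = m := by push_cast; ring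
  have hfac (j : Fin (m + 1)) {s : ℝ} (hs : s ≠ 0) :
      μH[(m : ℝ)] (facetProj j s '' Set.Icc (-1) 1) < ⊤ := by
    obtain ⟨K, hK⟩ := (contDiff_facetProj j hs).contDiffOn.exists_lipschitzOnWith one_ne_zero
      (convex_Icc (-1 : Fin m → ℝ) 1) isCompact_Icc
    refine (hK.hausdorffMeasure_image_le (Nat.cast_nonneg m)).trans_lt ?_
    have hv : (μH[(m : ℝ)] : Measure (Fin m → ℝ)) = volume := by
      simpa using hausdorffMeasure_pi_real (ι := Fin m)
    rw [hv]
    exact ENNReal.mul_lt_top (by simp) isCompact_Icc.measure_lt_top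
  rw [sphMeasure, hd]
  refine (measure_mono (unitSphere_subset_iUnion_facetProj m)).trans_lt ?_
  refine (measure_iUnion_fintype_le _ _).trans_lt (ENNReal.sum_lt_top.2 fun j _ => ?_)
  exact (measure_union_le _ _).trans_lt
    (ENNReal.add_lt_top.2 ⟨hfac j one_ne_zero, hfac j (by norm_num)⟩)

/-- The surface measure of the unit sphere, as a measure on the ambient space. -/
abbrev surfMeasure (n : ℕ) : Measure (Esp n) := (sphMeasure n).restrict (unitSphere n)

lemma isFiniteMeasure_surfMeasure (hn : 1 ≤ n) : IsFiniteMeasure (surfMeasure n) :=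
  ⟨by simpa using sphMeasure_unitSphere_lt_top hn⟩

lemma measurableSet_unitSphere : MeasurableSet (unitSphere n) := Metric.isClosed_sphere.measurableSet

lemma ae_surfMeasure_norm : ∀ᵐ y ∂(surfMeasure n), ‖y‖ = 1 := by
  filter_upwards [ae_restrict_mem measurableSet_unitSphere] with y hy
  simpa [unitSphere] using hy

lemma integral_surfMeasure_comp (e : Esp n ≃ₗᵢ[ℝ] Esp n) {E : Type*} [NormedAddCommGroup E]
    [NormedSpace ℝ E] (F : Esp n → E) :
    ∫ y, F (e y) ∂(surfMeasure n) = ∫ y, F y ∂(surfMeasure n) := by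
  have h := (e.toIsometryEquiv.measurePreserving_hausdorffMeasure ((n : ℝ) - 1)).restrict_preimage
    (measurableSet_unitSphere (n := n))
  have hpre : e.toIsometryEquiv ⁻¹' unitSphere n = unitSphere n := by
    ext y; simp [unitSphere]
  rw [hpre] at h
  exact h.integral_comp e.toHomeomorph.measurableEmbedding F

lemma integral_surfMeasure_inner {v w : Esp n} (hvw : ‖v‖ = ‖w‖) {E : Type*}
    [NormedAddCommGroup E] [NormedSpace ℝ E] (F : ℝ → E) :
    ∫ y, F (inner ℝ v y) ∂(surfMeasure n) = ∫ y, F (inner ℝ w y) ∂(surfMeasure n) := by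
  rw [← integral_surfMeasure_comp (Submodule.reflection (ℝ ∙ (v - w))ᗮ)]
  congr 1; ext y; congr 1
  rw [← LinearIsometryEquiv.inner_map_map (Submodule.reflection (ℝ ∙ (v - w))ᗮ) v,
    Submodule.reflection_sub hvw, Submodule.reflection_reflection]

lemma integral_surfMeasure_inner_smul {e v : Esp n} (h : inner ℝ e v = (0 : ℝ)) (ψ : ℝ → ℂ) :
    ∫ y, ((inner ℝ e y : ℝ) : ℂ) * ψ (inner ℝ v y) ∂(surfMeasure n) = 0 := by
  have h1 := integral_surfMeasure_comp (Submodule.reflection (ℝ ∙ e)ᗮ)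
    (fun y => ((inner ℝ e y : ℝ) : ℂ) * ψ (inner ℝ v y))
  have he : Submodule.reflection (ℝ ∙ e)ᗮ e = -e :=
    Submodule.reflection_orthogonalComplement_singleton_eq_neg e
  have hv : Submodule.reflection (ℝ ∙ e)ᗮ v = v :=
    Submodule.reflection_mem_subspace_eq_self
      (Submodule.mem_orthogonal_singleton_iff_inner_right.2 h)
  have e1 (y : Esp n) : inner ℝ e (Submodule.reflection (ℝ ∙ e)ᗮ y) = -inner ℝ e y := by
    rw [← LinearIsometryEquiv.inner_map_map (Submodule.reflection (ℝ ∙ e)ᗮ),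
      Submodule.reflection_reflection, he, inner_neg_left]
  have e2 (y : Esp n) : inner ℝ v (Submodule.reflection (ℝ ∙ e)ᗮ y) = inner ℝ v y := by
    rw [← LinearIsometryEquiv.inner_map_map (Submodule.reflection (ℝ ∙ e)ᗮ),
      Submodule.reflection_reflection, hv]
  simp only [e1, e2, Complex.ofReal_neg, neg_mul, integral_neg] at h1
  exact self_eq_neg.1 h1.symm

lemma integral_surfMeasure_rotation (hn : 1 ≤ n) {e b : Esp n} (he : ‖e‖ = 1) (hb : ‖b‖ = 1)
    (hab : inner ℝ e b = (0 : ℝ)) {ψ ψ' : ℝ → ℂ} (hψ : ∀ s, HasDerivAt ψ (ψ' s) s)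
    (hψ' : Continuous ψ') {K : ℝ} (hK : ∀ s, ‖ψ s‖ ≤ K) (hK' : ∀ s, ‖ψ' s‖ ≤ K) :
    ∫ y, (-((inner ℝ e y : ℝ) : ℂ) * ψ (inner ℝ e y) +
      ((inner ℝ b y : ℝ) : ℂ) ^ 2 * ψ' (inner ℝ e y)) ∂(surfMeasure n) = 0 := by
  have := isFiniteMeasure_surfMeasure hn
  have hψc : Continuous ψ := continuous_iff_continuousAt.2 fun s => (hψ s).continuousAt
  set v : ℝ → Esp n := fun θ => Real.cos θ • e + Real.sin θ • b with hv
  set v' : ℝ → Esp n := fun θ => -Real.sin θ • e + Real.cos θ • b with hv'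
  have horth (θ : ℝ) : inner ℝ (v' θ) (v θ) = (0 : ℝ) := by
    simp only [hv, hv', inner_add_left, inner_add_right, real_inner_smul_left,
      real_inner_smul_right, real_inner_self_eq_norm_sq, he, hb, hab, real_inner_comm e b]
    ring
  have hbd (c s : ℝ) (hc : |c| ≤ 1) (hs : |s| ≤ 1) (y : Esp n) (hy : ‖y‖ = 1) :
      |inner ℝ (c • e + s • b) y| ≤ 2 := by
    refine (abs_real_inner_le_norm _ _).trans ?_
    rw [hy, mul_one]
    refine (norm_add_le _ _).trans ?_
    rw [norm_smul, norm_smul, he, hb, Real.norm_eq_abs, Real.norm_eq_abs]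
    linarith
  have hK0 : 0 ≤ K := (norm_nonneg _).trans (hK 0)
  have hd := (hasDerivAt_integral_of_dominated_loc_of_deriv_le (μ := surfMeasure n)
    (F := fun θ y => ((inner ℝ (v' θ) y : ℝ) : ℂ) * ψ (inner ℝ (v θ) y))
    (F' := fun θ y => ((-inner ℝ (v θ) y : ℝ) : ℂ) * ψ (inner ℝ (v θ) y) +
      ((inner ℝ (v' θ) y : ℝ) : ℂ) * (((inner ℝ (v' θ) y : ℝ) : ℂ) * ψ' (inner ℝ (v θ) y)))
    (bound := fun _ => 2 * K + 2 * (2 * K)) (x₀ := (0 : ℝ)) univ_mem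
    (.of_forall fun θ => (Continuous.aestronglyMeasurable (by fun_prop))) ?_
    (Continuous.aestronglyMeasurable (by fun_prop)) ?_ (integrable_const _) ?_).2
  · simp only [integral_surfMeasure_inner_smul (horth _)] at hd
    have h0 := hd.unique (hasDerivAt_const (0 : ℝ) (0 : ℂ))
    rw [← h0]
    congr 1; ext y
    simp [hv, hv']
    ring
  · refine (integrable_const (2 * K)).mono' (Continuous.aestronglyMeasurable (by fun_prop)) ?_
    filter_upwards [ae_surfMeasure_norm] with y hy
    rw [norm_mul, Complex.norm_real, Real.norm_eq_abs]
    gcongr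
    · exact hbd _ _ (by simp) (by simp) y hy
    · exact hK _
  · filter_upwards [ae_surfMeasure_norm] with y hy θ _
    have h1 : |inner ℝ (v θ) y| ≤ 2 :=
      hbd _ _ (Real.abs_cos_le_one θ) (Real.abs_sin_le_one θ) y hy
    have h2 : |inner ℝ (v' θ) y| ≤ 2 :=
      hbd _ _ (by rw [abs_neg]; exact Real.abs_sin_le_one θ) (Real.abs_cos_le_one θ) y hy
    refine (norm_add_le _ _).trans ?_
    rw [norm_mul, norm_mul, norm_mul, Complex.norm_real, Complex.norm_real, Real.norm_eq_abs,
      Real.norm_eq_abs, abs_neg]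
    gcongr
    · exact hK _
    · exact hK' _
  · refine .of_forall fun y θ _ => ?_
    have d1 : HasDerivAt (fun θ => inner ℝ (v θ) y) (inner ℝ (v' θ) y) θ := by
      have := (((Real.hasDerivAt_cos θ).mul_const (inner ℝ e y)).add
        ((Real.hasDerivAt_sin θ).mul_const (inner ℝ b y)))
      refine (this.congr_deriv ?_).congr_of_eventuallyEq (.of_forall fun t => ?_)
      · simp only [hv', inner_add_left, real_inner_smul_left]
      · simp only [hv, inner_add_left, real_inner_smul_left, Pi.add_apply]
    have d2 : HasDerivAt (fun θ => inner ℝ (v' θ) y) (-inner ℝ (v θ) y) θ := by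
      have := (((Real.hasDerivAt_sin θ).neg.mul_const (inner ℝ e y)).add
        ((Real.hasDerivAt_cos θ).mul_const (inner ℝ b y)))
      refine (this.congr_deriv ?_).congr_of_eventuallyEq (.of_forall fun t => ?_)
      · simp only [hv, inner_add_left, real_inner_smul_left]; ring
      · simp only [hv', inner_add_left, real_inner_smul_left, Pi.add_apply, Pi.neg_apply]
    refine (d2.ofReal_comp.mul ((hψ _).scomp θ d1)).congr_deriv ?_
    simp only [Complex.real_smul, comp_apply]

lemma inner_single_one (i : Fin n) (y : Esp n) :
    inner ℝ (EuclideanSpace.single i (1 : ℝ)) y = y i := by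
  simp [EuclideanSpace.inner_single_left]

lemma integral_surfMeasure_identity (i₀ : Fin n) {ψ ψ' : ℝ → ℂ}
    (hψ : ∀ s, HasDerivAt ψ (ψ' s) s)
    (hψ' : Continuous ψ') {K : ℝ} (hK : ∀ s, ‖ψ s‖ ≤ K) (hK' : ∀ s, ‖ψ' s‖ ≤ K) :
    ∫ y, (((n : ℂ) - 1) * (y i₀ : ℂ) * ψ (y i₀) - (1 - (y i₀ : ℂ) ^ 2) * ψ' (y i₀))
      ∂(surfMeasure n) = 0 := by
  have hn : 1 ≤ n := Fin.pos i₀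
  have := isFiniteMeasure_surfMeasure hn
  have hψc : Continuous ψ := continuous_iff_continuousAt.2 fun s => (hψ s).continuousAt
  have hK0 : 0 ≤ K := (norm_nonneg _).trans (hK 0)
  have key : ∀ i ∈ Finset.univ.erase i₀, ∫ y, (-(y i₀ : ℂ) * ψ (y i₀) +
      (y i : ℂ) ^ 2 * ψ' (y i₀)) ∂(surfMeasure n) = 0 := by
    intro i hi
    have h := integral_surfMeasure_rotation hn (e := EuclideanSpace.single i₀ (1 : ℝ))
      (b := EuclideanSpace.single i (1 : ℝ)) (by simp) (by simp)
      (by rw [inner_single_one]; simp [(Finset.ne_of_mem_erase hi).symm]) hψ hψ' hK hK'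
    simpa only [inner_single_one] using h
  have hint : ∀ i ∈ Finset.univ.erase i₀, Integrable (fun y : Esp n => -(y i₀ : ℂ) * ψ (y i₀) +
      (y i : ℂ) ^ 2 * ψ' (y i₀)) (surfMeasure n) := by
    intro i hi
    refine (integrable_const (K + K)).mono' (Continuous.aestronglyMeasurable (by fun_prop)) ?_
    filter_upwards [ae_surfMeasure_norm] with y hy
    have hc (j : Fin n) : ‖y j‖ ≤ 1 := (PiLp.norm_apply_le y j).trans hy.le
    refine (norm_add_le _ _).trans ?_
    rw [norm_mul, norm_mul, norm_neg, norm_pow, Complex.norm_real, Complex.norm_real]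
    refine add_le_add ?_ ?_
    · exact (mul_le_mul (hc _) (hK _) (norm_nonneg _) zero_le_one).trans_eq (one_mul _)
    · exact (mul_le_mul (pow_le_one₀ (norm_nonneg _) (hc _)) (hK' _) (norm_nonneg _)
        zero_le_one).trans_eq (one_mul _)
  have hs := Finset.sum_eq_zero key
  rw [← integral_finsetSum _ hint] at hs
  rw [← neg_eq_zero, ← integral_neg, ← hs]
  refine integral_congr_ae ?_
  filter_upwards [ae_surfMeasure_norm] with y hy
  have hsum : ∑ i ∈ Finset.univ.erase i₀, (y i : ℂ) ^ 2 = 1 - (y i₀ : ℂ) ^ 2 := by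
    have h1 := EuclideanSpace.real_norm_sq_eq y
    rw [hy, ← Finset.add_sum_erase _ _ (Finset.mem_univ i₀)] at h1
    rw [eq_sub_iff_add_eq']
    have h2 := congrArg (Complex.ofReal) h1
    push_cast at h2
    rw [← h2]; norm_num
  rw [Finset.sum_add_distrib, ← Finset.sum_mul _ (fun i => (y i : ℂ) ^ 2), hsum, Finset.sum_const,
    Finset.card_erase_of_mem (Finset.mem_univ _), Finset.card_univ, Fintype.card_fin,
    nsmul_eq_mul, Nat.cast_sub hn]
  push_cast
  ring

/-- The average over the sphere of a plane-wave power. -/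
def planePow (i₀ : Fin n) (w : ℂ) : ℂ :=
  ∫ y, ((w - Complex.I * (y i₀ : ℂ))⁻¹) ^ (n - 1) ∂(surfMeasure n)

lemma re_sub_I_mul (w : ℂ) (s : ℝ) : (w - Complex.I * s).re = w.re := by simp

lemma sub_I_mul_ne_zero {w : ℂ} (hw : 0 < w.re) (s : ℝ) : w - Complex.I * s ≠ 0 := by
  intro h
  have := re_sub_I_mul w s
  rw [h] at this
  simp at this
  linarith

lemma norm_inv_sub_I_mul_le {w : ℂ} (s : ℝ) {r : ℝ} (hr : 0 < r) (h : r ≤ w.re) :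
    ‖(w - Complex.I * s)⁻¹‖ ≤ r⁻¹ := by
  rw [norm_inv]
  gcongr
  exact h.trans ((re_sub_I_mul w s).symm.le.trans (Complex.re_le_norm _))

lemma one_add_sq_mem_slitPlane {w : ℂ} (hw : 0 < w.re) : 1 + w ^ 2 ∈ Complex.slitPlane := by
  by_cases h : w.im = 0
  · left
    simp [pow_two, h]
    positivity
  · right
    simp only [pow_two, Complex.add_im, Complex.one_im, Complex.mul_im, zero_add]
    have : w.re * w.im ≠ 0 := mul_ne_zero hw.ne' h
    intro h2
    apply this
    linarith

lemma planePow_integral (i₀ : Fin n) {w : ℂ} (hw : 0 < w.re) :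
    ∫ y, ((w - Complex.I * (y i₀ : ℂ))⁻¹) ^ n * (w * (y i₀ : ℂ) - Complex.I)
      ∂(surfMeasure n) = 0 ∨ n = 1 := by
  rcases eq_or_ne n 1 with h1 | h1
  · exact Or.inr h1
  left
  obtain ⟨N, rfl⟩ : ∃ N, n = N + 1 := ⟨n - 1, by have := Fin.pos i₀; omega⟩
  have hN : (N : ℂ) ≠ 0 := by exact_mod_cast (by omega : N ≠ 0)
  have hd (s : ℝ) : HasDerivAt (fun s : ℝ => (w - Complex.I * s)⁻¹)
      (Complex.I * ((w - Complex.I * s)⁻¹) ^ 2) s := by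
    have h1 : HasDerivAt (fun s : ℝ => w - Complex.I * s) (-Complex.I) s := by
      have := (((hasDerivAt_id s).ofReal_comp).const_mul Complex.I).const_sub w
      exact this.congr_deriv (by simp)
    refine (h1.inv (sub_I_mul_ne_zero hw s)).congr_deriv ?_
    rw [inv_pow, div_eq_mul_inv, neg_neg]
  have hc : Continuous fun s : ℝ => (w - Complex.I * s)⁻¹ :=
    continuous_iff_continuousAt.2 fun s => (hd s).continuousAt
  have hψ (s : ℝ) : HasDerivAt (fun s : ℝ => ((w - Complex.I * s)⁻¹) ^ N)
      (N * Complex.I * ((w - Complex.I * s)⁻¹) ^ (N + 1)) s := by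
    refine ((hd s).pow N).congr_deriv ?_
    obtain ⟨M, rfl⟩ : ∃ M, N = M + 1 := ⟨N - 1, by omega⟩
    simp only [Nat.add_sub_cancel]
    ring
  have hb (s : ℝ) (k : ℕ) : ‖((w - Complex.I * s)⁻¹) ^ k‖ ≤ (w.re⁻¹) ^ k := by
    rw [norm_pow]
    gcongr
    exact norm_inv_sub_I_mul_le s hw le_rfl
  have hp (k : ℕ) : 0 ≤ (w.re⁻¹) ^ k := by positivity
  have h := integral_surfMeasure_identity i₀ hψ (by fun_prop)
    (K := (w.re⁻¹) ^ N + N * (w.re⁻¹) ^ (N + 1)) (fun s => (hb s N).trans (by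
      have := mul_nonneg (Nat.cast_nonneg (α := ℝ) N) (hp (N + 1)); linarith))
    (fun s => by
      rw [norm_mul, norm_mul, Complex.norm_I, mul_one, Complex.norm_natCast]
      have := mul_le_mul_of_nonneg_left (hb s (N + 1)) (Nat.cast_nonneg (α := ℝ) N)
      have := hp N
      linarith)
  refine (mul_eq_zero.1 ?_).resolve_left hN
  rw [← integral_const_mul, ← h]
  congr 1; ext y
  have h0 := sub_I_mul_ne_zero hw (y i₀)
  have e1 : ((w - Complex.I * (y i₀ : ℂ))⁻¹) ^ N =
      ((w - Complex.I * (y i₀ : ℂ))⁻¹) ^ (N + 1) * (w - Complex.I * (y i₀ : ℂ)) := by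
    rw [pow_succ, mul_assoc, inv_mul_cancel₀ h0, mul_one]
  rw [e1]
  push_cast
  ring

lemma hasDerivAt_planePow (i₀ : Fin n) {w : ℂ} (hw : 0 < w.re) :
    HasDerivAt (planePow i₀)
      (∫ y, -((n - 1 : ℕ) : ℂ) * ((w - Complex.I * (y i₀ : ℂ))⁻¹) ^ n ∂(surfMeasure n)) w := by
  obtain ⟨N, rfl⟩ : ∃ N, n = N + 1 := ⟨n - 1, by have := Fin.pos i₀; omega⟩
  have := isFiniteMeasure_surfMeasure (n := N + 1) (by omega)
  have hn : {z : ℂ | w.re / 2 < z.re} ∈ 𝓝 w :=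
    (isOpen_lt continuous_const Complex.continuous_re).mem_nhds
      (by simpa using half_lt_self hw)
  have hb (z : ℂ) (hz : w.re / 2 < z.re) (s : ℝ) (k : ℕ) :
      ‖((z - Complex.I * s)⁻¹) ^ k‖ ≤ ((w.re / 2)⁻¹) ^ k := by
    rw [norm_pow]
    gcongr
    exact norm_inv_sub_I_mul_le s (half_pos hw) hz.le
  have hm (z : ℂ) (k : ℕ) : AEStronglyMeasurable
      (fun y : Esp (N + 1) => ((z - Complex.I * (y i₀ : ℂ))⁻¹) ^ k) (surfMeasure (N + 1)) :=
    Measurable.aestronglyMeasurable (by fun_prop)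
  simp only [Nat.add_sub_cancel]
  refine (hasDerivAt_integral_of_dominated_loc_of_deriv_le (μ := surfMeasure (N + 1))
    (F := fun w y => ((w - Complex.I * (y i₀ : ℂ))⁻¹) ^ (N + 1 - 1))
    (F' := fun w y => -(N : ℂ) * ((w - Complex.I * (y i₀ : ℂ))⁻¹) ^ (N + 1))
    (bound := fun _ => N * ((w.re / 2)⁻¹) ^ (N + 1)) hn (.of_forall fun z => hm z _)
    ((integrable_const (((w.re / 2)⁻¹) ^ N)).mono' (hm w _)
      (.of_forall fun y => hb w (half_lt_self hw) _ _))
    ((hm w _).const_mul _) (.of_forall fun y z hz => ?_) (integrable_const _)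
    (.of_forall fun y z hz => ?_)).2
  · rw [norm_mul, norm_neg, Complex.norm_natCast]
    gcongr
    exact hb z hz _ _
  · have hz' : 0 < z.re := (half_pos hw).trans hz
    have h0 := sub_I_mul_ne_zero hz' (y i₀)
    have h1 : HasDerivAt (fun z : ℂ => (z - Complex.I * (y i₀ : ℂ))⁻¹)
        (-((z - Complex.I * (y i₀ : ℂ))⁻¹) ^ 2) z := by
      refine (((hasDerivAt_id z).sub_const _).inv h0).congr_deriv ?_
      simp [div_eq_mul_inv]
    refine (h1.pow N).congr_deriv ?_
    rcases N with _ | M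
    · simp
    · simp only [Nat.add_sub_cancel]; ring

theorem planePow_eq (hn : 2 ≤ n) (i₀ : Fin n) : ∃ C : ℝ, ∀ w : ℂ, 0 < w.re →
    planePow i₀ w = C * (1 + w ^ 2) ^ (-(((n : ℂ) - 1) / 2)) := by
  have := isFiniteMeasure_surfMeasure (n := n) (by omega)
  set a : ℂ := ((n : ℂ) - 1) / 2 with ha
  set U : Set ℂ := {w | 0 < w.re} with hU
  have hUo : IsOpen U := isOpen_lt continuous_const Complex.continuous_re
  have hd (w : ℂ) (hw : w ∈ U) : HasDerivAt (fun w => (1 + w ^ 2) ^ a * planePow i₀ w) 0 w := by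
    have hw : 0 < w.re := hw
    have hs := one_add_sq_mem_slitPlane hw
    have h1 : HasDerivAt (fun w : ℂ => 1 + w ^ 2) (2 * w) w := by
      refine ((hasDerivAt_pow 2 w).const_add 1).congr_deriv (by simp)
    refine ((h1.cpow_const (c := a) hs).mul (hasDerivAt_planePow i₀ hw)).congr_deriv ?_
    have hz := (planePow_integral i₀ hw).resolve_right (by omega)
    have hcp : (1 + w ^ 2) ^ a = (1 + w ^ 2) ^ (a - 1) * (1 + w ^ 2) := by
      conv_lhs => rw [← sub_add_cancel a 1]
      rw [Complex.cpow_add _ _ (Complex.slitPlane_ne_zero hs), Complex.cpow_one]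
    have hb (k : ℕ) : Integrable (fun y : Esp n => ((w - Complex.I * (y i₀ : ℂ))⁻¹) ^ k)
        (surfMeasure n) := by
      refine (integrable_const ((w.re⁻¹) ^ k)).mono'
        (Measurable.aestronglyMeasurable (by fun_prop)) (.of_forall fun y => ?_)
      rw [norm_pow]
      gcongr
      exact norm_inv_sub_I_mul_le _ hw le_rfl
    have hkey : 2 * a * w * planePow i₀ w + (1 + w ^ 2) *
        ∫ y, -((n - 1 : ℕ) : ℂ) * ((w - Complex.I * (y i₀ : ℂ))⁻¹) ^ n ∂(surfMeasure n) = 0 := by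
      rw [planePow, ← integral_const_mul, ← integral_const_mul, ← integral_add
        ((hb _).const_mul _) (((hb n).const_mul _).const_mul _)]
      have h2a : 2 * a = ((n - 1 : ℕ) : ℂ) := by
        rw [ha, Nat.cast_sub (by omega)]; push_cast; ring
      calc _ = ∫ y, -(((n - 1 : ℕ) : ℂ) * Complex.I) *
            (((w - Complex.I * (y i₀ : ℂ))⁻¹) ^ n * (w * (y i₀ : ℂ) - Complex.I))
            ∂(surfMeasure n) := by
            congr 1; ext y
            have h0 := sub_I_mul_ne_zero hw (y i₀)
            have e1 : ((w - Complex.I * (y i₀ : ℂ))⁻¹) ^ (n - 1) =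
                ((w - Complex.I * (y i₀ : ℂ))⁻¹) ^ n * (w - Complex.I * (y i₀ : ℂ)) := by
              obtain ⟨N, rfl⟩ : ∃ N, n = N + 1 := ⟨n - 1, by omega⟩
              rw [Nat.add_sub_cancel, pow_succ, mul_assoc, inv_mul_cancel₀ h0, mul_one]
            rw [e1, h2a]
            linear_combination (-((n - 1 : ℕ) : ℂ) *
              ((w - Complex.I * (y i₀ : ℂ))⁻¹) ^ n) * Complex.I_mul_I
        _ = 0 := by rw [integral_const_mul, hz, mul_zero]
    rw [hcp]
    linear_combination ((1 + w ^ 2) ^ (a - 1)) * hkey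
  obtain ⟨C, hC⟩ := hUo.exists_is_const_of_deriv_eq_zero
    (convex_halfSpace_re_gt 0).isPreconnected
    (f := fun w => (1 + w ^ 2) ^ a * planePow i₀ w)
    (fun w hw => (hd w hw).differentiableAt.differentiableWithinAt)
    (fun w hw => (hd w hw).deriv)
  have h1 : (1 : ℂ) ∈ U := by simp [hU]
  have hconj : (starRingEnd ℂ) (planePow i₀ 1) = planePow i₀ 1 := by
    have h2 := integral_surfMeasure_comp (LinearIsometryEquiv.neg ℝ)
      (fun y : Esp n => ((1 - Complex.I * (y i₀ : ℂ))⁻¹) ^ (n - 1))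
    rw [planePow, ← integral_conj, ← h2]
    congr 1; ext y
    simp
  have hreal : C.im = 0 := by
    have h3 := hC 1 h1
    rw [← h3]
    have e1 : (1 + 1 ^ 2 : ℂ) ^ a = ((2 ^ (((n : ℝ) - 1) / 2) : ℝ) : ℂ) := by
      rw [Complex.ofReal_cpow (by norm_num), ha]; push_cast; norm_num
    rw [e1, Complex.im_ofReal_mul, Complex.conj_eq_iff_im.1 hconj, mul_zero]
  refine ⟨C.re, fun w hw => ?_⟩
  have hs := one_add_sq_mem_slitPlane hw
  have h3 := hC w hw
  have hC' : ((C.re : ℝ) : ℂ) = C := Complex.ext (by simp) (by simp [hreal])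
  rw [hC', ← h3, Complex.cpow_neg]
  have : (1 + w ^ 2) ^ a ≠ 0 := by
    simp [Complex.cpow_eq_zero_iff, Complex.slitPlane_ne_zero hs]
  field_simp

/-- The kernel appearing in the spatial representation of the regularized data. -/
def spaceKernel (x : Esp n) (ε : ℝ) (z y : Esp n) : ℂ :=
  ((ε + Complex.I * (‖y - z‖ ^ 2 - ‖x - y‖ ^ 2 : ℝ) : ℂ)⁻¹) ^ (n - 1)

lemma measurable_spaceKernel (x : Esp n) (ε : ℝ) :
    Measurable (fun p : Esp n × Esp n => spaceKernel x ε p.1 p.2) := by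
  unfold spaceKernel
  fun_prop

lemma norm_spaceKernel_le (x : Esp n) {ε : ℝ} (hε : 0 < ε) (z y : Esp n) :
    ‖spaceKernel x ε z y‖ ≤ (ε⁻¹) ^ (n - 1) := by
  rw [spaceKernel, norm_pow, norm_inv]
  gcongr
  refine le_trans (le_of_eq ?_) (Complex.re_le_norm _)
  rw [Complex.add_re, Complex.ofReal_re, Complex.I_mul_re, Complex.ofReal_im, neg_zero, add_zero]

lemma integral_spaceKernel (i₀ : Fin n) {x z : Esp n} (hxz : z ≠ x) (ε : ℝ) :
    ∫ y, spaceKernel x ε z y ∂(surfMeasure n) = (((2 * ‖z - x‖)⁻¹ ^ (n - 1) : ℝ) : ℂ) *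
      planePow i₀ ((ε + Complex.I * (‖z‖ ^ 2 - ‖x‖ ^ 2 : ℝ)) / (2 * ‖z - x‖ : ℝ)) := by
  set ρ : ℝ := 2 * ‖z - x‖ with hρ
  have hρ0 : 0 < ρ := by
    have := norm_pos_iff.2 (sub_ne_zero.2 hxz)
    positivity
  set β : ℝ := ‖z‖ ^ 2 - ‖x‖ ^ 2 with hβ
  have h1 : ∫ y, spaceKernel x ε z y ∂(surfMeasure n) =
      ∫ y, (fun s : ℝ => ((ε + Complex.I * (β - s : ℝ) : ℂ)⁻¹) ^ (n - 1))
        (inner ℝ ((2 : ℝ) • (z - x)) y) ∂(surfMeasure n) := by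
    congr 1; ext y
    simp only [spaceKernel]
    congr 5
    rw [norm_sub_sq_real, norm_sub_sq_real, real_inner_smul_left, inner_sub_left,
      real_inner_comm z y]
    ring
  have h2 : ‖(2 : ℝ) • (z - x)‖ = ‖ρ • EuclideanSpace.single i₀ (1 : ℝ)‖ := by
    rw [norm_smul, norm_smul, Real.norm_of_nonneg hρ0.le]
    simp [hρ]
  rw [h1, integral_surfMeasure_inner h2 (fun s : ℝ => ((ε + Complex.I * (β - s : ℝ) : ℂ)⁻¹) ^ (n - 1)),
    planePow, ← integral_const_mul]
  congr 1; ext y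
  simp only
  rw [real_inner_smul_left, inner_single_one, Complex.ofReal_pow, ← mul_pow, Complex.ofReal_inv,
    ← mul_inv]
  congr 2
  have : (ρ : ℂ) ≠ 0 := by exact_mod_cast hρ0.ne'
  push_cast
  field_simp
  ring

lemma abs_norm_sq_sub_le {x z : Esp n} (hz : ‖z‖ ≤ 1) :
    |‖z‖ ^ 2 - ‖x‖ ^ 2| ≤ (2 * ‖z - x‖) * ((1 + ‖x‖) / 2) := by
  have h1 : |‖z‖ - ‖x‖| ≤ ‖z - x‖ := abs_norm_sub_norm_le z x
  have h2 : ‖z‖ ^ 2 - ‖x‖ ^ 2 = (‖z‖ - ‖x‖) * (‖z‖ + ‖x‖) := by ring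
  rw [h2, abs_mul, abs_of_nonneg (by positivity : 0 ≤ ‖z‖ + ‖x‖)]
  have := norm_nonneg x
  have := norm_nonneg (z - x)
  calc _ ≤ ‖z - x‖ * (1 + ‖x‖) := by gcongr
    _ = _ := by ring

lemma le_norm_one_add_sq {w : ℂ} {d : ℝ} (hd : 0 ≤ d) (hw : |w.im| ≤ 1 - d) :
    d ^ 2 ≤ ‖1 + w ^ 2‖ := by
  have h := abs_le.1 hw
  have h1 : 1 + w ^ 2 = (w - Complex.I) * (w + Complex.I) := by
    linear_combination Complex.I_mul_I
  rw [h1, norm_mul, pow_two]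
  have e1 : d ≤ ‖w - Complex.I‖ := by
    refine le_trans ?_ (Complex.abs_im_le_norm _)
    rw [Complex.sub_im, Complex.I_im, le_abs]
    right; linarith
  have e2 : d ≤ ‖w + Complex.I‖ := by
    refine le_trans ?_ (Complex.abs_im_le_norm _)
    rw [Complex.add_im, Complex.I_im, le_abs]
    left; linarith
  gcongr

lemma spaceKernel_arg_re_im {ε β ρ : ℝ} : ((ε + Complex.I * β) / (ρ : ℂ) : ℂ).re = ε / ρ ∧
    ((ε + Complex.I * β) / (ρ : ℂ) : ℂ).im = β / ρ := by
  rw [Complex.div_ofReal_re, Complex.div_ofReal_im]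
  simp

lemma norm_integral_spaceKernel_le (hn : 2 ≤ n) {x : Esp n} (hx : ‖x‖ < 1) :
    ∃ C : ℝ, ∀ z, ‖z‖ ≤ 1 → z ≠ x → ∀ ε > 0,
      ‖∫ y, spaceKernel x ε z y ∂(surfMeasure n)‖ ≤ C * (‖z - x‖⁻¹) ^ (n - 1) := by
  set i₀ : Fin n := ⟨0, by omega⟩
  obtain ⟨C, hC⟩ := planePow_eq hn i₀
  set d : ℝ := (1 - ‖x‖) / 2 with hd
  have hd0 : 0 < d := by rw [hd]; linarith
  have hn' : (2 : ℝ) ≤ n := by exact_mod_cast hn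
  refine ⟨|C| * (d ^ 2) ^ (-(((n : ℝ) - 1) / 2)), fun z hz hzx ε hε => ?_⟩
  have hρ0 : 0 < 2 * ‖z - x‖ := by
    have := norm_pos_iff.2 (sub_ne_zero.2 hzx)
    positivity
  obtain ⟨hre, him⟩ := spaceKernel_arg_re_im (ε := ε) (β := ‖z‖ ^ 2 - ‖x‖ ^ 2) (ρ := 2 * ‖z - x‖)
  rw [integral_spaceKernel i₀ hzx, hC _ (by rw [hre]; positivity)]
  set w : ℂ := (ε + Complex.I * (‖z‖ ^ 2 - ‖x‖ ^ 2 : ℝ)) / (2 * ‖z - x‖ : ℝ) with hw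
  have hexp : (-(((n : ℂ) - 1) / 2)) = ((-(((n : ℝ) - 1) / 2) : ℝ) : ℂ) := by push_cast; ring
  have h1 : d ^ 2 ≤ ‖1 + w ^ 2‖ := by
    refine le_norm_one_add_sq hd0.le ?_
    rw [him, abs_div, abs_of_pos hρ0, div_le_iff₀ hρ0]
    refine (abs_norm_sq_sub_le hz).trans_eq ?_
    rw [hd]; ring
  rw [norm_mul, norm_mul, hexp, Complex.norm_cpow_real, Complex.norm_real, Complex.norm_real,
    Real.norm_eq_abs C, Real.norm_of_nonneg (by positivity), mul_comm]
  have h2 : ‖1 + w ^ 2‖ ^ (-(((n : ℝ) - 1) / 2)) ≤ (d ^ 2) ^ (-(((n : ℝ) - 1) / 2)) :=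
    Real.rpow_le_rpow_of_nonpos (by positivity) h1 (by linarith)
  have h3 : (2 * ‖z - x‖)⁻¹ ≤ ‖z - x‖⁻¹ := by
    have := norm_pos_iff.2 (sub_ne_zero.2 hzx)
    gcongr; linarith
  gcongr

lemma tendsto_im_integral_spaceKernel (hn : 2 ≤ n) {x : Esp n} (hx : ‖x‖ < 1) {z : Esp n}
    (hz : ‖z‖ ≤ 1) (hzx : z ≠ x) {ε : ℕ → ℝ} (hε : ∀ m, 0 < ε m) (hε0 : Tendsto ε atTop (𝓝 0)) :
    Tendsto (fun m => (∫ y, spaceKernel x (ε m) z y ∂(surfMeasure n)).im) atTop (𝓝 0) := by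
  set i₀ : Fin n := ⟨0, by omega⟩
  obtain ⟨C, hC⟩ := planePow_eq hn i₀
  have hρ0 : 0 < 2 * ‖z - x‖ := by
    have := norm_pos_iff.2 (sub_ne_zero.2 hzx)
    positivity
  set ρ := 2 * ‖z - x‖ with hρ
  set β := ‖z‖ ^ 2 - ‖x‖ ^ 2 with hβ
  have hβρ : (β / ρ) ^ 2 < 1 := by
    rw [sq_lt_one_iff_abs_lt_one, abs_div, abs_of_pos hρ0, div_lt_one hρ0]
    refine (abs_norm_sq_sub_le hz).trans_lt ?_
    have : (1 + ‖x‖) / 2 < 1 := by linarith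
    exact mul_lt_of_lt_one_right hρ0 this
  have hw : Tendsto (fun m => 1 + ((ε m + Complex.I * β) / (ρ : ℂ)) ^ 2) atTop
      (𝓝 ((1 - (β / ρ) ^ 2 : ℝ) : ℂ)) := by
    have h1 := (((((Complex.continuous_ofReal.tendsto 0).comp hε0).add_const
      (Complex.I * β)).div_const (ρ : ℂ)).pow 2).const_add 1
    have hv : 1 + ((((0 : ℝ) : ℂ) + Complex.I * β) / (ρ : ℂ)) ^ 2 =
        ((1 - (β / ρ) ^ 2 : ℝ) : ℂ) := by
      push_cast
      linear_combination ((β : ℂ) / ρ) ^ 2 * Complex.I_mul_I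
    rw [hv] at h1
    exact h1
  have hsl : ((1 - (β / ρ) ^ 2 : ℝ) : ℂ) ∈ Complex.slitPlane :=
    Complex.ofReal_mem_slitPlane.2 (by linarith)
  have h2 : Tendsto (fun m => (((ρ⁻¹ ^ (n - 1) : ℝ) : ℂ) * (C *
      (1 + ((ε m + Complex.I * β) / (ρ : ℂ)) ^ 2) ^ (-(((n : ℂ) - 1) / 2)))).im) atTop
      (𝓝 (((ρ⁻¹ ^ (n - 1) : ℝ) : ℂ) * (C *
        ((1 - (β / ρ) ^ 2 : ℝ) : ℂ) ^ (-(((n : ℂ) - 1) / 2)))).im) :=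
    (Complex.continuous_im.tendsto _).comp
      ((((continuousAt_cpow_const hsl).tendsto.comp hw).const_mul _).const_mul _)
  have hexp : (-(((n : ℂ) - 1) / 2)) = ((-(((n : ℝ) - 1) / 2) : ℝ) : ℂ) := by push_cast; ring
  have h3 : (((ρ⁻¹ ^ (n - 1) : ℝ) : ℂ) * (C *
        ((1 - (β / ρ) ^ 2 : ℝ) : ℂ) ^ (-(((n : ℂ) - 1) / 2)))).im = 0 := by
    rw [hexp, ← Complex.ofReal_cpow (by linarith), ← Complex.ofReal_mul, ← Complex.ofReal_mul,
      Complex.ofReal_im]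
  rw [h3] at h2
  refine h2.congr fun m => ?_
  obtain ⟨hre, -⟩ := spaceKernel_arg_re_im (ε := ε m) (β := β) (ρ := ρ)
  rw [integral_spaceKernel i₀ hzx, hC]
  rw [hre]
  have := hε m
  positivity

lemma integrable_mul_inv_norm_pow {f : Esp n → ℂ} (hn : 1 ≤ n) (hf : Continuous f)
    (hc : HasCompactSupport f) (x : Esp n) :
    Integrable (fun z => ‖f z‖ * (‖z - x‖⁻¹) ^ (n - 1)) := by
  have h1 : LocallyIntegrable (fun z : Esp n => (‖z‖⁻¹) ^ (n - 1)) := by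
    refine locallyIntegrable_of_norm_le_rpow (C := 1) (α := ((n - 1 : ℕ) : ℝ)) (by simpa using hn) ?_
      (.of_forall fun z => ?_) (Measurable.aestronglyMeasurable (by fun_prop))
    · simp only [finrank_euclideanSpace, Fintype.card_fin]
      exact_mod_cast (by omega : n - 1 < n)
    · rw [Real.norm_of_nonneg (by positivity), one_mul, Real.rpow_neg (norm_nonneg _),
        Real.rpow_natCast, inv_pow]
  have hg : HasCompactSupport fun z => ‖f (z + x)‖ :=
    (hc.comp_homeomorph (Homeomorph.addRight x)).norm
  have h2 := h1.integrable_smul_left_of_hasCompactSupport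
    (g := fun z => ‖f (z + x)‖) (by fun_prop) hg
  have h3 := h2.comp_sub_right x
  simpa using h3

theorem tendsto_im_integral_spaceKernel_mul (hn : 2 ≤ n) {x : Esp n} (hx : ‖x‖ < 1)
    {f : Esp n → ℂ} (hf : Continuous f) (hsupp : support f ⊆ Metric.closedBall 0 1)
    (him : ∀ z, (f z).im = 0)
    {ε : ℕ → ℝ} (hε : ∀ m, 0 < ε m) (hε0 : Tendsto ε atTop (𝓝 0)) :
    Tendsto (fun m => ∫ y, (∫ z, f z * spaceKernel x (ε m) z y).im ∂(surfMeasure n))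
      atTop (𝓝 0) := by
  have := isFiniteMeasure_surfMeasure (n := n) (by omega)
  have hcs : HasCompactSupport f :=
    HasCompactSupport.of_support_subset_isCompact (isCompact_closedBall 0 1) hsupp
  have hfi : Integrable f := hf.integrable_of_hasCompactSupport hcs
  obtain ⟨C, hC⟩ := norm_integral_spaceKernel_le hn hx
  have hz (z : Esp n) (h : f z ≠ 0) : ‖z‖ ≤ 1 := by
    simpa using hsupp (mem_support.2 h)
  have hprod (m : ℕ) : Integrable (uncurry fun y z => f z * spaceKernel x (ε m) z y)
      ((surfMeasure n).prod volume) := by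
    refine ((integrable_const (μ := surfMeasure n) ((ε m)⁻¹ ^ (n - 1))).mul_prod hfi.norm).mono'
      ?_ (.of_forall fun p => ?_)
    · exact (hf.measurable.comp measurable_snd).aestronglyMeasurable.mul
        ((measurable_spaceKernel x (ε m)).comp measurable_swap).aestronglyMeasurable
    · simp only [uncurry, norm_mul]
      rw [mul_comm]
      gcongr
      exact norm_spaceKernel_le x (hε m) _ _
  have hswap (m : ℕ) : ∫ y, (∫ z, f z * spaceKernel x (ε m) z y).im ∂(surfMeasure n) =
      ∫ z, (f z * ∫ y, spaceKernel x (ε m) z y ∂(surfMeasure n)).im := by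
    have h1 := integral_integral_swap (hprod m)
    simp only [integral_const_mul] at h1
    have e1 := Complex.imCLM.integral_comp_comm (hprod m).integral_prod_left
    have e2 := Complex.imCLM.integral_comp_comm (hprod m).swap.integral_prod_left
    simp only [Complex.imCLM_apply, uncurry, comp_apply, Prod.swap, integral_const_mul] at e1 e2
    rw [e1, e2, h1]
  simp_rw [hswap]
  have hlim : Tendsto (fun m => ∫ z, (f z * ∫ y, spaceKernel x (ε m) z y ∂(surfMeasure n)).im)
      atTop (𝓝 (∫ _ : Esp n, (0 : ℝ))) := by
    have hne : ∀ᵐ z : Esp n, z ≠ x := by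
      have : Nontrivial (Esp n) := Module.nontrivial_of_finrank_pos (R := ℝ) (by simp; omega)
      simp [ae_iff]
    refine tendsto_integral_of_dominated_convergence
      (fun z => C * (‖f z‖ * (‖z - x‖⁻¹) ^ (n - 1))) (fun m => ?_)
      ((integrable_mul_inv_norm_pow (by omega) hf hcs x).const_mul C) (fun m => ?_) ?_
    · have := (hprod m).swap.integral_prod_left.aestronglyMeasurable
      simp only [uncurry, comp_apply, Prod.swap, integral_const_mul] at this
      exact Complex.continuous_im.comp_aestronglyMeasurable this
    · filter_upwards [hne] with z hzx
      refine (Complex.abs_im_le_norm _).trans ?_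
      rw [norm_mul]
      by_cases h : f z = 0
      · simp [h]
      · calc _ ≤ ‖f z‖ * (C * (‖z - x‖⁻¹) ^ (n - 1)) := by
              gcongr
              exact hC z (hz z h) hzx _ (hε m)
          _ = _ := by ring
    · filter_upwards [hne] with z hzx
      by_cases h : f z = 0
      · simp [h]
      · have := (tendsto_im_integral_spaceKernel hn hx (hz z h) hzx hε hε0).const_mul (f z).re
        rw [mul_zero] at this
        refine this.congr fun m => ?_
        rw [Complex.mul_im, him z, zero_mul, add_zero]
  simpa using hlim

lemma oscKernel_base_im (ε q : ℝ) : (-q + ε * Complex.I : ℂ).im = ε := by simp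

lemma oscKernel_base_mem_slitPlane {ε : ℝ} (hε : 0 < ε) (q : ℝ) :
    (-q + ε * Complex.I : ℂ) ∈ Complex.slitPlane :=
  Or.inr (by rw [oscKernel_base_im]; exact hε.ne')

lemma hasDerivAt_oscKernel_base (ε : ℝ) (A t : ℝ) :
    HasDerivAt (fun t : ℝ => (-((t ^ 2 - A : ℝ) : ℂ) + ε * Complex.I)) (-(2 * t : ℝ)) t := by
  have h1 : HasDerivAt (fun t : ℝ => t ^ 2 - A) (2 * t) t := by
    simpa using (hasDerivAt_pow 2 t).sub_const A
  exact (h1.ofReal_comp.neg).add_const _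

lemma hasDerivAt_oscKernel {ε : ℝ} (hε : 0 < ε) (b A t : ℝ) :
    HasDerivAt (fun t : ℝ => oscKernel b ε (t ^ 2 - A))
      (2 * b * t * oscKernel (b + 1) ε (t ^ 2 - A)) t := by
  have h1 := hasDerivAt_oscKernel_base ε A t
  have hexp : (-b : ℂ) - 1 = -((b + 1 : ℝ) : ℂ) := by push_cast; ring
  have h2 := (Complex.hasStrictDerivAt_cpow_const (c := (-b : ℂ))
    (oscKernel_base_mem_slitPlane hε (t ^ 2 - A))).hasDerivAt.scomp t h1
  refine h2.congr_deriv ?_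
  rw [hexp, oscKernel]
  simp only [smul_eq_mul]
  push_cast
  ring

lemma continuous_oscKernel {ε : ℝ} (hε : 0 < ε) (b A : ℝ) :
    Continuous fun t : ℝ => oscKernel b ε (t ^ 2 - A) :=
  continuous_iff_continuousAt.2 fun t => (hasDerivAt_oscKernel hε b A t).continuousAt

lemma norm_oscKernel (b ε q : ℝ) :
    ‖oscKernel b ε q‖ = ‖(-q + ε * Complex.I : ℂ)‖ ^ (-b) := by
  rw [oscKernel, ← Complex.ofReal_neg b, Complex.norm_cpow_real]

lemma norm_oscKernel_le {b : ℝ} (hb : 0 ≤ b) (ε : ℝ) {q : ℝ} (hq : q ≠ 0) :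
    ‖oscKernel b ε q‖ ≤ |q| ^ (-b) := by
  rw [norm_oscKernel]
  refine Real.rpow_le_rpow_of_nonpos (abs_pos.2 hq) ?_ (by linarith)
  refine le_trans (le_of_eq ?_) (Complex.abs_re_le_norm _)
  simp

lemma norm_oscKernel_le_of_pos {b : ℝ} (hb : 0 ≤ b) {ε : ℝ} (hε : 0 < ε) (q : ℝ) :
    ‖oscKernel b ε q‖ ≤ ε ^ (-b) := by
  rw [norm_oscKernel]
  refine Real.rpow_le_rpow_of_nonpos hε ?_ (by linarith)
  refine le_trans ?_ (Complex.abs_im_le_norm _)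
  rw [oscKernel_base_im]
  exact le_abs_self _

lemma tendsto_oscKernel_aux (b : ℝ) {q : ℝ} (hq : q ≠ 0) {ε : ℕ → ℝ} (hε : ∀ m, 0 < ε m)
    (hε0 : Tendsto ε atTop (𝓝 0)) :
    Tendsto (fun m => oscKernel b (ε m) q) atTop
      (𝓝 ((Complex.I ^ (b : ℂ))⁻¹ * ((Complex.I * q : ℂ)⁻¹) ^ (b : ℂ))) := by
  have h1 : Tendsto (fun m => (ε m + Complex.I * q : ℂ)⁻¹) atTop (𝓝 ((Complex.I * q : ℂ)⁻¹)) := by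
    have h0 : Complex.I * q ≠ 0 := mul_ne_zero Complex.I_ne_zero (by exact_mod_cast hq)
    have := ((Complex.continuous_ofReal.tendsto 0).comp hε0).add_const (Complex.I * q)
    rw [Complex.ofReal_zero, zero_add] at this
    exact this.inv₀ h0
  have hsl : (Complex.I * q : ℂ)⁻¹ ∈ Complex.slitPlane := by
    right
    simp [Complex.inv_im, hq]
  have h2 := ((continuousAt_cpow_const (b := (b : ℂ)) hsl).tendsto.comp h1).const_mul
    (Complex.I ^ (b : ℂ))⁻¹
  refine h2.congr fun m => ?_
  have hI : Complex.I ^ (b : ℂ) ≠ 0 := by simp [Complex.cpow_eq_zero_iff]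
  rw [comp_apply, inv_cpow_eq_oscKernel (hε m), inv_mul_cancel_left₀ hI]

lemma tendsto_im_oscKernel_of_neg (b : ℝ) {q : ℝ} (hq : q < 0) {ε : ℕ → ℝ}
    (hε0 : Tendsto ε atTop (𝓝 0)) :
    Tendsto (fun m => (oscKernel b (ε m) q).im) atTop (𝓝 0) := by
  have h1 : Tendsto (fun m => (-q + ε m * Complex.I : ℂ)) atTop (𝓝 ((-q : ℝ) : ℂ)) := by
    have := (((Complex.continuous_ofReal.tendsto 0).comp hε0).mul_const Complex.I).const_add (-q : ℂ)
    simpa using this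
  have hsl : ((-q : ℝ) : ℂ) ∈ Complex.slitPlane := Complex.ofReal_mem_slitPlane.2 (by linarith)
  have h2 := (Complex.continuous_im.tendsto _).comp
    ((continuousAt_cpow_const (b := (-b : ℂ)) hsl).tendsto.comp h1)
  have h3 : (((-q : ℝ) : ℂ) ^ (-b : ℂ)).im = 0 := by
    rw [← Complex.ofReal_neg b, ← Complex.ofReal_cpow (by linarith), Complex.ofReal_im]
  rw [h3] at h2
  exact h2

lemma tendsto_im_oscKernel_half {q : ℝ} (hq : 0 < q) {ε : ℕ → ℝ} (hε : ∀ m, 0 < ε m)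
    (hε0 : Tendsto ε atTop (𝓝 0)) :
    Tendsto (fun m => (oscKernel (1 / 2) (ε m) q).im) atTop (𝓝 (-(√q)⁻¹)) := by
  have h := (Complex.continuous_im.tendsto _).comp (tendsto_oscKernel_aux (1 / 2) hq.ne' hε hε0)
  have h1 : (Complex.I ^ ((1 / 2 : ℝ) : ℂ))⁻¹ * ((Complex.I * q : ℂ)⁻¹) ^ ((1 / 2 : ℝ) : ℂ) =
      -Complex.I * ((√q)⁻¹ : ℝ) := by
    have hq0 : (q : ℂ) ≠ 0 := by exact_mod_cast hq.ne'
    have harg : (Complex.I * q : ℂ).arg ≠ Real.pi := by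
      rw [mul_comm, Complex.arg_real_mul _ hq, Complex.arg_I]
      linarith [Real.pi_pos]
    rw [Complex.inv_cpow _ _ harg, mul_comm Complex.I, Complex.cpow_def_of_ne_zero
      (mul_ne_zero hq0 Complex.I_ne_zero), Complex.log_ofReal_mul hq Complex.I_ne_zero, add_mul,
      Complex.exp_add, ← Complex.cpow_def_of_ne_zero Complex.I_ne_zero, Complex.ofReal_log hq.le,
      ← Complex.cpow_def_of_ne_zero hq0, ← Complex.ofReal_cpow hq.le, ← Real.sqrt_eq_rpow, mul_inv,
      mul_left_comm, ← mul_inv, ← Complex.cpow_add _ _ Complex.I_ne_zero]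
    norm_num
    ring
  rw [h1] at h
  simpa [comp_def] using h

lemma eqOn_invDerivR {a : ℝ} {f g : ℝ → ℝ} (h : Set.EqOn f g (Set.Ioi a)) :
    Set.EqOn (invDerivR f) (invDerivR g) (Set.Ioi a) := fun t ht => by
  simp only [invDerivR]
  rw [(h.eventuallyEq_of_mem (Ioi_mem_nhds ht)).deriv_eq]

lemma eqOn_iterate_invDerivR {a : ℝ} (j : ℕ) {f g : ℝ → ℝ} (h : Set.EqOn f g (Set.Ioi a)) :
    Set.EqOn (invDerivR^[j] f) (invDerivR^[j] g) (Set.Ioi a) := by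
  induction j generalizing f g with
  | zero => exact h
  | succ j ih =>
    simp only [iterate_succ_apply]
    exact ih (eqOn_invDerivR h)

lemma ContDiffOn.invDerivR_Ioi {f : ℝ → ℝ} (hf : ContDiffOn ℝ (⊤ : ℕ∞) f (Set.Ioi 0)) :
    ContDiffOn ℝ (⊤ : ℕ∞) (invDerivR f) (Set.Ioi 0) :=
  (hf.deriv_of_isOpen isOpen_Ioi (by simp)).div contDiffOn_id fun _ ht => (ne_of_gt ht)

lemma ContDiffOn.differentiableAt_Ioi {f : ℝ → ℝ} (hf : ContDiffOn ℝ (⊤ : ℕ∞) f (Set.Ioi 0))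
    {t : ℝ} (ht : 0 < t) : DifferentiableAt ℝ f t :=
  (hf.differentiableOn (by simp)).differentiableAt (Ioi_mem_nhds ht)

lemma iterate_invDerivR_add_const_mul (j : ℕ) {f g : ℝ → ℝ} (c : ℝ)
    (hf : ContDiffOn ℝ (⊤ : ℕ∞) f (Set.Ioi 0)) (hg : ContDiffOn ℝ (⊤ : ℕ∞) g (Set.Ioi 0)) :
    Set.EqOn (invDerivR^[j] fun t => f t + c * g t)
      (fun t => invDerivR^[j] f t + c * invDerivR^[j] g t) (Set.Ioi 0) := by
  induction j generalizing f g with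
  | zero => exact fun t _ => rfl
  | succ j ih =>
    intro t ht
    have h1 : Set.EqOn (invDerivR fun t => f t + c * g t)
        (fun t => invDerivR f t + c * invDerivR g t) (Set.Ioi 0) := fun t ht => by
      simp only [invDerivR]
      have h := ((hf.differentiableAt_Ioi ht).hasDerivAt.add
        ((hg.differentiableAt_Ioi ht).hasDerivAt.const_mul c)).deriv
      rw [show (fun t => f t + c * g t) = f + fun t => c * g t from rfl, h]
      ring
    simp only [iterate_succ_apply]
    rw [eqOn_iterate_invDerivR j h1 ht]
    exact ih hf.invDerivR_Ioi hg.invDerivR_Ioi ht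

lemma contDiffOn_mul_inv_pow {w : ℝ → ℝ} (hw : ContDiff ℝ (⊤ : ℕ∞) w) (m : ℕ) :
    ContDiffOn ℝ (⊤ : ℕ∞) (fun t => w t * (t ^ m)⁻¹) (Set.Ioi 0) :=
  hw.contDiffOn.mul ((contDiff_id.pow m).contDiffOn.inv fun _ ht => (pow_pos ht m).ne')

lemma invDerivR_mul_inv_pow {w : ℝ → ℝ} (hw : ContDiff ℝ (⊤ : ℕ∞) w) (m : ℕ) :
    Set.EqOn (invDerivR fun t => w t * (t ^ (m + 1))⁻¹)
      (fun t => deriv w t * (t ^ (m + 2))⁻¹ + (-(m + 1)) * (w t * (t ^ (m + 3))⁻¹))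
      (Set.Ioi 0) := fun t ht => by
  have ht0 : t ≠ 0 := ne_of_gt ht
  have h1 : HasDerivAt (fun t : ℝ => (t ^ (m + 1))⁻¹) (-((m + 1) * t ^ m) / (t ^ (m + 1)) ^ 2) t := by
    have := (hasDerivAt_pow (m + 1) t).fun_inv (pow_ne_zero _ ht0)
    simpa using this
  have h := (((hw.differentiable (by simp)) t).hasDerivAt.fun_mul h1).deriv
  simp only [invDerivR]
  rw [h]
  field_simp
  ring

/-- All iterates of `invDerivR` on `V` decay like `t⁻³` on `[r₀, ∞)`. -/
def InvDecay (r₀ : ℝ) (B : ℕ → ℝ) (V : ℝ → ℝ) : Prop :=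
  ContDiffOn ℝ (⊤ : ℕ∞) V (Set.Ioi 0) ∧ ∀ j t, r₀ ≤ t → |invDerivR^[j] V t| ≤ B j / t ^ 3

lemma InvDecay.invDerivR {r₀ : ℝ} {B : ℕ → ℝ} {V : ℝ → ℝ} (h : InvDecay r₀ B V) :
    InvDecay r₀ (fun j => B (j + 1)) (invDerivR V) :=
  ⟨h.1.invDerivR_Ioi, fun j t ht => by simpa only [iterate_succ_apply] using h.2 (j + 1) t ht⟩

lemma exists_iterate_invDerivR_bound {r₀ : ℝ} (hr : 0 < r₀) (j m : ℕ) (D : ℕ → ℝ) :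
    ∃ K, ∀ w : ℝ → ℝ, ContDiff ℝ (⊤ : ℕ∞) w →
      (∀ i t, 0 ≤ t → |iteratedDeriv i w t| ≤ D i / (1 + t ^ 2)) →
      ∀ t, r₀ ≤ t → |invDerivR^[j] (fun t => w t * (t ^ (m + 1))⁻¹) t| ≤ K / t ^ 3 := by
  induction j generalizing m D with
  | zero =>
    refine ⟨D 0 * (r₀ ^ m)⁻¹, fun w _ hD t ht => ?_⟩
    have htp : 0 < t := hr.trans_le ht
    have h0 := hD 0 t htp.le
    rw [iteratedDeriv_zero] at h0
    have hD0 : 0 ≤ D 0 := by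
      have h1 := (abs_nonneg _).trans h0
      by_contra! h2
      exact absurd h1 (not_le.2 (div_neg_of_neg_of_pos h2 (by positivity)))
    have h1 : |w t| ≤ D 0 / t ^ 2 :=
      h0.trans (div_le_div_of_nonneg_left hD0 (by positivity) (by linarith))
    have h2 : (t ^ m)⁻¹ ≤ (r₀ ^ m)⁻¹ :=
      inv_anti₀ (by positivity) (pow_le_pow_left₀ hr.le ht m)
    simp only [iterate_zero, id_eq]
    rw [abs_mul, abs_of_pos (by positivity : 0 < (t ^ (m + 1))⁻¹)]
    calc |w t| * (t ^ (m + 1))⁻¹ ≤ D 0 / t ^ 2 * (t ^ (m + 1))⁻¹ := by gcongr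
      _ = D 0 * (t ^ m)⁻¹ / t ^ 3 := by field_simp; ring
      _ ≤ _ := by gcongr
  | succ j ih =>
    obtain ⟨K₁, h₁⟩ := ih (m + 1) fun i => D (i + 1)
    obtain ⟨K₂, h₂⟩ := ih (m + 2) D
    refine ⟨K₁ + (m + 1) * K₂, fun w hw hD t ht => ?_⟩
    have htp : 0 < t := hr.trans_le ht
    have hw' : ContDiff ℝ (⊤ : ℕ∞) (deriv w) := (contDiff_infty_iff_deriv.1 hw).2
    rw [iterate_succ_apply, eqOn_iterate_invDerivR j (invDerivR_mul_inv_pow hw m) htp,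
      iterate_invDerivR_add_const_mul j _ (contDiffOn_mul_inv_pow hw' _)
        (contDiffOn_mul_inv_pow hw _) htp]
    have e₁ := h₁ (deriv w) hw' (fun i t ht => by
      rw [← iteratedDeriv_succ']; exact hD (i + 1) t ht) t ht
    have e₂ := h₂ w hw hD t ht
    refine (abs_add_le _ _).trans ?_
    rw [abs_mul, abs_neg, abs_of_pos (by positivity : (0 : ℝ) < m + 1), add_div, mul_div_assoc]
    gcongr

lemma exists_invDecay {r₀ : ℝ} (hr : 0 < r₀) (D : ℕ → ℝ) :
    ∃ B : ℕ → ℝ, ∀ w : ℝ → ℝ, ContDiff ℝ (⊤ : ℕ∞) w →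
      (∀ i t, 0 ≤ t → |iteratedDeriv i w t| ≤ D i / (1 + t ^ 2)) →
      InvDecay r₀ B (fun t => w t / t) := by
  choose B hB using fun j => exists_iterate_invDerivR_bound hr j 0 D
  refine ⟨B, fun w hw hD => ?_⟩
  have he : (fun t => w t / t) = fun t => w t * (t ^ (0 + 1))⁻¹ := by
    funext t; simp [div_eq_mul_inv]
  rw [he]
  exact ⟨contDiffOn_mul_inv_pow hw _, fun j => hB j w hw hD⟩

lemma integrableOn_Ioi_inv_sq {r : ℝ} (hr : 0 < r) :
    IntegrableOn (fun t : ℝ => (t ^ 2)⁻¹) (Set.Ioi r) := by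
  refine (integrableOn_Ioi_rpow_of_lt (a := -2) (by norm_num) hr).congr_fun (fun t ht => ?_)
    measurableSet_Ioi
  have : 0 < t := hr.trans ht
  simp only
  rw [Real.rpow_neg this.le]
  norm_num

lemma integrableOn_Ioi_of_norm_le_inv_sq {E : Type*} [NormedAddCommGroup E] {r C : ℝ} (hr : 0 < r)
    {g : ℝ → E} (hg : ContinuousOn g (Set.Ioi r)) (hC : ∀ t, r < t → ‖g t‖ ≤ C * (t ^ 2)⁻¹) :
    IntegrableOn g (Set.Ioi r) :=
  ((integrableOn_Ioi_inv_sq hr).const_mul C).mono' (hg.aestronglyMeasurable measurableSet_Ioi)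
    ((ae_restrict_mem measurableSet_Ioi).mono fun t ht => hC t ht)

namespace InvDecay
variable {r₀ : ℝ} {B : ℕ → ℝ} {V : ℝ → ℝ}

lemma iterate (h : InvDecay r₀ B V) (j : ℕ) :
    InvDecay r₀ (fun i => B (i + j)) (_root_.invDerivR^[j] V) := by
  induction j generalizing B V with
  | zero => exact h
  | succ j ih =>
    rw [iterate_succ_apply]
    exact ih h.invDerivR

lemma continuousOn (h : InvDecay r₀ B V) : ContinuousOn V (Set.Ioi 0) := h.1.continuousOn

lemma abs_le (h : InvDecay r₀ B V) {t : ℝ} (ht : r₀ ≤ t) : |V t| ≤ B 0 / t ^ 3 := h.2 0 t ht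

lemma nonneg_bound (h : InvDecay r₀ B V) (hr : 0 < r₀) (j : ℕ) : 0 ≤ B j := by
  have h1 := (abs_nonneg _).trans (h.2 j r₀ le_rfl)
  by_contra! h2
  exact absurd h1 (not_le.2 (div_neg_of_neg_of_pos h2 (by positivity)))

lemma abs_mul_le (h : InvDecay r₀ B V) (hr : 0 < r₀) {t : ℝ} (ht : r₀ ≤ t) :
    |t * V t| ≤ B 0 * (t ^ 2)⁻¹ := by
  have htp := hr.trans_le ht
  rw [abs_mul, abs_of_pos htp]
  calc t * |V t| ≤ t * (B 0 / t ^ 3) := by gcongr; exact h.abs_le ht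
    _ = _ := by field_simp

lemma abs_le_const (h : InvDecay r₀ B V) (hr : 0 < r₀) {t : ℝ} (ht : r₀ ≤ t) :
    |V t| ≤ B 0 / r₀ ^ 3 :=
  (h.abs_le ht).trans (div_le_div_of_nonneg_left (h.nonneg_bound hr 0) (by positivity)
    (pow_le_pow_left₀ hr.le ht 3))

lemma hasDerivAt (h : InvDecay r₀ B V) {t : ℝ} (ht : 0 < t) :
    HasDerivAt V (t * _root_.invDerivR V t) t := by
  refine (h.1.differentiableAt_Ioi ht).hasDerivAt.congr_deriv ?_
  rw [_root_.invDerivR]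
  field_simp

lemma tendsto_zero (h : InvDecay r₀ B V) : Tendsto V atTop (𝓝 0) := by
  have h1 : Tendsto (fun t : ℝ => B 0 / t ^ 3) atTop (𝓝 0) :=
    tendsto_const_nhds.div_atTop (tendsto_pow_atTop (by norm_num))
  exact squeeze_zero_norm' ((eventually_ge_atTop r₀).mono fun t ht => h.abs_le ht) h1

lemma integrableOn_mul (h : InvDecay r₀ B V) (hr : 0 < r₀) {r : ℝ} (hr' : r₀ ≤ r)
    {K : ℝ → ℂ} (hK : Continuous K) {C : ℝ} (hC : ∀ t, ‖K t‖ ≤ C) :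
    IntegrableOn (fun t => ((t * V t : ℝ) : ℂ) * K t) (Set.Ioi r) := by
  have hrp := hr.trans_le hr'
  refine integrableOn_Ioi_of_norm_le_inv_sq (C := B 0 * C) hrp ?_ fun t ht => ?_
  · refine ContinuousOn.mul (Complex.continuous_ofReal.comp_continuousOn
      (continuousOn_id.mul (h.continuousOn.mono ?_))) hK.continuousOn
    exact Set.Ioi_subset_Ioi hrp.le
  · have ht' : r₀ ≤ t := hr'.trans (le_of_lt ht)
    rw [norm_mul, Complex.norm_real, Real.norm_eq_abs]
    calc |t * V t| * ‖K t‖ ≤ B 0 * (t ^ 2)⁻¹ * C := by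
          gcongr
          · exact mul_nonneg (h.nonneg_bound hr 0) (by positivity)
          · exact h.abs_mul_le hr ht'
          · exact hC t
      _ = _ := by ring

lemma integrableOn_mul_oscKernel (h : InvDecay r₀ B V) (hr : 0 < r₀) {r : ℝ} (hr' : r₀ ≤ r)
    {b : ℝ} (hb : 0 ≤ b) {ε : ℝ} (hε : 0 < ε) (A : ℝ) :
    IntegrableOn (fun t => ((t * V t : ℝ) : ℂ) * oscKernel b ε (t ^ 2 - A)) (Set.Ioi r) :=
  h.integrableOn_mul hr hr' (continuous_oscKernel hε b A) fun _ => norm_oscKernel_le_of_pos hb hε _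

lemma integral_mul_oscKernel_add_one (h : InvDecay r₀ B V) (hr : 0 < r₀) {r : ℝ} (hr' : r₀ ≤ r)
    {b : ℝ} (hb : 0 < b) {ε : ℝ} (hε : 0 < ε) (A : ℝ) :
    ∫ t in Set.Ioi r, ((t * V t : ℝ) : ℂ) * oscKernel (b + 1) ε (t ^ 2 - A) =
      ((-(1 / (2 * b)) * V r : ℝ) : ℂ) * oscKernel b ε (r ^ 2 - A) + ((-(1 / (2 * b)) : ℝ) : ℂ) *
        ∫ t in Set.Ioi r, ((t * _root_.invDerivR V t : ℝ) : ℂ) * oscKernel b ε (t ^ 2 - A) := by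
  have hrp := hr.trans_le hr'
  have hi1 := h.invDerivR.integrableOn_mul_oscKernel hr hr' hb.le hε A
  have hi2 := h.integrableOn_mul_oscKernel hr hr' (by linarith : 0 ≤ b + 1) hε A
  have hd : ∀ t ∈ Set.Ici r, HasDerivAt (fun t => (V t : ℂ) * oscKernel b ε (t ^ 2 - A))
      (((t * _root_.invDerivR V t : ℝ) : ℂ) * oscKernel b ε (t ^ 2 - A) +
        (2 * b : ℂ) * (((t * V t : ℝ) : ℂ) * oscKernel (b + 1) ε (t ^ 2 - A))) t := fun t ht => by
    refine ((h.hasDerivAt (hrp.trans_le ht)).ofReal_comp.mul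
      (hasDerivAt_oscKernel hε b A t)).congr_deriv ?_
    push_cast
    ring
  have hlim : Tendsto (fun t => (V t : ℂ) * oscKernel b ε (t ^ 2 - A)) atTop (𝓝 0) := by
    have h1 : Tendsto (fun t => |V t| * ε ^ (-b)) atTop (𝓝 0) := by
      simpa using ((h.tendsto_zero).abs).mul_const (ε ^ (-b))
    refine squeeze_zero_norm (fun t => ?_) h1
    rw [norm_mul, Complex.norm_real, Real.norm_eq_abs]
    gcongr
    exact norm_oscKernel_le_of_pos hb.le hε _
  have hmain := integral_Ioi_of_hasDerivAt_of_tendsto' hd (hi1.add (hi2.const_mul _)) hlim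
  rw [integral_add hi1 (hi2.const_mul _), integral_const_mul] at hmain
  have hb' : (b : ℂ) ≠ 0 := by exact_mod_cast hb.ne'
  push_cast at hmain ⊢
  field_simp
  linear_combination hmain

end InvDecay

lemma exists_im_integral_oscKernel_add_nat {r₀ : ℝ} (hr : 0 < r₀) {b₀ : ℝ} (hb₀ : 0 < b₀) (j : ℕ) :
    ∃ c : ℝ, c ≠ 0 ∧ ∀ B : ℕ → ℝ, ∃ M : ℝ, ∀ V, InvDecay r₀ B V → ∀ s, 2 * r₀ ≤ s →
      ∃ E : ℝ → ℝ, (∀ ε, 0 < ε → |E ε| ≤ M) ∧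
        (∀ ε : ℕ → ℝ, Tendsto ε atTop (𝓝 0) → Tendsto (fun m => E (ε m)) atTop (𝓝 0)) ∧
        ∀ ε, 0 < ε →
          (∫ t in Set.Ioi (s / 2), ((t * V t : ℝ) : ℂ) *
            oscKernel (b₀ + j) ε (t ^ 2 - s ^ 2)).im = E ε + c *
          (∫ t in Set.Ioi (s / 2), ((t * invDerivR^[j] V t : ℝ) : ℂ) *
            oscKernel b₀ ε (t ^ 2 - s ^ 2)).im := by
  induction j with
  | zero =>
    refine ⟨1, one_ne_zero, fun B => ⟨0, fun V _ s _ => ⟨0, ?_, ?_, ?_⟩⟩⟩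
    · simp
    · intro ε _
      simp
    · simp
  | succ j ih =>
    obtain ⟨c, hc, ih⟩ := ih
    have hb : 0 < b₀ + j := by positivity
    refine ⟨-(1 / (2 * (b₀ + j))) * c, mul_ne_zero (by simpa using hb.ne') hc, fun B => ?_⟩
    obtain ⟨M, hM⟩ := ih fun i => B (i + 1)
    refine ⟨1 / (2 * (b₀ + j)) * (B 0 / r₀ ^ 3) * (3 * r₀ ^ 2) ^ (-(b₀ + j)) +
      1 / (2 * (b₀ + j)) * M, fun V hV s hs => ?_⟩
    obtain ⟨E, hE1, hE2, hE3⟩ := hM (invDerivR V) hV.invDerivR s hs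
    have hr' : r₀ ≤ s / 2 := by linarith
    have hq : (s / 2) ^ 2 - s ^ 2 ≤ -(3 * r₀ ^ 2) := by nlinarith
    have hq0 : (s / 2) ^ 2 - s ^ 2 < 0 := by nlinarith [sq_nonneg r₀, pow_pos hr 2]
    refine ⟨fun ε => -(1 / (2 * (b₀ + j))) * V (s / 2) *
      (oscKernel (b₀ + j) ε ((s / 2) ^ 2 - s ^ 2)).im + -(1 / (2 * (b₀ + j))) * E ε, ?_, ?_, ?_⟩
    · intro ε hε
      refine (abs_add_le _ _).trans ?_
      rw [abs_mul, abs_mul, abs_mul, abs_neg, abs_of_pos (by positivity : 0 < 1 / (2 * (b₀ + j)))]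
      have h1 : |(oscKernel (b₀ + j) ε ((s / 2) ^ 2 - s ^ 2)).im| ≤
          (3 * r₀ ^ 2) ^ (-(b₀ + j)) := by
        refine (Complex.abs_im_le_norm _).trans ((norm_oscKernel_le hb.le ε hq0.ne).trans ?_)
        refine Real.rpow_le_rpow_of_nonpos (by positivity) ?_ (by linarith)
        rw [abs_of_neg hq0]
        linarith
      have h2 := hV.abs_le_const hr hr'
      have h3 := hV.nonneg_bound hr 0
      gcongr
      exact hE1 ε hε
    · intro ε hε
      have h1 := (tendsto_im_oscKernel_of_neg (b₀ + j) hq0 hε).const_mul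
        (-(1 / (2 * (b₀ + j))) * V (s / 2))
      simpa using h1.add ((hE2 ε hε).const_mul (-(1 / (2 * (b₀ + j)))))
    · intro ε hε
      have h1 := hV.integral_mul_oscKernel_add_one hr hr' hb hε (s ^ 2)
      rw [show b₀ + ((j + 1 : ℕ) : ℝ) = b₀ + j + 1 by push_cast; ring, h1, Complex.add_im,
        Complex.im_ofReal_mul, Complex.im_ofReal_mul]
      rw [hE3 ε hε]
      simp only [iterate_succ_apply]
      ring

lemma tendsto_oscKernel_base (q : ℝ) {ε : ℕ → ℝ} (hε0 : Tendsto ε atTop (𝓝 0)) :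
    Tendsto (fun m => (-q + ε m * Complex.I : ℂ)) atTop (𝓝 ((-q : ℝ) : ℂ)) := by
  have := (((Complex.continuous_ofReal.tendsto 0).comp hε0).mul_const Complex.I).const_add (-q : ℂ)
  simpa using this

lemma tendsto_arg_of_neg {q : ℝ} (hq : q < 0) {ε : ℕ → ℝ} (hε0 : Tendsto ε atTop (𝓝 0)) :
    Tendsto (fun m => (-q + ε m * Complex.I : ℂ).arg) atTop (𝓝 0) := by
  have hsl : ((-q : ℝ) : ℂ) ∈ Complex.slitPlane := Complex.ofReal_mem_slitPlane.2 (by linarith)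
  have h := (Complex.continuousAt_arg hsl).tendsto.comp (tendsto_oscKernel_base q hε0)
  rwa [Complex.arg_ofReal_of_nonneg (by linarith)] at h

lemma tendsto_arg_of_pos {q : ℝ} (hq : 0 < q) {ε : ℕ → ℝ} (hε : ∀ m, 0 < ε m)
    (hε0 : Tendsto ε atTop (𝓝 0)) :
    Tendsto (fun m => (-q + ε m * Complex.I : ℂ).arg) atTop (𝓝 Real.pi) := by
  have h1 : Tendsto (fun m => (-q + ε m * Complex.I : ℂ)) atTop
      (𝓝[{z : ℂ | 0 ≤ z.im}] ((-q : ℝ) : ℂ)) :=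
    tendsto_nhdsWithin_iff.2 ⟨tendsto_oscKernel_base q hε0, Eventually.of_forall fun m => by
      exact (hε m).le.trans_eq (oscKernel_base_im (ε m) q).symm⟩
  exact (Complex.tendsto_arg_nhdsWithin_im_nonneg_of_re_neg_of_im_zero
    (by rw [Complex.ofReal_re]; linarith) (Complex.ofReal_im _)).comp h1

lemma hasDerivAt_arg_oscKernel_base {ε : ℝ} (hε : 0 < ε) (A t : ℝ) :
    HasDerivAt (fun t : ℝ => (-((t ^ 2 - A : ℝ) : ℂ) + ε * Complex.I).arg)
      (-(2 * t) * (oscKernel 1 ε (t ^ 2 - A)).im) t := by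
  have h1 := (hasDerivAt_oscKernel_base ε A t).clog_real
    (oscKernel_base_mem_slitPlane hε (t ^ 2 - A))
  have h2 := Complex.imCLM.hasFDerivAt.comp_hasDerivAt t h1
  refine (h2.congr_deriv ?_).congr_of_eventuallyEq (Eventually.of_forall fun t => ?_)
  swap
  · rw [comp_apply, Complex.imCLM_apply, Complex.log_im]
  rw [oscKernel, Complex.ofReal_one, Complex.cpow_neg_one, ← Complex.im_ofReal_mul,
    Complex.imCLM_apply]
  congr 1
  push_cast
  ring

namespace InvDecay
variable {r₀ : ℝ} {B : ℕ → ℝ} {V : ℝ → ℝ}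

lemma continuous_arg {ε : ℝ} (hε : 0 < ε) (A : ℝ) :
    Continuous fun t : ℝ => (-((t ^ 2 - A : ℝ) : ℂ) + ε * Complex.I).arg :=
  continuous_iff_continuousAt.2 fun t => (hasDerivAt_arg_oscKernel_base hε A t).continuousAt

lemma integrableOn_mul_real (h : InvDecay r₀ B V) (hr : 0 < r₀) {r : ℝ} (hr' : r₀ ≤ r)
    {K : ℝ → ℝ} (hK : Continuous K) {C : ℝ} (hC : ∀ t, |K t| ≤ C) :
    IntegrableOn (fun t => t * V t * K t) (Set.Ioi r) := by
  have h1 := h.integrableOn_mul hr hr' (Complex.continuous_ofReal.comp hK)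
    (C := C) (fun t => by simpa using hC t)
  have h2 : IntegrableOn (fun t => (((t * V t : ℝ) : ℂ) * ((K t : ℝ) : ℂ)).re) (Set.Ioi r) :=
    h1.re
  refine h2.congr_fun (fun t _ => ?_) measurableSet_Ioi
  simp only
  rw [← Complex.ofReal_mul, Complex.ofReal_re]

lemma im_integral_mul (h : InvDecay r₀ B V) (hr : 0 < r₀) {r : ℝ} (hr' : r₀ ≤ r)
    {b : ℝ} (hb : 0 ≤ b) {ε : ℝ} (hε : 0 < ε) (A : ℝ) :
    (∫ t in Set.Ioi r, ((t * V t : ℝ) : ℂ) * oscKernel b ε (t ^ 2 - A)).im =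
      ∫ t in Set.Ioi r, t * V t * (oscKernel b ε (t ^ 2 - A)).im := by
  have h1 := Complex.imCLM.integral_comp_comm (h.integrableOn_mul_oscKernel hr hr' hb hε A)
  simp only [Complex.imCLM_apply] at h1
  rw [← h1]
  simp only [Complex.im_ofReal_mul]

lemma im_integral_oscKernel_one (h : InvDecay r₀ B V) (hr : 0 < r₀) {r : ℝ} (hr' : r₀ ≤ r)
    {ε : ℝ} (hε : 0 < ε) (A : ℝ) :
    (∫ t in Set.Ioi r, ((t * V t : ℝ) : ℂ) * oscKernel 1 ε (t ^ 2 - A)).im =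
      1 / 2 * (V r * (-((r ^ 2 - A : ℝ) : ℂ) + ε * Complex.I).arg) +
      1 / 2 * ∫ t in Set.Ioi r, t * _root_.invDerivR V t *
        (-((t ^ 2 - A : ℝ) : ℂ) + ε * Complex.I).arg := by
  have hrp := hr.trans_le hr'
  rw [h.im_integral_mul hr hr' zero_le_one hε]
  have hi1 := h.invDerivR.integrableOn_mul_real hr hr' (continuous_arg hε A)
    (fun t => Complex.abs_arg_le_pi _)
  have hi2 := h.integrableOn_mul_real hr hr' (K := fun t => (oscKernel 1 ε (t ^ 2 - A)).im)
    (Complex.continuous_im.comp (continuous_oscKernel hε 1 A))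
    (fun t => (Complex.abs_im_le_norm _).trans (norm_oscKernel_le_of_pos zero_le_one hε _))
  have hd : ∀ t ∈ Set.Ici r, HasDerivAt
      (fun t => V t * (-((t ^ 2 - A : ℝ) : ℂ) + ε * Complex.I).arg)
      (t * _root_.invDerivR V t * (-((t ^ 2 - A : ℝ) : ℂ) + ε * Complex.I).arg +
        -2 * (t * V t * (oscKernel 1 ε (t ^ 2 - A)).im)) t := fun t ht => by
    refine ((h.hasDerivAt (hrp.trans_le ht)).fun_mul
      (hasDerivAt_arg_oscKernel_base hε A t)).congr_deriv ?_
    ring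
  have hlim : Tendsto (fun t : ℝ => V t * (-((t ^ 2 - A : ℝ) : ℂ) + ε * Complex.I).arg) atTop
      (𝓝 0) := by
    have h1 : Tendsto (fun t => |V t| * Real.pi) atTop (𝓝 0) := by
      simpa using (h.tendsto_zero.abs).mul_const Real.pi
    refine squeeze_zero_norm (fun t => ?_) h1
    rw [norm_mul, Real.norm_eq_abs, Real.norm_eq_abs]
    gcongr
    exact Complex.abs_arg_le_pi _
  have hmain := integral_Ioi_of_hasDerivAt_of_tendsto' hd (hi1.add (hi2.const_mul _)) hlim
  rw [integral_add hi1 (hi2.const_mul _), integral_const_mul] at hmain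
  linarith

lemma abs_im_integral_oscKernel_one_le (h : InvDecay r₀ B V) (hr : 0 < r₀) {r : ℝ} (hr' : r₀ ≤ r)
    {ε : ℝ} (hε : 0 < ε) (A : ℝ) :
    |(∫ t in Set.Ioi r, ((t * V t : ℝ) : ℂ) * oscKernel 1 ε (t ^ 2 - A)).im| ≤
      1 / 2 * (B 0 / r₀ ^ 3 * Real.pi) +
        1 / 2 * ∫ t in Set.Ioi r₀, B 1 * (t ^ 2)⁻¹ * Real.pi := by
  rw [h.im_integral_oscKernel_one hr hr' hε]
  refine (abs_add_le _ _).trans ?_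
  rw [abs_mul, abs_mul, abs_mul, abs_of_pos (by norm_num : (0 : ℝ) < 1 / 2)]
  have hB := h.invDerivR.nonneg_bound hr 0
  have hint : IntegrableOn (fun t : ℝ => B 1 * (t ^ 2)⁻¹ * Real.pi) (Set.Ioi r₀) :=
    ((integrableOn_Ioi_inv_sq hr).const_mul _).mul_const _
  have h0 := h.nonneg_bound hr 0
  gcongr
  · exact h.abs_le_const hr hr'
  · exact Complex.abs_arg_le_pi _
  · rw [← Real.norm_eq_abs]
    refine (norm_integral_le_of_norm_le (hint.mono_set (Set.Ioi_subset_Ioi hr'))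
      ((ae_restrict_mem measurableSet_Ioi).mono fun t ht => ?_)).trans
      (setIntegral_mono_set hint (ae_of_all _ fun t => ?_)
        (Set.Ioi_subset_Ioi hr').eventuallyLE)
    · rw [norm_mul, Real.norm_eq_abs, Real.norm_eq_abs]
      gcongr
      · exact h.invDerivR.abs_mul_le hr (hr'.trans (le_of_lt ht))
      · exact Complex.abs_arg_le_pi _
    · simp only [Pi.zero_apply]
      have := Real.pi_pos
      positivity

lemma tendsto_im_integral_oscKernel_one (h : InvDecay r₀ B V) (hr : 0 < r₀) {r s : ℝ}
    (hr' : r₀ ≤ r) (hrs : r < s) {ε : ℕ → ℝ} (hε : ∀ m, 0 < ε m)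
    (hε0 : Tendsto ε atTop (𝓝 0)) :
    Tendsto (fun m => (∫ t in Set.Ioi r, ((t * V t : ℝ) : ℂ) *
      oscKernel 1 (ε m) (t ^ 2 - s ^ 2)).im) atTop (𝓝 (-(Real.pi / 2) * V s)) := by
  have hrp := hr.trans_le hr'
  have hsp := hrp.trans hrs
  have h1 := tendsto_arg_of_neg (q := r ^ 2 - s ^ 2) (by nlinarith) hε0
  have hder : ∫ t in Set.Ioi s, t * _root_.invDerivR V t = -V s := by
    have hi := h.invDerivR.integrableOn_mul_real hr (hr'.trans hrs.le) (K := fun _ => 1)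
      continuous_const (C := 1) (by simp)
    simp only [mul_one] at hi
    rw [integral_Ioi_of_hasDerivAt_of_tendsto' (fun t ht => h.hasDerivAt (hsp.trans_le ht)) hi
      h.tendsto_zero, zero_sub]
  have h2 : Tendsto (fun m => ∫ t in Set.Ioi r, t * _root_.invDerivR V t *
      (-((t ^ 2 - s ^ 2 : ℝ) : ℂ) + ε m * Complex.I).arg) atTop
      (𝓝 (∫ t in Set.Ioi r, (Set.Ioi s).indicator
        (fun t => t * _root_.invDerivR V t * Real.pi) t)) := by
    refine tendsto_integral_of_dominated_convergence (fun t => B 1 * (t ^ 2)⁻¹ * Real.pi)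
      (fun m => ?_) (((integrableOn_Ioi_inv_sq hrp).const_mul _).mul_const _) (fun m => ?_) ?_
    · exact (h.invDerivR.integrableOn_mul_real hr hr' (continuous_arg (hε m) _)
        (fun t => Complex.abs_arg_le_pi _)).aestronglyMeasurable
    · refine (ae_restrict_mem measurableSet_Ioi).mono fun t ht => ?_
      have hB := h.invDerivR.nonneg_bound hr 0
      rw [norm_mul, Real.norm_eq_abs, Real.norm_eq_abs]
      gcongr
      · exact h.invDerivR.abs_mul_le hr (hr'.trans (le_of_lt ht))
      · exact Complex.abs_arg_le_pi _
    · filter_upwards [ae_restrict_mem measurableSet_Ioi,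
        (Measure.ae_ne (volume.restrict (Set.Ioi r)) s)] with t ht hts
      have htp : 0 < t := hrp.trans ht
      rcases lt_or_gt_of_ne hts with hlt | hgt
      · rw [Set.indicator_of_notMem (by simpa using hlt.le)]
        have := (tendsto_arg_of_neg (q := t ^ 2 - s ^ 2) (by nlinarith) hε0).const_mul
          (t * _root_.invDerivR V t)
        rwa [mul_zero] at this
      · rw [Set.indicator_of_mem (by simpa using hgt)]
        exact (tendsto_arg_of_pos (q := t ^ 2 - s ^ 2) (by nlinarith) hε hε0).const_mul _
  rw [setIntegral_indicator measurableSet_Ioi, Set.inter_eq_self_of_subset_right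
    (Set.Ioi_subset_Ioi hrs.le), integral_mul_const, hder] at h2
  have h3 := ((h1.const_mul (V r)).const_mul (1 / 2)).add (h2.const_mul (1 / 2))
  rw [show 1 / 2 * (V r * 0) + 1 / 2 * (-V s * Real.pi) = -(Real.pi / 2) * V s by ring] at h3
  exact h3.congr fun m => (h.im_integral_oscKernel_one hr hr' (hε m) _).symm

end InvDecay

/-- An integrable function dominating `|q|^(-1/2)` for `|q| ≤ 1`. -/
def sqrtPeak (q : ℝ) : ℝ :=
  (Set.Ioc (0 : ℝ) 1).indicator (fun q => q ^ (-(1 / 2) : ℝ)) q +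
    (Set.Ioc (0 : ℝ) 1).indicator (fun q => q ^ (-(1 / 2) : ℝ)) (-q)

lemma integrable_sqrtPeak : Integrable sqrtPeak := by
  have h : Integrable ((Set.Ioc (0 : ℝ) 1).indicator fun q : ℝ => q ^ (-(1 / 2) : ℝ)) := by
    rw [integrable_indicator_iff measurableSet_Ioc,
      ← intervalIntegrable_iff_integrableOn_Ioc_of_le zero_le_one]
    exact intervalIntegral.intervalIntegrable_rpow' (by norm_num)
  exact h.add h.comp_neg

lemma sqrtPeak_nonneg (q : ℝ) : 0 ≤ sqrtPeak q :=
  add_nonneg (Set.indicator_nonneg (fun _ hq => Real.rpow_nonneg hq.1.le _) _)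
    (Set.indicator_nonneg (fun _ hq => Real.rpow_nonneg hq.1.le _) _)

lemma abs_rpow_le_sqrtPeak {q : ℝ} (hq : q ≠ 0) :
    |q| ^ (-(1 / 2) : ℝ) ≤ 1 + sqrtPeak q := by
  rcases le_or_gt |q| 1 with h | h
  · have h0 : ∀ q : ℝ, 0 ≤ (Set.Ioc (0 : ℝ) 1).indicator (fun q => q ^ (-(1 / 2) : ℝ)) q :=
      Set.indicator_nonneg fun q hq => Real.rpow_nonneg hq.1.le _
    have h1 := h0 q
    have h2 := h0 (-q)
    rw [sqrtPeak]
    rcases lt_or_gt_of_ne hq with hneg | hpos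
    · rw [abs_of_neg hneg] at h ⊢
      rw [Set.indicator_of_mem (Set.mem_Ioc.2 ⟨by linarith, h⟩ : -q ∈ Set.Ioc (0 : ℝ) 1)] at h2 ⊢
      linarith
    · rw [abs_of_pos hpos] at h ⊢
      rw [Set.indicator_of_mem (Set.mem_Ioc.2 ⟨hpos, h⟩ : q ∈ Set.Ioc (0 : ℝ) 1)] at h1 ⊢
      linarith
  · have := Real.rpow_le_one_of_one_le_of_nonpos h.le (by norm_num : (-(1 / 2) : ℝ) ≤ 0)
    linarith [sqrtPeak_nonneg q]

namespace InvDecay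
variable {r₀ : ℝ} {B : ℕ → ℝ} {V : ℝ → ℝ}

/-- The function dominating `t V(t) κ(t² - s²)` uniformly in `ε`. -/
def halfDom (r₀ C s t : ℝ) : ℝ :=
  C * (2 * r₀) ^ (-(1 / 2) : ℝ) * ((t ^ 2)⁻¹ + (r₀ ^ 2)⁻¹ * sqrtPeak (t - s))

lemma integrableOn_halfDom (hr : 0 < r₀) (C s : ℝ) :
    IntegrableOn (halfDom r₀ C s) (Set.Ioi r₀) :=
  ((integrableOn_Ioi_inv_sq hr).add
    ((integrable_sqrtPeak.comp_sub_right s).integrableOn.const_mul _)).const_mul _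

lemma halfDom_nonneg (hr : 0 < r₀) {C : ℝ} (hC : 0 ≤ C) (s t : ℝ) : 0 ≤ halfDom r₀ C s t := by
  have := sqrtPeak_nonneg (t - s)
  rw [halfDom]
  positivity

lemma integral_halfDom_le (hr : 0 < r₀) {C : ℝ} (hC : 0 ≤ C) {r : ℝ} (hr' : r₀ ≤ r) (s : ℝ) :
    ∫ t in Set.Ioi r, halfDom r₀ C s t ≤ C * (2 * r₀) ^ (-(1 / 2) : ℝ) *
      ((∫ t in Set.Ioi r₀, (t ^ 2)⁻¹) + (r₀ ^ 2)⁻¹ * ∫ t, sqrtPeak t) := by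
  refine (setIntegral_mono_set (integrableOn_halfDom hr C s)
    (ae_of_all _ fun t => halfDom_nonneg hr hC s t)
    (Set.Ioi_subset_Ioi hr').eventuallyLE).trans ?_
  have hp := (integrable_sqrtPeak.comp_sub_right s)
  simp only [halfDom]
  rw [integral_const_mul, integral_add (integrableOn_Ioi_inv_sq hr)
    (hp.integrableOn.const_mul _), integral_const_mul]
  gcongr
  rw [← integral_sub_right_eq_self (μ := volume) sqrtPeak s]
  exact setIntegral_le_integral hp (ae_of_all _ fun t => sqrtPeak_nonneg _)

lemma abs_mul_rpow_le (h : InvDecay r₀ B V) (hr : 0 < r₀) {s t : ℝ} (hs : 2 * r₀ ≤ s)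
    (ht : r₀ ≤ t) (hts : t ≠ s) :
    |t * V t| * |t ^ 2 - s ^ 2| ^ (-(1 / 2) : ℝ) ≤ halfDom r₀ (B 0) s t := by
  have htp := hr.trans_le ht
  have h1 : |t ^ 2 - s ^ 2| ^ (-(1 / 2) : ℝ) ≤
      (2 * r₀) ^ (-(1 / 2) : ℝ) * (1 + sqrtPeak (t - s)) := by
    rw [show t ^ 2 - s ^ 2 = (t + s) * (t - s) by ring, abs_mul, Real.mul_rpow (abs_nonneg _)
      (abs_nonneg _)]
    exact mul_le_mul (Real.rpow_le_rpow_of_nonpos (by positivity)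
      (by rw [abs_of_pos (by linarith)]; linarith) (by norm_num))
      (abs_rpow_le_sqrtPeak (sub_ne_zero.2 hts)) (by positivity) (by positivity)
  have h2 : (t ^ 2)⁻¹ ≤ (r₀ ^ 2)⁻¹ := inv_anti₀ (by positivity) (pow_le_pow_left₀ hr.le ht 2)
  have hB := h.nonneg_bound hr 0
  have hp := sqrtPeak_nonneg (t - s)
  calc |t * V t| * |t ^ 2 - s ^ 2| ^ (-(1 / 2) : ℝ) ≤
      B 0 * (t ^ 2)⁻¹ * ((2 * r₀) ^ (-(1 / 2) : ℝ) * (1 + sqrtPeak (t - s))) := by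
        gcongr
        exact h.abs_mul_le hr ht
    _ = B 0 * (2 * r₀) ^ (-(1 / 2) : ℝ) * ((t ^ 2)⁻¹ + (t ^ 2)⁻¹ * sqrtPeak (t - s)) := by ring
    _ ≤ _ := by rw [halfDom]; gcongr

lemma norm_mul_im_oscKernel_half_le (h : InvDecay r₀ B V) (hr : 0 < r₀) {s t : ℝ}
    (hs : 2 * r₀ ≤ s) (ht : r₀ ≤ t) (hts : t ≠ s) (ε : ℝ) :
    ‖t * V t * (oscKernel (1 / 2) ε (t ^ 2 - s ^ 2)).im‖ ≤ halfDom r₀ (B 0) s t := by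
  have htp := hr.trans_le ht
  have hq : t ^ 2 - s ^ 2 ≠ 0 := by
    rw [show t ^ 2 - s ^ 2 = (t + s) * (t - s) by ring]
    exact mul_ne_zero (by linarith : 0 < t + s).ne' (sub_ne_zero.2 hts)
  rw [norm_mul, Real.norm_eq_abs, Real.norm_eq_abs]
  refine le_trans ?_ (h.abs_mul_rpow_le hr hs ht hts)
  gcongr
  exact (Complex.abs_im_le_norm _).trans (norm_oscKernel_le (by norm_num) ε hq)

lemma abs_im_integral_oscKernel_half_le (h : InvDecay r₀ B V) (hr : 0 < r₀) {r s : ℝ}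
    (hr' : r₀ ≤ r) (hs : 2 * r₀ ≤ s) {ε : ℝ} (hε : 0 < ε) :
    |(∫ t in Set.Ioi r, ((t * V t : ℝ) : ℂ) * oscKernel (1 / 2) ε (t ^ 2 - s ^ 2)).im| ≤
      B 0 * (2 * r₀) ^ (-(1 / 2) : ℝ) *
      ((∫ t in Set.Ioi r₀, (t ^ 2)⁻¹) + (r₀ ^ 2)⁻¹ * ∫ t, sqrtPeak t) := by
  rw [h.im_integral_mul hr hr' (by norm_num) hε, ← Real.norm_eq_abs]
  refine (norm_integral_le_of_norm_le
    ((integrableOn_halfDom hr (B 0) s).mono_set (Set.Ioi_subset_Ioi hr')) ?_).trans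
    (integral_halfDom_le hr (h.nonneg_bound hr 0) hr' s)
  filter_upwards [ae_restrict_mem measurableSet_Ioi,
    Measure.ae_ne (volume.restrict (Set.Ioi r)) s] with t ht hts
  exact h.norm_mul_im_oscKernel_half_le hr hs (hr'.trans (le_of_lt ht)) hts ε

lemma tendsto_im_integral_oscKernel_half (h : InvDecay r₀ B V) (hr : 0 < r₀) {r s : ℝ}
    (hr' : r₀ ≤ r) (hs : 2 * r₀ ≤ s) (hrs : r < s) {ε : ℕ → ℝ} (hε : ∀ m, 0 < ε m)
    (hε0 : Tendsto ε atTop (𝓝 0)) :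
    Tendsto (fun m => (∫ t in Set.Ioi r, ((t * V t : ℝ) : ℂ) *
      oscKernel (1 / 2) (ε m) (t ^ 2 - s ^ 2)).im) atTop
      (𝓝 (-1 * ∫ t in Set.Ioi s, t * V t / √(t ^ 2 - s ^ 2))) := by
  have hrp := hr.trans_le hr'
  have h2 : Tendsto (fun m => ∫ t in Set.Ioi r, t * V t *
      (oscKernel (1 / 2) (ε m) (t ^ 2 - s ^ 2)).im) atTop
      (𝓝 (∫ t in Set.Ioi r, (Set.Ioi s).indicator
        (fun t => -1 * (t * V t / √(t ^ 2 - s ^ 2))) t)) := by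
    refine tendsto_integral_of_dominated_convergence (halfDom r₀ (B 0) s)
      (fun m => ?_) ((integrableOn_halfDom hr (B 0) s).mono_set (Set.Ioi_subset_Ioi hr'))
      (fun m => ?_) ?_
    · exact (h.integrableOn_mul_real hr hr'
        (K := fun t => (oscKernel (1 / 2) (ε m) (t ^ 2 - s ^ 2)).im)
        (Complex.continuous_im.comp (continuous_oscKernel (hε m) _ _))
        (fun t => (Complex.abs_im_le_norm _).trans
          (norm_oscKernel_le_of_pos (by norm_num) (hε m) _))).aestronglyMeasurable
    · filter_upwards [ae_restrict_mem measurableSet_Ioi,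
        Measure.ae_ne (volume.restrict (Set.Ioi r)) s] with t ht hts
      exact h.norm_mul_im_oscKernel_half_le hr hs (hr'.trans (le_of_lt ht)) hts _
    · filter_upwards [ae_restrict_mem measurableSet_Ioi,
        Measure.ae_ne (volume.restrict (Set.Ioi r)) s] with t ht hts
      have htp : 0 < t := hrp.trans ht
      rcases lt_or_gt_of_ne hts with hlt | hgt
      · rw [Set.indicator_of_notMem (by simpa using hlt.le)]
        have := (tendsto_im_oscKernel_of_neg (1 / 2) (q := t ^ 2 - s ^ 2)
          (by nlinarith) hε0).const_mul (t * V t)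
        rwa [mul_zero] at this
      · rw [Set.indicator_of_mem (by simpa using hgt)]
        have := (tendsto_im_oscKernel_half (q := t ^ 2 - s ^ 2) (by nlinarith) hε hε0).const_mul
          (t * V t)
        rwa [show t * V t * -(√(t ^ 2 - s ^ 2))⁻¹ = -1 * (t * V t / √(t ^ 2 - s ^ 2)) by ring] at this
  rw [setIntegral_indicator measurableSet_Ioi, Set.inter_eq_self_of_subset_right
    (Set.Ioi_subset_Ioi hrs.le), integral_const_mul] at h2
  exact h2.congr fun m => (h.im_integral_mul hr hr' (by norm_num) (hε m) _).symm

end InvDecay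

/-- The Abel-type transform `∫_s^∞ t V(t) / √(t² - s²) dt`. -/
def abelT (V : ℝ → ℝ) (s : ℝ) : ℝ := ∫ t in Set.Ioi s, t * V t / √(t ^ 2 - s ^ 2)

lemma sqrt_sq_add_sq_pos {s : ℝ} (hs : 0 < s) (q : ℝ) : 0 < √(s ^ 2 + q ^ 2) := by positivity

lemma abelT_eq (V : ℝ → ℝ) {s : ℝ} (hs : 0 < s) :
    abelT V s = ∫ q in Set.Ioi (0 : ℝ), V √(s ^ 2 + q ^ 2) := by
  have himg : (fun q : ℝ => √(s ^ 2 + q ^ 2)) '' Set.Ioi 0 = Set.Ioi s := by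
    ext t
    constructor
    · rintro ⟨q, hq, rfl⟩
      have hq' : 0 < q := hq
      exact Real.lt_sqrt_of_sq_lt (by nlinarith)
    · intro ht
      have ht' : s < t := ht
      refine ⟨√(t ^ 2 - s ^ 2), Real.sqrt_pos.2 (by nlinarith), ?_⟩
      simp only
      rw [Real.sq_sqrt (by nlinarith), add_sub_cancel, Real.sqrt_sq (by linarith)]
  have hder : ∀ q ∈ Set.Ioi (0 : ℝ), HasDerivWithinAt (fun q : ℝ => √(s ^ 2 + q ^ 2))
      (q / √(s ^ 2 + q ^ 2)) (Set.Ioi 0) q := fun q _ => by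
    have h1 : HasDerivAt (fun q : ℝ => s ^ 2 + q ^ 2) (2 * q) q := by
      simpa using (hasDerivAt_pow 2 q).const_add (s ^ 2)
    refine ((h1.sqrt (by positivity)).congr_deriv ?_).hasDerivWithinAt
    rw [mul_div_mul_left _ _ two_ne_zero]
  have hinj : Set.InjOn (fun q : ℝ => √(s ^ 2 + q ^ 2)) (Set.Ioi 0) := by
    intro p hp q hq h
    have hp' : 0 < p := hp
    have hq' : 0 < q := hq
    have := (Real.sqrt_inj (by positivity) (by positivity)).1 h
    exact (pow_left_inj₀ hp'.le hq'.le two_ne_zero).1 (by linarith)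
  rw [abelT, ← himg, integral_image_eq_integral_abs_deriv_smul measurableSet_Ioi hder hinj
    fun t => t * V t / √(t ^ 2 - s ^ 2)]
  refine setIntegral_congr_fun measurableSet_Ioi fun q hq => ?_
  have hq' : 0 < q := hq
  have ht := sqrt_sq_add_sq_pos hs q
  simp only [smul_eq_mul]
  rw [Real.sq_sqrt (by positivity), add_sub_cancel_left, Real.sqrt_sq hq'.le,
    abs_of_pos (by positivity)]
  field_simp

namespace InvDecay
variable {r₀ : ℝ} {B : ℕ → ℝ} {V : ℝ → ℝ}

lemma continuous_comp_sqrt (h : InvDecay r₀ B V) {s : ℝ} (hs : 0 < s) :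
    Continuous fun q : ℝ => V √(s ^ 2 + q ^ 2) :=
  h.continuousOn.comp_continuous (by fun_prop) fun q => sqrt_sq_add_sq_pos hs q

lemma abs_comp_sqrt_le (h : InvDecay r₀ B V) (hr : 0 < r₀) (hr1 : r₀ ≤ 1) {s : ℝ} (hs : r₀ ≤ s)
    (q : ℝ) : |V √(s ^ 2 + q ^ 2)| ≤ B 0 * (r₀ ^ 3)⁻¹ * (1 + q ^ 2)⁻¹ := by
  have hsp := hr.trans_le hs
  set t := √(s ^ 2 + q ^ 2) with ht
  have h1 : r₀ ≤ t := hs.trans (Real.le_sqrt_of_sq_le (by nlinarith))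
  have h2 : t ^ 2 = s ^ 2 + q ^ 2 := Real.sq_sqrt (by positivity)
  have h3 : r₀ ^ 2 * (1 + q ^ 2) ≤ t ^ 2 := by
    have : r₀ ^ 2 ≤ s ^ 2 := pow_le_pow_left₀ hr.le hs 2
    have : r₀ ^ 2 ≤ 1 := pow_le_one₀ hr.le hr1
    nlinarith [sq_nonneg q]
  have h4 : r₀ ^ 3 * (1 + q ^ 2) ≤ t ^ 3 := by
    calc r₀ ^ 3 * (1 + q ^ 2) = r₀ * (r₀ ^ 2 * (1 + q ^ 2)) := by ring
      _ ≤ t * t ^ 2 := by gcongr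
      _ = _ := by ring
  refine (h.abs_le h1).trans ?_
  rw [mul_assoc, ← mul_inv, ← div_eq_mul_inv]
  exact div_le_div_of_nonneg_left (h.nonneg_bound hr 0) (by positivity) h4

lemma hasDerivAt_abelT (h : InvDecay r₀ B V) (hr : 0 < r₀) (hr1 : r₀ ≤ 1) {s : ℝ} (hs : r₀ < s) :
    HasDerivAt (abelT V) (s * abelT (_root_.invDerivR V) s) s := by
  have hsp := hr.trans hs
  have hB := h.invDerivR.nonneg_bound hr 0
  have hnhds : Set.Ioo r₀ (s + 1) ∈ 𝓝 s := Ioo_mem_nhds hs (by linarith)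
  have hbd : Integrable (fun q : ℝ => B 0 * (r₀ ^ 3)⁻¹ * (1 + q ^ 2)⁻¹)
      (volume.restrict (Set.Ioi 0)) := (integrable_inv_one_add_sq.const_mul _).integrableOn
  have hmain := (hasDerivAt_integral_of_dominated_loc_of_deriv_le (𝕜 := ℝ)
    (μ := volume.restrict (Set.Ioi (0 : ℝ)))
    (F := fun s q => V √(s ^ 2 + q ^ 2))
    (F' := fun s q => s * _root_.invDerivR V √(s ^ 2 + q ^ 2))
    (bound := fun q => (s + 1) * (B 1 * (r₀ ^ 3)⁻¹ * (1 + q ^ 2)⁻¹)) hnhds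
    ((eventually_gt_nhds hsp).mono fun s' hs' =>
      (h.continuous_comp_sqrt hs').aestronglyMeasurable)
    (hbd.mono' (h.continuous_comp_sqrt hsp).aestronglyMeasurable
      (ae_of_all _ fun q => h.abs_comp_sqrt_le hr hr1 hs.le q))
    (((h.invDerivR.continuous_comp_sqrt hsp).const_mul s).aestronglyMeasurable)
    (ae_of_all _ fun q s' hs' => ?_)
    ((integrable_inv_one_add_sq.const_mul _).integrableOn.const_mul _)
    (ae_of_all _ fun q s' hs' => ?_)).2
  · rw [integral_const_mul, ← abelT_eq _ hsp] at hmain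
    refine hmain.congr_of_eventuallyEq ((eventually_gt_nhds hsp).mono fun s' hs' => ?_)
    exact abelT_eq V hs'
  · have hs0 : 0 < s' := hr.trans hs'.1
    rw [norm_mul, Real.norm_eq_abs, abs_of_pos hs0]
    have := hs'.2.le
    gcongr
    exact h.invDerivR.abs_comp_sqrt_le hr hr1 hs'.1.le q
  · have hs0 : 0 < s' := hr.trans hs'.1
    have ht := sqrt_sq_add_sq_pos hs0 q
    have h1 : HasDerivAt (fun s : ℝ => s ^ 2 + q ^ 2) (2 * s') s' := by
      simpa using (hasDerivAt_pow 2 s').add_const (q ^ 2)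
    refine ((h.hasDerivAt ht).comp s' (h1.sqrt (by positivity))).congr_deriv ?_
    field_simp

lemma iterate_invDerivR_abelT (h : InvDecay r₀ B V) (hr : 0 < r₀) (hr1 : r₀ ≤ 1) (j : ℕ) :
    Set.EqOn (_root_.invDerivR^[j] (abelT V)) (abelT (_root_.invDerivR^[j] V)) (Set.Ioi r₀) := by
  induction j generalizing B V with
  | zero => exact fun t _ => rfl
  | succ j ih =>
    intro s hs
    have h1 : Set.EqOn (_root_.invDerivR (abelT V)) (abelT (_root_.invDerivR V)) (Set.Ioi r₀) :=
      fun s hs => by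
        rw [_root_.invDerivR, (h.hasDerivAt_abelT hr hr1 hs).deriv,
          mul_div_cancel_left₀ _ (hr.trans hs).ne']
    simp only [iterate_succ_apply]
    rw [eqOn_iterate_invDerivR j h1 hs]
    exact ih h.invDerivR hs

end InvDecay

lemma cnConst_ne_zero (n : ℕ) : cnConst n ≠ 0 := by
  have := Real.pi_pos
  rw [cnConst]
  split_ifs
  · exact div_ne_zero (pow_ne_zero _ (by norm_num)) (by positivity)
  · exact div_ne_zero (pow_ne_zero _ (by norm_num)) (by positivity)

lemma near_neg {r₀ s t : ℝ} (hr : 0 < r₀) (hs : 2 * r₀ ≤ s) (ht : t ∈ Set.Ioc 0 (s / 2)) :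
    t ^ 2 - s ^ 2 ≤ -(3 * r₀ ^ 2) := by
  have h1 := ht.1
  have h2 := ht.2
  nlinarith

section near
variable {r₀ s C : ℝ} {v : ℝ → ℝ}

lemma integrableOn_near (hv : Continuous v) (b : ℝ) {ε : ℝ} (hε : 0 < ε) (A r : ℝ) :
    IntegrableOn (fun t => (v t : ℂ) * oscKernel b ε (t ^ 2 - A)) (Set.Ioc 0 r) :=
  (((Complex.continuous_ofReal.comp hv).mul (continuous_oscKernel hε b A)).integrableOn_Icc).mono_set
    Set.Ioc_subset_Icc_self

lemma im_integral_near (hv : Continuous v) (b : ℝ) {ε : ℝ} (hε : 0 < ε) (A r : ℝ) :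
    (∫ t in Set.Ioc 0 r, (v t : ℂ) * oscKernel b ε (t ^ 2 - A)).im =
      ∫ t in Set.Ioc 0 r, v t * (oscKernel b ε (t ^ 2 - A)).im := by
  have h1 := Complex.imCLM.integral_comp_comm (integrableOn_near hv b hε A r)
  simp only [Complex.imCLM_apply] at h1
  rw [← h1]
  simp only [Complex.im_ofReal_mul]

lemma abs_near_le (hr : 0 < r₀) (hs : 2 * r₀ ≤ s) (hC : ∀ t, 0 ≤ t → |v t| ≤ C) {b : ℝ}
    (hb : 0 ≤ b) (ε : ℝ) {t : ℝ} (ht : t ∈ Set.Ioc 0 (s / 2)) :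
    ‖v t * (oscKernel b ε (t ^ 2 - s ^ 2)).im‖ ≤ C * (3 * r₀ ^ 2) ^ (-b) := by
  have hq := near_neg hr hs ht
  have hq0 : t ^ 2 - s ^ 2 < 0 := by nlinarith [pow_pos hr 2]
  have hv := hC t ht.1.le
  rw [norm_mul, Real.norm_eq_abs, Real.norm_eq_abs]
  have h1 : |(oscKernel b ε (t ^ 2 - s ^ 2)).im| ≤ (3 * r₀ ^ 2) ^ (-b) := by
    refine (Complex.abs_im_le_norm _).trans ((norm_oscKernel_le hb ε hq0.ne).trans ?_)
    refine Real.rpow_le_rpow_of_nonpos (by positivity) ?_ (by linarith)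
    rw [abs_of_neg hq0]
    linarith
  exact mul_le_mul hv h1 (abs_nonneg _) ((abs_nonneg _).trans hv)

lemma abs_im_integral_near_le (hr : 0 < r₀) (hs : 2 * r₀ ≤ s) (hs2 : s ≤ 2) (hv : Continuous v)
    (hC : ∀ t, 0 ≤ t → |v t| ≤ C) {b : ℝ} (hb : 0 ≤ b) {ε : ℝ} (hε : 0 < ε) :
    |(∫ t in Set.Ioc 0 (s / 2), (v t : ℂ) * oscKernel b ε (t ^ 2 - s ^ 2)).im| ≤
      C * (3 * r₀ ^ 2) ^ (-b) := by
  have hC0 : 0 ≤ C := (abs_nonneg _).trans (hC 0 le_rfl)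
  rw [im_integral_near hv b hε, ← Real.norm_eq_abs]
  refine (norm_setIntegral_le_of_norm_le_const (by simp) fun t ht =>
    abs_near_le hr hs hC hb ε ht).trans ?_
  rw [measureReal_def, Real.volume_Ioc, sub_zero, ENNReal.toReal_ofReal (by linarith)]
  exact mul_le_of_le_one_right (by positivity) (by linarith)

lemma tendsto_im_integral_near (hr : 0 < r₀) (hs : 2 * r₀ ≤ s) (hv : Continuous v)
    (hC : ∀ t, 0 ≤ t → |v t| ≤ C) {b : ℝ} (hb : 0 ≤ b) {ε : ℕ → ℝ} (hε : ∀ m, 0 < ε m)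
    (hε0 : Tendsto ε atTop (𝓝 0)) :
    Tendsto (fun m => (∫ t in Set.Ioc 0 (s / 2), (v t : ℂ) *
      oscKernel b (ε m) (t ^ 2 - s ^ 2)).im) atTop (𝓝 0) := by
  have h : Tendsto (fun m => ∫ t in Set.Ioc 0 (s / 2), v t *
      (oscKernel b (ε m) (t ^ 2 - s ^ 2)).im) atTop (𝓝 (∫ _ in Set.Ioc 0 (s / 2), (0 : ℝ))) := by
    refine tendsto_integral_of_dominated_convergence (fun _ => C * (3 * r₀ ^ 2) ^ (-b))
      (fun m => ?_) (integrable_const _) (fun m => ?_) ?_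
    · exact (hv.mul (Complex.continuous_im.comp
        (continuous_oscKernel (hε m) b _))).aestronglyMeasurable
    · exact (ae_restrict_mem measurableSet_Ioc).mono fun t ht => abs_near_le hr hs hC hb _ ht
    · refine (ae_restrict_mem measurableSet_Ioc).mono fun t ht => ?_
      have hq := near_neg hr hs ht
      have := (tendsto_im_oscKernel_of_neg b (q := t ^ 2 - s ^ 2)
        (by nlinarith [pow_pos hr 2]) hε0).const_mul (v t)
      rwa [mul_zero] at this
  rw [integral_zero] at h
  exact h.congr fun m => (im_integral_near hv b (hε m) _ _).symm

end near

/-- The base case of the recursion, as a property of a limiting functional `L`. -/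
lemma exists_im_integral_tendsto_of_base {r₀ : ℝ} (hr : 0 < r₀) {b₀ c₀ : ℝ} (hb₀ : 0 < b₀)
    (hc₀ : c₀ ≠ 0) (L : (ℝ → ℝ) → ℝ → ℝ)
    (hbase : ∀ B : ℕ → ℝ, ∃ M : ℝ, ∀ V, InvDecay r₀ B V → ∀ s, 2 * r₀ ≤ s →
      (∀ ε, 0 < ε → |(∫ t in Set.Ioi (s / 2), ((t * V t : ℝ) : ℂ) *
        oscKernel b₀ ε (t ^ 2 - s ^ 2)).im| ≤ M) ∧
      ∀ ε : ℕ → ℝ, (∀ m, 0 < ε m) → Tendsto ε atTop (𝓝 0) →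
        Tendsto (fun m => (∫ t in Set.Ioi (s / 2), ((t * V t : ℝ) : ℂ) *
          oscKernel b₀ (ε m) (t ^ 2 - s ^ 2)).im) atTop (𝓝 (c₀ * L V s))) (k : ℕ) (D : ℕ → ℝ) :
    ∃ c : ℝ, c ≠ 0 ∧ ∃ M : ℝ, ∀ v : ℝ → ℝ, ContDiff ℝ (⊤ : ℕ∞) v →
      (∀ i t, 0 ≤ t → |iteratedDeriv i v t| ≤ D i / (1 + t ^ 2)) → ∀ s, 2 * r₀ ≤ s → s ≤ 2 →
      (∀ ε, 0 < ε → |(∫ t in Set.Ioi 0, (v t : ℂ) *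
        oscKernel (b₀ + k) ε (t ^ 2 - s ^ 2)).im| ≤ M) ∧
      ∀ ε : ℕ → ℝ, (∀ m, 0 < ε m) → Tendsto ε atTop (𝓝 0) →
        Tendsto (fun m => (∫ t in Set.Ioi 0, (v t : ℂ) *
          oscKernel (b₀ + k) (ε m) (t ^ 2 - s ^ 2)).im) atTop
          (𝓝 (c * L (invDerivR^[k] fun t => v t / t) s)) := by
  obtain ⟨B, hB⟩ := exists_invDecay hr D
  obtain ⟨c, hc, hchain⟩ := exists_im_integral_oscKernel_add_nat hr hb₀ k
  obtain ⟨M₁, hM₁⟩ := hchain B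
  obtain ⟨M₂, hM₂⟩ := hbase fun i => B (i + k)
  have hb : 0 < b₀ + k := by positivity
  refine ⟨c * c₀, mul_ne_zero hc hc₀, D 0 * (3 * r₀ ^ 2) ^ (-(b₀ + k)) + (M₁ + |c| * M₂),
    fun v hv hD s hs hs2 => ?_⟩
  have hV := hB v hv hD
  obtain ⟨E, hE1, hE2, hE3⟩ := hM₁ _ hV s hs
  obtain ⟨hL1, hL2⟩ := hM₂ _ (hV.iterate k) s hs
  have hC : ∀ t, 0 ≤ t → |v t| ≤ D 0 := fun t ht => by
    have h0 := hD 0 t ht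
    rw [iteratedDeriv_zero, le_div_iff₀ (by positivity)] at h0
    nlinarith [abs_nonneg (v t), sq_nonneg t]
  have hs0 : 0 < s / 2 := by linarith
  have hcongr : ∀ ε, Set.EqOn (fun t => ((t * (v t / t) : ℝ) : ℂ) *
      oscKernel (b₀ + k) ε (t ^ 2 - s ^ 2)) (fun t => (v t : ℂ) *
      oscKernel (b₀ + k) ε (t ^ 2 - s ^ 2)) (Set.Ioi (s / 2)) := fun ε t ht => by
    simp only
    rw [mul_div_cancel₀ _ (hs0.trans ht).ne']
  have hsplit : ∀ ε, 0 < ε → (∫ t in Set.Ioi 0, (v t : ℂ) *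
      oscKernel (b₀ + k) ε (t ^ 2 - s ^ 2)).im =
      (∫ t in Set.Ioc 0 (s / 2), (v t : ℂ) * oscKernel (b₀ + k) ε (t ^ 2 - s ^ 2)).im +
      (E ε + c * (∫ t in Set.Ioi (s / 2), ((t * invDerivR^[k] (fun t => v t / t) t : ℝ) : ℂ) *
        oscKernel b₀ ε (t ^ 2 - s ^ 2)).im) := fun ε hε => by
    have hi := hV.integrableOn_mul_oscKernel hr (by linarith : r₀ ≤ s / 2) hb.le hε (s ^ 2)
    rw [← hE3 ε hε, setIntegral_congr_fun measurableSet_Ioi (hcongr ε), ← Complex.add_im,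
      ← Set.Ioc_union_Ioi_eq_Ioi hs0.le, setIntegral_union (Set.Ioc_disjoint_Ioi le_rfl)
      measurableSet_Ioi (integrableOn_near hv.continuous _ hε _ _)
      (hi.congr_fun (hcongr ε) measurableSet_Ioi)]
  constructor
  · intro ε hε
    rw [hsplit ε hε]
    refine (abs_add_le _ _).trans (add_le_add
      (abs_im_integral_near_le hr hs hs2 hv.continuous hC hb.le hε) ?_)
    refine (abs_add_le _ _).trans (add_le_add (hE1 ε hε) ?_)
    rw [abs_mul]
    gcongr
    exact hL1 ε hε
  · intro ε hε hε0
    have h1 := tendsto_im_integral_near hr hs hv.continuous hC hb.le hε hε0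
    have h2 := h1.add ((hE2 ε hε0).add ((hL2 ε hε hε0).const_mul c))
    rw [zero_add, zero_add, ← mul_assoc] at h2
    exact h2.congr fun m => (hsplit _ (hε m)).symm

theorem exists_im_integral_tendsto_Wtr (hn : 2 ≤ n) {r₀ : ℝ} (hr : 0 < r₀) (hr1 : r₀ ≤ 1)
    (D : ℕ → ℝ) :
    ∃ c : ℝ, c ≠ 0 ∧ ∃ M : ℝ, ∀ v : ℝ → ℝ, ContDiff ℝ (⊤ : ℕ∞) v →
      (∀ i t, 0 ≤ t → |iteratedDeriv i v t| ≤ D i / (1 + t ^ 2)) → ∀ s, 2 * r₀ ≤ s → s ≤ 2 →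
      (∀ ε, 0 < ε → |(∫ t in Set.Ioi 0, (v t : ℂ) *
        oscKernel (((n : ℝ) - 1) / 2) ε (t ^ 2 - s ^ 2)).im| ≤ M) ∧
      ∀ ε : ℕ → ℝ, (∀ m, 0 < ε m) → Tendsto ε atTop (𝓝 0) →
        Tendsto (fun m => (∫ t in Set.Ioi 0, (v t : ℂ) *
          oscKernel (((n : ℝ) - 1) / 2) (ε m) (t ^ 2 - s ^ 2)).im) atTop
          (𝓝 (c * Wtr n v s)) := by
  have hcn := cnConst_ne_zero n
  rcases Nat.even_or_odd n with he | ho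
  · obtain ⟨k, hk⟩ : ∃ k, n = 2 * k + 2 := by
      obtain ⟨m, hm⟩ := he
      exact ⟨m - 1, by omega⟩
    have hk' : (n - 2) / 2 = k := by omega
    have ha : ((n : ℝ) - 1) / 2 = 1 / 2 + k := by rw [hk]; push_cast; ring
    obtain ⟨c, hc, M, hM⟩ := exists_im_integral_tendsto_of_base hr (b₀ := 1 / 2) (c₀ := -1)
      (by norm_num) (by norm_num) abelT (fun B => ⟨_, fun V hV s hs =>
        ⟨fun ε hε => hV.abs_im_integral_oscKernel_half_le hr (by linarith) hs hε,
          fun ε hε hε0 => hV.tendsto_im_integral_oscKernel_half hr (by linarith) hs (by linarith)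
            hε hε0⟩⟩) k D
    obtain ⟨B, hB⟩ := exists_invDecay hr D
    refine ⟨c / cnConst n, div_ne_zero hc hcn, M, fun v hv hD s hs hs2 => ?_⟩
    have hW : Wtr n v s = cnConst n * abelT (invDerivR^[k] fun t => v t / t) s := by
      have h1 : Set.EqOn (fun s' => ∫ t in Set.Ioi s', v t / Real.sqrt (t ^ 2 - s' ^ 2))
          (abelT fun t => v t / t) (Set.Ioi r₀) := fun s' hs' => by
        refine setIntegral_congr_fun measurableSet_Ioi fun t ht => ?_
        simp only
        rw [mul_div_cancel₀ _ ((hr.trans hs').trans ht).ne']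
      rw [Wtr, if_pos he, hk', eqOn_iterate_invDerivR k h1 (by simp; linarith),
        (hB v hv hD).iterate_invDerivR_abelT hr hr1 k (by simp; linarith)]
    rw [ha, hW, ← mul_assoc, div_mul_cancel₀ _ hcn]
    exact hM v hv hD s hs hs2
  · obtain ⟨k, hk⟩ : ∃ k, n = 2 * k + 3 := by
      obtain ⟨m, hm⟩ := ho
      exact ⟨m - 1, by omega⟩
    have hk' : (n - 3) / 2 = k := by omega
    have ha : ((n : ℝ) - 1) / 2 = 1 + k := by rw [hk]; push_cast; ring
    obtain ⟨c, hc, M, hM⟩ := exists_im_integral_tendsto_of_base hr (b₀ := 1)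
      (c₀ := -(Real.pi / 2)) one_pos (neg_ne_zero.2 (by positivity)) (fun V s => V s)
      (fun B => ⟨_, fun V hV s hs =>
        ⟨fun ε hε => hV.abs_im_integral_oscKernel_one_le hr (by linarith) hε _,
          fun ε hε hε0 => hV.tendsto_im_integral_oscKernel_one hr (by linarith) (by linarith)
            hε hε0⟩⟩) k D
    refine ⟨c / cnConst n, div_ne_zero hc hcn, M, fun v hv hD s hs hs2 => ?_⟩
    have hW : Wtr n v s = cnConst n * (invDerivR^[k] fun t => v t / t) s := by
      rw [Wtr, if_neg (Nat.not_even_iff_odd.2 ho), hk']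
    rw [ha, hW, ← mul_assoc, div_mul_cancel₀ _ hcn]
    exact hM v hv hD s hs hs2

lemma oscConst_pos (hn : 2 ≤ n) : 0 < oscConst n := by
  have hn' : (2 : ℝ) ≤ n := by exact_mod_cast hn
  have h1 := Real.Gamma_pos_of_pos (by linarith : 0 < (n : ℝ) - 1)
  have h2 := Real.Gamma_pos_of_pos (by linarith : 0 < ((n : ℝ) - 1) / 2)
  have := Real.pi_pos
  rw [oscConst]
  positivity

lemma contDiff_iteratedDeriv_snd {u : Esp n → ℝ → ℝ}
    (hu : ContDiff ℝ (⊤ : ℕ∞) fun p : Esp n × ℝ => u p.1 p.2) (i : ℕ) :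
    ContDiff ℝ (⊤ : ℕ∞) fun p : Esp n × ℝ => iteratedDeriv i (u p.1) p.2 := by
  induction i with
  | zero => simpa using hu
  | succ i ih =>
    have h : (fun p : Esp n × ℝ => iteratedDeriv (i + 1) (u p.1) p.2) =
        fun p => fderiv ℝ (fun p : Esp n × ℝ => iteratedDeriv i (u p.1) p.2) p (0, 1) := by
      funext p
      have h1 := (ih.differentiable (by simp) p).hasFDerivAt
      have h2 : HasDerivAt (fun t : ℝ => ((p.1, t) : Esp n × ℝ)) (0, 1) p.2 :=
        (hasDerivAt_const _ _).prodMk (hasDerivAt_id _)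
      rw [iteratedDeriv_succ]
      exact (h1.comp_hasDerivAt p.2 h2).deriv
    rw [h]
    exact (ih.fderiv_right (by simp)).clm_apply contDiff_const

lemma exists_uniform_bound (hn : 2 ≤ n) {u : Esp n → ℝ → ℝ}
    (hu : ContDiff ℝ (⊤ : ℕ∞) fun p : Esp n × ℝ => u p.1 p.2)
    (hdecay : ∀ k : ℕ, ∃ C : ℝ, ∀ t : ℝ, 1 ≤ t → ∀ y ∈ unitSphere n,
      |iteratedDeriv k (u y) t| ≤ C * t ^ (-(n + k : ℝ))) :
    ∃ D : ℕ → ℝ, ∀ y ∈ unitSphere n, ∀ i t, 0 ≤ t →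
      |iteratedDeriv i (u y) t| ≤ D i / (1 + t ^ 2) := by
  choose C hC using hdecay
  have hK : ∀ i : ℕ, ∃ K, ∀ p ∈ unitSphere n ×ˢ Set.Icc (0 : ℝ) 1,
      ‖iteratedDeriv i (u p.1) p.2‖ ≤ K := fun i =>
    ((isCompact_sphere (0 : Esp n) 1).prod isCompact_Icc).exists_bound_of_continuousOn
      (contDiff_iteratedDeriv_snd hu i).continuous.continuousOn
  choose K hK using hK
  refine ⟨fun i => 2 * |C i| + 2 * |K i|, fun y hy i t ht => ?_⟩
  rw [le_div_iff₀ (by positivity)]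
  rcases le_or_gt 1 t with h1 | h1
  · have h2 : |iteratedDeriv i (u y) t| ≤ |C i| * (t ^ 2)⁻¹ := by
      refine (hC i t h1 y hy).trans ?_
      have h3 : t ^ (-(n + i : ℝ)) ≤ (t ^ 2)⁻¹ := by
        have hn' : (2 : ℝ) ≤ n := by exact_mod_cast hn
        have hi : (0 : ℝ) ≤ i := i.cast_nonneg
        rw [← Real.rpow_natCast, ← Real.rpow_neg ht]
        exact Real.rpow_le_rpow_of_exponent_le h1 (by push_cast; linarith)
      exact mul_le_mul (le_abs_self _) h3 (by positivity) (abs_nonneg _)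
    calc |iteratedDeriv i (u y) t| * (1 + t ^ 2) ≤ |C i| * (t ^ 2)⁻¹ * (2 * t ^ 2) := by
          gcongr
          nlinarith
      _ = 2 * |C i| := by
          have : t ≠ 0 := by linarith
          field_simp
      _ ≤ _ := by linarith [abs_nonneg (K i)]
  · have h2 : |iteratedDeriv i (u y) t| ≤ |K i| :=
      (hK i (y, t) ⟨hy, ht, h1.le⟩).trans (le_abs_self _)
    calc |iteratedDeriv i (u y) t| * (1 + t ^ 2) ≤ |K i| * 2 := by
          gcongr
          nlinarith
      _ ≤ _ := by linarith [abs_nonneg (C i)]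

lemma aestronglyMeasurable_im_integral_spaceKernel (hn : 1 ≤ n) (x : Esp n) {f : Esp n → ℂ}
    (hf : Continuous f) (ε : ℝ) :
    AEStronglyMeasurable (fun y => (∫ z, f z * spaceKernel x ε z y).im) (surfMeasure n) := by
  have := isFiniteMeasure_surfMeasure hn
  have h : AEStronglyMeasurable (fun p : Esp n × Esp n => f p.2 * spaceKernel x ε p.2 p.1)
      ((surfMeasure n).prod volume) :=
    (hf.measurable.comp measurable_snd).aestronglyMeasurable.mul
      ((measurable_spaceKernel x ε).comp measurable_swap).aestronglyMeasurable
  exact Complex.continuous_im.comp_aestronglyMeasurable h.integral_prod_right'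

theorem integral_Wtr_norm_sub_eq_zero {n : ℕ} (hn : 2 ≤ n)
    (f : Esp n → ℝ) (hf : ContDiff ℝ (⊤ : ℕ∞) f)
    (hsupp : Function.support f ⊆ Metric.closedBall 0 1)
    (u : Esp n → ℝ → ℝ)
    (hu : ContDiff ℝ (⊤ : ℕ∞) (fun p : Esp n × ℝ => u p.1 p.2))
    (hwave : ∀ x : Esp n, ∀ t : ℝ, 0 ≤ t →
      iteratedDeriv 2 (u x) t = lapl (fun z => u z t) x)
    (hinit : ∀ x, u x 0 = f x)
    (hinit' : ∀ x, deriv (u x) 0 = 0)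
    (hdecay : ∀ k : ℕ, ∃ C : ℝ, ∀ t : ℝ, 1 ≤ t → ∀ y ∈ unitSphere n,
      |iteratedDeriv k (u y) t| ≤ C * t ^ (-(n + k : ℝ)))
    (x : Esp n) (hx : x ∈ Metric.ball (0 : Esp n) 1) :
    ∫ y in unitSphere n, Wtr n (u y) ‖x - y‖ ∂(sphMeasure n) = 0 := by
  have hx1 : ‖x‖ < 1 := by simpa using hx
  have hfin := isFiniteMeasure_surfMeasure (n := n) (by omega)
  have hsupp' : support (fun z => (f z : ℂ)) ⊆ Metric.closedBall 0 1 := fun z hz =>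
    hsupp fun h => hz (by simp [h])
  have hcs : HasCompactSupport fun z => (f z : ℂ) :=
    HasCompactSupport.of_support_subset_isCompact (isCompact_closedBall 0 1) hsupp'
  let φ : 𝓢(Esp n, ℂ) := hcs.toSchwartzMap (Complex.ofRealCLM.contDiff.comp hf)
  have hφ : ∀ z, φ z = f z := fun z => rfl
  have hrep : ∀ x t, 0 ≤ t → (u x t : ℂ) = 2⁻¹ * (waveU (𝓕 φ : 𝓢(Esp n, ℂ)) 1 (x, t) +
      waveU (𝓕 φ : 𝓢(Esp n, ℂ)) 1 (x, -t)) := fun x t ht =>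
    wave_eq_fourier_complex φ (fun z => by simp [hφ]) u (contDiff_infty.1 hu 2) hwave
      (fun z => by simp [hφ, hinit]) hinit' x ht
  obtain ⟨D, hD⟩ := exists_uniform_bound hn hu hdecay
  obtain ⟨c, hc, M, hM⟩ := exists_im_integral_tendsto_Wtr hn (r₀ := (1 - ‖x‖) / 2) (by linarith)
    (by linarith [norm_nonneg x]) D
  have huy : ∀ y, ContDiff ℝ (⊤ : ℕ∞) (u y) := fun y =>
    hu.comp (contDiff_const.prodMk contDiff_id)
  have hint : ∀ y ∈ unitSphere n, IntegrableOn (u y) (Set.Ioi 0) := fun y hy => by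
    refine ((integrable_inv_one_add_sq.const_mul (D 0)).integrableOn).mono'
      (huy y).continuous.aestronglyMeasurable
      ((ae_restrict_mem measurableSet_Ioi).mono fun t ht => ?_)
    simpa [div_eq_mul_inv] using hD y hy 0 t (le_of_lt ht)
  have hs : ∀ y ∈ unitSphere n, 2 * ((1 - ‖x‖) / 2) ≤ ‖x - y‖ ∧ ‖x - y‖ ≤ 2 := fun y hy => by
    have hy1 : ‖y‖ = 1 := by simpa [unitSphere] using hy
    have h1 := norm_sub_norm_le y x
    have h2 := norm_sub_le x y
    rw [norm_sub_rev] at h1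
    constructor <;> linarith
  have hosc := oscConst_pos hn
  have hkey : ∀ y ∈ unitSphere n, ∀ ε : ℝ, 0 < ε → (∫ z, (f z : ℂ) * spaceKernel x ε z y).im =
      (oscConst n)⁻¹ * (∫ t in Set.Ioi 0, (u y t : ℂ) *
        oscKernel (((n : ℝ) - 1) / 2) ε (t ^ 2 - ‖x - y‖ ^ 2)).im := fun y hy ε hε => by
    rw [integral_wave_mul_oscKernel hn φ u hu.continuous hrep y (hint y hy) hε,
      Complex.im_ofReal_mul, inv_mul_cancel_left₀ hosc.ne']
    rfl
  have hε : ∀ m : ℕ, (0 : ℝ) < 1 / ((m : ℝ) + 1) := fun m => by positivity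
  have hε0 := tendsto_one_div_add_atTop_nhds_zero_nat (𝕜 := ℝ)
  have hcont : Continuous fun z => (f z : ℂ) := Complex.continuous_ofReal.comp hf.continuous
  have hlim1 := tendsto_im_integral_spaceKernel_mul hn hx1 hcont hsupp' (by simp) hε hε0
  have hmem : ∀ᵐ y ∂(surfMeasure n), y ∈ unitSphere n := ae_restrict_mem measurableSet_unitSphere
  have hlim2 : Tendsto (fun m : ℕ => ∫ y, (∫ z, (f z : ℂ) *
      spaceKernel x (1 / ((m : ℝ) + 1)) z y).im ∂(surfMeasure n)) atTop
      (𝓝 (∫ y, (oscConst n)⁻¹ * (c * Wtr n (u y) ‖x - y‖) ∂(surfMeasure n))) := by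
    refine tendsto_integral_of_dominated_convergence (fun _ => (oscConst n)⁻¹ * M)
      (fun m => aestronglyMeasurable_im_integral_spaceKernel (by omega) x hcont _)
      (integrable_const _) (fun m => hmem.mono fun y hy => ?_) (hmem.mono fun y hy => ?_)
    · rw [hkey y hy _ (hε m), norm_mul, Real.norm_eq_abs, Real.norm_eq_abs,
        abs_of_pos (inv_pos.2 hosc)]
      gcongr
      exact (hM (u y) (huy y) (hD y hy) _ (hs y hy).1 (hs y hy).2).1 _ (hε m)
    · have h := (hM (u y) (huy y) (hD y hy) _ (hs y hy).1 (hs y hy).2).2 _ hε hε0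
      exact (h.const_mul (oscConst n)⁻¹).congr fun m => (hkey y hy _ (hε m)).symm
  have h0 := tendsto_nhds_unique hlim2 hlim1
  rw [integral_const_mul, integral_const_mul] at h0
  exact ((mul_eq_zero.1 h0).resolve_left (inv_pos.2 hosc).ne' |> mul_eq_zero.1).resolve_left hc

end Helpers

theorem stmt4 {n : ℕ} (hn : 2 ≤ n)
    (f : Esp n → ℝ) (hf : ContDiff ℝ (⊤ : ℕ∞) f)
    (hsupp : Function.support f ⊆ Metric.closedBall 0 1)
    (u : Esp n → ℝ → ℝ)
    (hu : ContDiff ℝ (⊤ : ℕ∞) (fun p : Esp n × ℝ => u p.1 p.2))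
    (hwave : ∀ x : Esp n, ∀ t : ℝ, 0 ≤ t →
      iteratedDeriv 2 (u x) t = lapl (fun z => u z t) x)
    (hinit : ∀ x, u x 0 = f x)
    (hinit' : ∀ x, deriv (u x) 0 = 0)
    (hdecay : ∀ k : ℕ, ∃ C : ℝ, ∀ t : ℝ, 1 ≤ t → ∀ y ∈ unitSphere n,
      |iteratedDeriv k (u y) t| ≤ C * t ^ (-(n + k : ℝ)))
    (x : Esp n) (hx : x ∈ Metric.ball (0 : Esp n) 1) :
    ∫ y in unitSphere n, Wtr n (u y) ‖x - y‖ ∂(sphMeasure n) = 0 :=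
  integral_Wtr_norm_sub_eq_zero hn f hf hsupp u hu hwave hinit hinit' hdecay x hx

end
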